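/- Let A, B be finite algebras in a locally finite Taylor variety, and let ρ ∈ Con(A), σ ∈ Con(B) be irreducible congruences. Then there exists a bridge from (A,ρ) to (B,σ) if and only if A/ρ ∼ B/σ (i.e., A/ρ and B/σ are similar). -/

import Mathlib

namespace Zhuk

/-- A signature: a type of operation symbols with arities. -/
structure Signature where
  ops : Type
  arity : ops → ℕ

/-- An algebra structure of signature `S` on carrier `A`. -/
class SAlg (S : Signature) (A : Type) where
  interp : (o : S.ops) → (Fin (S.arity o) → A) → A

variable {S : Signature}

/-- Componentwise algebra structure on a product. -/
instance prodSAlg {A B : Type} [SAlg S A] [SAlg S B] : SAlg S (A × B) :=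
  ⟨fun o x => (SAlg.interp o fun i => (x i).1, SAlg.interp o fun i => (x i).2)⟩

/-- A subset closed under all the operations. -/
def IsSubuniverse (S : Signature) {A : Type} [SAlg S A] (R : Set A) : Prop :=
  ∀ (o : S.ops) (x : Fin (S.arity o) → A), (∀ i, x i ∈ R) → SAlg.interp o x ∈ R

/-- The algebra structure on (the subtype of) a subuniverse. -/
def subAlg {A : Type} [SAlg S A] (R : Set A) (h : IsSubuniverse S R) : SAlg S ↥R :=
  ⟨fun o x => ⟨SAlg.interp o fun i => (x i).1, h o _ fun i => (x i).2⟩⟩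

/-- Terms of signature `S` in `n` variables. -/
inductive STerm (S : Signature) (n : ℕ) : Type
  | var : Fin n → STerm S n
  | app (o : S.ops) : (Fin (S.arity o) → STerm S n) → STerm S n

/-- Evaluation of a term in an algebra. -/
def STerm.eval {A : Type} [SAlg S A] {n : ℕ} : STerm S n → (Fin n → A) → A
  | .var i, v => v i
  | .app o ts, v => SAlg.interp o fun i => (ts i).eval v

/-- The diagonal (smallest) congruence `0_A`. -/
def diag (A : Type) : Set (A × A) := {p | p.1 = p.2}

/-- Relational composition. -/
def rcomp {A B C : Type} (R : Set (A × B)) (T : Set (B × C)) : Set (A × C) :=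
  {p | ∃ b, (p.1, b) ∈ R ∧ (b, p.2) ∈ T}

/-- Relational inverse. -/
def rinv {A B : Type} (R : Set (A × B)) : Set (B × A) := {p | (p.2, p.1) ∈ R}

/-- Transitive closure of a binary relation (as a set of pairs). -/
def transCl {A : Type} (R : Set (A × A)) : Set (A × A) :=
  {p | Relation.TransGen (fun a b => (a, b) ∈ R) p.1 p.2}

/-- `R` is stable under (saturated with respect to) `ρ`:  `R = ρ ∘ R ∘ ρ`. -/
def Saturated {A : Type} (ρ R : Set (A × A)) : Prop := rcomp ρ (rcomp R ρ) = R

/-- A congruence: a subuniverse of `A²` which is an equivalence relation. -/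
def IsCongruence (S : Signature) {A : Type} [SAlg S A] (θ : Set (A × A)) : Prop :=
  IsSubuniverse S θ ∧ Equivalence fun a b => (a, b) ∈ θ

/-- `ρ ∈ Con*(A)`: a congruence different from the full congruence `1_A`. -/
def ConStar (S : Signature) {A : Type} [SAlg S A] (ρ : Set (A × A)) : Prop :=
  IsCongruence S ρ ∧ ρ ≠ Set.univ

/-- The ternary centralizer relation `C(φ, θ; δ)`, via the term condition. -/
def Centralizes (S : Signature) {A : Type} [SAlg S A] (φ θ δ : Set (A × A)) : Prop :=
  ∀ (n : ℕ) (t : STerm S (n + 1)) (a b : A) (c d : Fin n → A),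
    (a, b) ∈ φ → (∀ i, (c i, d i) ∈ θ) →
    (t.eval (Fin.cons a c), t.eval (Fin.cons a d)) ∈ δ →
    (t.eval (Fin.cons b c), t.eval (Fin.cons b d)) ∈ δ

/-- The centralizer `(δ : θ)`: the largest congruence `φ` with `C(φ, θ; δ)`. -/
def centralizer (S : Signature) {A : Type} [SAlg S A] (δ θ : Set (A × A)) : Set (A × A) :=
  ⋃₀ {φ | IsCongruence S φ ∧ Centralizes S φ θ δ}

/-- A congruence of the subalgebra `A(θ) ≤ A²`, viewed ambiently as a subset of
`(A×A) × (A×A)` whose field is `θ`. -/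
def IsConOn (S : Signature) {A : Type} [SAlg S A] (θ : Set (A × A))
    (Δ : Set ((A × A) × (A × A))) : Prop :=
  Δ ⊆ θ ×ˢ θ ∧ IsSubuniverse S Δ ∧ (∀ p ∈ θ, (p, p) ∈ Δ) ∧
    (∀ p q, (p, q) ∈ Δ → (q, p) ∈ Δ) ∧ (∀ p q r, (p, q) ∈ Δ → (q, r) ∈ Δ → (p, r) ∈ Δ)

/-- `Δ_{θ,α}`: the congruence of `A(θ)` generated by `{((a,a),(b,b)) : (a,b) ∈ α}`. -/
def DeltaCon (S : Signature) {A : Type} [SAlg S A] (θ α : Set (A × A)) :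
    Set ((A × A) × (A × A)) :=
  ⋂₀ {Δ | IsConOn S θ Δ ∧ ∀ a b : A, (a, b) ∈ α → ((a, a), (b, b)) ∈ Δ}

/-- Projection of a quaternary relation to its first two coordinates. -/
def pr12 {A B : Type} (T : Set (A × A × B × B)) : Set (A × A) :=
  {p | ∃ b₁ b₂, (p.1, p.2, b₁, b₂) ∈ T}

/-- Projection of a quaternary relation to its last two coordinates. -/
def pr34 {A B : Type} (T : Set (A × A × B × B)) : Set (B × B) :=
  {q | ∃ a₁ a₂, (a₁, a₂, q.1, q.2) ∈ T}

/-- The trace of a quaternary relation. -/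
def btr {A B : Type} (T : Set (A × A × B × B)) : Set (A × B) :=
  {p | (p.1, p.1, p.2, p.2) ∈ T}

/-- Zhuk's bridges: Definition 4.3 (B0*), (B1*), (B2*). -/
def IsBridge (S : Signature) {A B : Type} [SAlg S A] [SAlg S B]
    (ρ : Set (A × A)) (σ : Set (B × B)) (T : Set (A × A × B × B)) : Prop :=
  IsSubuniverse S T ∧
  (∀ a₁ a₂ b₁ b₂ a₁' a₂', (a₁, a₂, b₁, b₂) ∈ T → (a₁, a₁') ∈ ρ → (a₂, a₂') ∈ ρ →
    (a₁', a₂', b₁, b₂) ∈ T) ∧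
  (∀ a₁ a₂ b₁ b₂ b₁' b₂', (a₁, a₂, b₁, b₂) ∈ T → (b₁, b₁') ∈ σ → (b₂, b₂') ∈ σ →
    (a₁, a₂, b₁', b₂') ∈ T) ∧
  ρ ⊂ pr12 T ∧ σ ⊂ pr34 T ∧
  (∀ a₁ a₂ b₁ b₂, (a₁, a₂, b₁, b₂) ∈ T → ((a₁, a₂) ∈ ρ ↔ (b₁, b₂) ∈ σ))

/-- A bridge from `(A,ρ,L)` to `(B,σ,R)`: a bridge with prescribed anchors. -/
def IsBridgeLR (S : Signature) {A B : Type} [SAlg S A] [SAlg S B]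
    (ρ : Set (A × A)) (σ : Set (B × B)) (L : Set (A × A)) (R : Set (B × B))
    (T : Set (A × A × B × B)) : Prop :=
  IsBridge S ρ σ T ∧ pr12 T = L ∧ pr34 T = R

/-- A reflexive bridge (case `B = A`): `0_A ⊆ tr(T)`. -/
def ReflBridge {A : Type} (T : Set (A × A × A × A)) : Prop :=
  ∀ a : A, (a, a) ∈ btr T

/-- `Cov(ρ)`: the inclusion-minimal ρ-saturated subuniverses of `A²` properly containing ρ. -/
def Cov (S : Signature) {A : Type} [SAlg S A] (ρ : Set (A × A)) : Set (Set (A × A)) :=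
  {L | IsSubuniverse S L ∧ Saturated ρ L ∧ ρ ⊂ L ∧
    ∀ L', IsSubuniverse S L' → Saturated ρ L' → ρ ⊂ L' → L' ⊆ L → L' = L}

/-- `ref.tr(ρ,L)`: traces of reflexive bridges from `(A,ρ,L)` to itself. -/
def refTr (S : Signature) {A : Type} [SAlg S A] (ρ L : Set (A × A)) : Set (Set (A × A)) :=
  {γ | ∃ T : Set (A × A × A × A), IsBridgeLR S ρ ρ L L T ∧ ReflBridge T ∧ btr T = γ}

/-- `γ = Opt(ρ,L)`: `γ` is the (unique) inclusion-maximal member of `ref.tr(ρ,L)`. -/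
def IsOptOf (S : Signature) {A : Type} [SAlg S A] (ρ L γ : Set (A × A)) : Prop :=
  γ ∈ refTr S ρ L ∧ ∀ δ ∈ refTr S ρ L, γ ⊆ δ → δ = γ

/-- `ρ` is meet-irreducible with unique upper cover `ρplus`. -/
def MeetIrredWith (S : Signature) {A : Type} [SAlg S A] (ρ ρplus : Set (A × A)) : Prop :=
  IsCongruence S ρ ∧ ρ ≠ Set.univ ∧ IsCongruence S ρplus ∧ ρ ⊂ ρplus ∧
    ∀ θ, IsCongruence S θ → ρ ⊂ θ → ρplus ⊆ θ

/-- `Cov⁺(ρ) = {τ ∈ Cov(ρ) : τ ⊆ ρ⁺}`. -/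
def CovPlus (S : Signature) {A : Type} [SAlg S A] (ρ ρplus : Set (A × A)) :
    Set (Set (A × A)) :=
  {τ | τ ∈ Cov S ρ ∧ τ ⊆ ρplus}

/-- A good bridge between meet-irreducible congruences with upper covers `ρplus`, `σplus`. -/
def GoodBridge (S : Signature) {A B : Type} [SAlg S A] [SAlg S B]
    (ρ ρplus : Set (A × A)) (σ σplus : Set (B × B)) (T : Set (A × A × B × B)) : Prop :=
  IsBridge S ρ σ T ∧
    ∃ τ ∈ CovPlus S ρ ρplus, ∃ τ' ∈ CovPlus S σ σplus, ∃ T' ⊆ T,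
      IsBridgeLR S ρ σ τ τ' T' ∧ btr T' = btr T

/-- `t` (with Taylor-identity data `u v`) is idempotent on `A` and satisfies the
corresponding identities on `A`. -/
def TaylorOn (S : Signature) (A : Type) [SAlg S A] {n : ℕ} (t : STerm S n)
    (u v : Fin n → Fin n → Fin 2) : Prop :=
  (∀ a : A, t.eval (fun _ => a) = a) ∧
    ∀ (i : Fin n) (x y : A),
      t.eval (fun j => if u i j = 0 then x else y) =
        t.eval (fun j => if v i j = 0 then x else y)

/-- `A` is a Taylor algebra. -/
def IsTaylorAlg (S : Signature) (A : Type) [SAlg S A] : Prop :=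
  ∃ (n : ℕ) (t : STerm S n) (u v : Fin n → Fin n → Fin 2),
    1 < n ∧ (∀ i, u i i ≠ v i i) ∧ TaylorOn S A t u v

/-- `A` and `B` lie in a common (locally finite, as they are finite) Taylor variety:
they share a common Taylor term with common Taylor identities. -/
def CommonTaylor (S : Signature) (A B : Type) [SAlg S A] [SAlg S B] : Prop :=
  ∃ (n : ℕ) (t : STerm S n) (u v : Fin n → Fin n → Fin 2),
    1 < n ∧ (∀ i, u i i ≠ v i i) ∧ TaylorOn S A t u v ∧ TaylorOn S B t u v

/-- The quotient of `A` by (the equivalence relation of) `θ`. -/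
abbrev ConQuot {A : Type} (θ : Set (A × A)) : Type :=
  Quot (fun a b => (a, b) ∈ θ)

/-- The class of `a` in `A/θ`. -/
def ConQuot.mk {A : Type} (θ : Set (A × A)) (a : A) : ConQuot θ :=
  Quot.mk _ a

/-- The quotient algebra structure on `A/θ` (extensionally correct when `θ` is a
congruence). -/
noncomputable def quotAlg {S : Signature} {A : Type} (iA : SAlg S A) (θ : Set (A × A)) :
    SAlg S (ConQuot θ) :=
  ⟨fun o x => ConQuot.mk θ
    (@SAlg.interp S A iA o fun i => Classical.choose (Quot.exists_rep (x i)))⟩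

/-- `f` is a homomorphism with respect to the given algebra structures. -/
def IsHomI {S : Signature} {A B : Type} (iA : SAlg S A) (iB : SAlg S B) (f : A → B) : Prop :=
  ∀ (o : S.ops) (x : Fin (S.arity o) → A),
    f (@SAlg.interp S A iA o x) = @SAlg.interp S B iB o fun i => f (x i)

/-- The two algebras are isomorphic. -/
def IsoAlgI {S : Signature} {A B : Type} (iA : SAlg S A) (iB : SAlg S B) : Prop :=
  ∃ f : A ≃ B, IsHomI iA iB f

/-- The identity bridge `I_{(A,ρ,L)}`. -/
def idBridge {A : Type} (ρ L : Set (A × A)) : Set (A × A × A × A) :=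
  {p | (p.1, p.2.1) ∈ L ∧ (p.2.2.1, p.2.2.2) ∈ L ∧ (p.1, p.2.2.1) ∈ ρ ∧ (p.2.1, p.2.2.2) ∈ ρ}

/-- Composition of quaternary relations (bridges). -/
def bComp {A B C : Type} (T : Set (A × A × B × B)) (T' : Set (B × B × C × C)) :
    Set (A × A × C × C) :=
  {p | ∃ b₁ b₂, (p.1, p.2.1, b₁, b₂) ∈ T ∧ (b₁, b₂, p.2.2.1, p.2.2.2) ∈ T'}

/-- Converse of a quaternary relation (bridge). -/
def bConv {A B : Type} (T : Set (A × A × B × B)) : Set (B × B × A × A) :=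
  {p | (p.2.2.1, p.2.2.2, p.1, p.2.1) ∈ T}

/-- `Δ♭_{θ,α}`: the congruence `Δ_{θ,α}` of `A(θ)` viewed as a quaternary relation. -/
def deltaFlat (S : Signature) {A : Type} [SAlg S A] (θ α : Set (A × A)) :
    Set (A × A × A × A) :=
  {p | ((p.1, p.2.1), (p.2.2.1, p.2.2.2)) ∈ DeltaCon S θ α}

/-- `T^opt_{(A,ρ)} = I_{(A,ρ,ρ⁺)} ∘ Δ♭_{ρ⁺,(ρ:ρ⁺)} ∘ I_{(A,ρ,ρ⁺)}`. -/
def Topt (S : Signature) {A : Type} [SAlg S A] (ρ ρplus : Set (A × A)) :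
    Set (A × A × A × A) :=
  bComp (idBridge ρ ρplus)
    (bComp (deltaFlat S ρplus (centralizer S ρ ρplus)) (idBridge ρ ρplus))

/-- `A` is subdirectly irreducible with monolith `μ`. -/
def IsMonolith (S : Signature) {A : Type} [SAlg S A] (μ : Set (A × A)) : Prop :=
  IsCongruence S μ ∧ μ ≠ diag A ∧ ∀ θ, IsCongruence S θ → θ ≠ diag A → μ ⊆ θ

/-- The carrier of `D(A,θ)`-style quotients: `A(μ)/Δ_{μ,α}`. -/
abbrev DCar (S : Signature) (A : Type) [SAlg S A] (μ α : Set (A × A)) : Type :=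
  Quot (fun p q : ↥μ => ((p : A × A), (q : A × A)) ∈ DeltaCon S μ α)

/-- The class of a pair `p ∈ μ` in `A(μ)/Δ_{μ,α}`. -/
def DCar.mk (S : Signature) (A : Type) [SAlg S A] (μ α : Set (A × A)) (p : ↥μ) :
    DCar S A μ α :=
  Quot.mk _ p

/-- The algebra structure on `A(μ)/Δ_{μ,α}` (extensionally correct when `μ` is a
congruence and `Δ_{μ,α}` is a congruence of `A(μ)`). -/
noncomputable def DAlg (S : Signature) (A : Type) [SAlg S A] (μ α : Set (A × A))
    (h : IsSubuniverse S μ) : SAlg S (DCar S A μ α) :=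
  letI := subAlg μ h
  ⟨fun o x => DCar.mk S A μ α
    (SAlg.interp o fun i => Classical.choose (Quot.exists_rep (x i)))⟩

/-- The canonical similarity bridge `T_{D(A)}` from `A` to `D(A)`. -/
def TDBridge (S : Signature) (A : Type) [SAlg S A] (μ α : Set (A × A)) :
    Set (A × A × DCar S A μ α × DCar S A μ α) :=
  {x | ∃ (a b e : A) (_ : (a, b) ∈ μ) (h1 : (a, e) ∈ μ) (h2 : (b, e) ∈ μ),
    x = (a, b, DCar.mk S A μ α ⟨(a, e), h1⟩, DCar.mk S A μ α ⟨(b, e), h2⟩)}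

/-- Similarity of (subdirectly irreducible) algebras: `D(A) ≅ D(B)`, where `D(X)` is
`X(μ)/Δ_{μ,(0:μ)}` if the monolith `μ` is abelian, and `X` itself otherwise. -/
def SimilarI (S : Signature) {A B : Type} (iA : SAlg S A) (iB : SAlg S B) : Prop :=
  letI := iA
  letI := iB
  ∃ (μA : Set (A × A)) (μB : Set (B × B)) (hA : IsMonolith S μA) (hB : IsMonolith S μB),
    ((Centralizes S μA μA (diag A) ∧ Centralizes S μB μB (diag B)) →
      IsoAlgI (DAlg S A μA (centralizer S (diag A) μA) hA.1.1)
        (DAlg S B μB (centralizer S (diag B) μB) hB.1.1)) ∧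
    ((Centralizes S μA μA (diag A) ∧ ¬ Centralizes S μB μB (diag B)) →
      IsoAlgI (DAlg S A μA (centralizer S (diag A) μA) hA.1.1) iB) ∧
    ((¬ Centralizes S μA μA (diag A) ∧ Centralizes S μB μB (diag B)) →
      IsoAlgI iA (DAlg S B μB (centralizer S (diag B) μB) hB.1.1)) ∧
    ((¬ Centralizes S μA μA (diag A) ∧ ¬ Centralizes S μB μB (diag B)) →
      IsoAlgI iA iB)

end Zhuk

namespace Zhuk

variable {S : Signature}

section Basics
variable {A B C : Type} [SAlg S A] [SAlg S B] [SAlg S C]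

theorem eval_prod {n : ℕ} (t : STerm S n) (v : Fin n → A × B) :
    t.eval v = (t.eval (fun i => (v i).1), t.eval fun i => (v i).2) := by
  induction t with
  | var i => rfl
  | app o ts ih =>
    simp only [STerm.eval, ih]
    rfl

theorem IsSubuniverse.eval {R : Set A} (h : IsSubuniverse S R) {n : ℕ} (t : STerm S n)
    (v : Fin n → A) (hv : ∀ i, v i ∈ R) : t.eval v ∈ R := by
  induction t with
  | var i => exact hv i
  | app o ts ih => exact h o _ ih

theorem IsSubuniverse.eval_pair {R : Set (A × B)} (h : IsSubuniverse S R) {n : ℕ}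
    (t : STerm S n) (x : Fin n → A) (y : Fin n → B) (hxy : ∀ i, (x i, y i) ∈ R) :
    (t.eval x, t.eval y) ∈ R := by
  have := h.eval t (fun i => (x i, y i)) hxy
  rwa [eval_prod] at this

theorem IsSubuniverse.eval_quad {D : Type} [SAlg S D] {T : Set (A × B × C × D)}
    (h : IsSubuniverse S T) {n : ℕ}
    (t : STerm S n) (x : Fin n → A) (y : Fin n → B) (z : Fin n → C) (w : Fin n → D)
    (hT : ∀ i, (x i, y i, z i, w i) ∈ T) :
    (t.eval x, t.eval y, t.eval z, t.eval w) ∈ T := by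
  have := h.eval t (fun i => (x i, y i, z i, w i)) hT
  rwa [eval_prod, eval_prod, eval_prod] at this

theorem IsSubuniverse.eval_quad_cons {D : Type} [SAlg S D] {T : Set (A × B × C × D)}
    (h : IsSubuniverse S T) {n : ℕ} (t : STerm S (n + 1)) {a : A} {b : B} {c : C} {d : D}
    {x : Fin n → A} {y : Fin n → B} {z : Fin n → C} {w : Fin n → D}
    (h0 : (a, b, c, d) ∈ T) (hT : ∀ i, (x i, y i, z i, w i) ∈ T) :
    (t.eval (Fin.cons a x), t.eval (Fin.cons b y), t.eval (Fin.cons c z),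
      t.eval (Fin.cons d w)) ∈ T :=
  h.eval_quad t _ _ _ _ (Fin.cases h0 hT)

theorem IsSubuniverse.eval_pair_cons {R : Set (A × B)} (h : IsSubuniverse S R) {n : ℕ}
    (t : STerm S (n + 1)) {a : A} {b : B} {x : Fin n → A} {y : Fin n → B}
    (h0 : (a, b) ∈ R) (hR : ∀ i, (x i, y i) ∈ R) :
    (t.eval (Fin.cons a x), t.eval (Fin.cons b y)) ∈ R :=
  h.eval_pair t _ _ (Fin.cases h0 hR)

theorem IsSubuniverse.eval_quad_three {D : Type} [SAlg S D] {T : Set (A × B × C × D)}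
    (h : IsSubuniverse S T) (t : STerm S 3) {a a' a'' : A} {b b' b'' : B} {c c' c'' : C}
    {d d' d'' : D} (h0 : (a, b, c, d) ∈ T) (h1 : (a', b', c', d') ∈ T)
    (h2 : (a'', b'', c'', d'') ∈ T) :
    (t.eval ![a, a', a''], t.eval ![b, b', b''], t.eval ![c, c', c''],
      t.eval ![d, d', d'']) ∈ T := by
  refine h.eval_quad t _ _ _ _ fun i => ?_
  fin_cases i <;> assumption

theorem IsSubuniverse.eval_pair_three {R : Set (A × B)} (h : IsSubuniverse S R)
    (t : STerm S 3) {a a' a'' : A} {b b' b'' : B}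
    (h0 : (a, b) ∈ R) (h1 : (a', b') ∈ R) (h2 : (a'', b'') ∈ R) :
    (t.eval ![a, a', a''], t.eval ![b, b', b'']) ∈ R := by
  refine h.eval_pair t _ _ fun i => ?_
  fin_cases i <;> assumption

theorem eval_prod_three (t : STerm S 3) (p q r : A × B) :
    t.eval ![p, q, r] = (t.eval ![p.1, q.1, r.1], t.eval ![p.2, q.2, r.2]) := by
  rw [eval_prod]
  congr 2 <;> funext i <;> fin_cases i <;> rfl

/-- Polynomial operations in the variables indexed by `ι`. -/
inductive IsPol (S : Signature) {A : Type} [SAlg S A] {ι : Type} : ((ι → A) → A) → Prop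
  | proj (i : ι) : IsPol S fun x => x i
  | const (a : A) : IsPol S fun _ => a
  | app (o : S.ops) (f : Fin (S.arity o) → (ι → A) → A) (h : ∀ i, IsPol S (f i)) :
      IsPol S fun x => SAlg.interp o fun i => f i x

theorem IsPol.comp {ι κ : Type} {f : (ι → A) → A} (hf : IsPol S f) {g : ι → (κ → A) → A}
    (hg : ∀ i, IsPol S (g i)) : IsPol S fun x => f fun i => g i x := by
  induction hf with
  | proj i => exact hg i
  | const a => exact .const a
  | app o f _ ih => exact .app o _ ih

theorem IsPol.term {ι : Type} {n : ℕ} (t : STerm S n) {g : Fin n → (ι → A) → A}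
    (hg : ∀ i, IsPol S (g i)) : IsPol S fun x => t.eval fun i => g i x := by
  induction t with
  | var i => exact hg i
  | app o ts ih => exact .app o _ ih

/-- Unary polynomials. -/
def IsPol1 (S : Signature) {A : Type} [SAlg S A] (f : A → A) : Prop :=
  IsPol S fun x : Unit → A => f (x ())

/-- Binary polynomials. -/
def IsPol2 (S : Signature) {A : Type} [SAlg S A] (f : A → A → A) : Prop :=
  IsPol S fun x : Fin 2 → A => f (x 0) (x 1)

/-- Ternary polynomials. -/
def IsPol3 (S : Signature) {A : Type} [SAlg S A] (f : A → A → A → A) : Prop :=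
  IsPol S fun x : Fin 3 → A => f (x 0) (x 1) (x 2)

theorem IsPol1.app {f : A → A} (hf : IsPol1 S f) {ι : Type} {g : (ι → A) → A}
    (hg : IsPol S g) : IsPol S fun x => f (g x) :=
  IsPol.comp hf fun _ => hg

theorem IsPol2.app {f : A → A → A} (hf : IsPol2 S f) {ι : Type} {g h : (ι → A) → A}
    (hg : IsPol S g) (hh : IsPol S h) : IsPol S fun x => f (g x) (h x) := by
  have := IsPol.comp hf (g := ![g, h]) (fun i => by fin_cases i <;> assumption)
  exact this

theorem IsPol3.app {f : A → A → A → A} (hf : IsPol3 S f) {ι : Type} {g h k : (ι → A) → A}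
    (hg : IsPol S g) (hh : IsPol S h) (hk : IsPol S k) :
    IsPol S fun x => f (g x) (h x) (k x) := by
  have := IsPol.comp hf (g := ![g, h, k]) (fun i => by fin_cases i <;> assumption)
  exact this

theorem IsPol1.id : IsPol1 S (fun x : A => x) := IsPol.proj ()

theorem IsPol1.comp {f g : A → A} (hf : IsPol1 S f) (hg : IsPol1 S g) :
    IsPol1 S (fun x => f (g x)) := IsPol1.app hf hg

theorem IsPol1.iterate {f : A → A} (hf : IsPol1 S f) (n : ℕ) : IsPol1 S (f^[n]) := by
  induction n with
  | zero => exact IsPol1.id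
  | succ n ih => exact ih.comp hf

theorem IsPol2.iterate {f : A → A → A} (hf : IsPol2 S f) {ι : Type} {g h : (ι → A) → A}
    (hg : IsPol S g) (hh : IsPol S h) (n : ℕ) : IsPol S fun x => (f (g x))^[n] (h x) := by
  induction n with
  | zero => exact hh
  | succ n ih =>
    simp only [Function.iterate_succ_apply']
    exact hf.app hg ih

theorem IsPol.mem {ι : Type} {f : (ι → A) → A} (hf : IsPol S f) {R : Set (A × A)}
    (hR : IsSubuniverse S R) (hr : ∀ a, (a, a) ∈ R) {x y : ι → A} (h : ∀ i, (x i, y i) ∈ R) :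
    (f x, f y) ∈ R := by
  induction hf with
  | proj i => exact h i
  | const a => exact hr a
  | app o f _ ih => exact hR o (fun i => (f i x, f i y)) ih

theorem IsPol1.mem {f : A → A} (hf : IsPol1 S f) {R : Set (A × A)}
    (hR : IsSubuniverse S R) (hr : ∀ a, (a, a) ∈ R) {x y : A} (h : (x, y) ∈ R) :
    (f x, f y) ∈ R :=
  IsPol.mem hf hR hr (x := fun _ => x) (y := fun _ => y) fun _ => h

theorem IsPol2.mem {f : A → A → A} (hf : IsPol2 S f) {R : Set (A × A)}
    (hR : IsSubuniverse S R) (hr : ∀ a, (a, a) ∈ R) {x y x' y' : A} (h : (x, y) ∈ R)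
    (h' : (x', y') ∈ R) : (f x x', f y y') ∈ R :=
  IsPol.mem hf hR hr (x := ![x, x']) (y := ![y, y']) fun i => by fin_cases i <;> assumption

theorem IsPol3.mem {f : A → A → A → A} (hf : IsPol3 S f) {R : Set (A × A)}
    (hR : IsSubuniverse S R) (hr : ∀ a, (a, a) ∈ R) {x y x' y' x'' y'' : A} (h : (x, y) ∈ R)
    (h' : (x', y') ∈ R) (h'' : (x'', y'') ∈ R) : (f x x' x'', f y y' y'') ∈ R :=
  IsPol.mem hf hR hr (x := ![x, x', x'']) (y := ![y, y', y'']) fun i => by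
    fin_cases i <;> assumption

theorem IsPol.exists_term_update {ι : Type} [DecidableEq ι] {n : ℕ} (E : Fin n ≃ ι ⊕ A) (i₀ : ι)
    {f : (ι → A) → A} (hf : IsPol S f) :
    ∃ t : STerm S (n + 1), ∀ (x : ι → A) (a : A),
      f (Function.update x i₀ a) = t.eval (Fin.cons a fun j => Sum.elim x id (E j)) := by
  induction hf with
  | proj i =>
    by_cases h : i = i₀
    · subst h
      exact ⟨.var 0, fun x a => by simp [STerm.eval]⟩
    · exact ⟨.var (E.symm (.inl i)).succ, fun x a => by simp [STerm.eval, h]⟩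
  | const a => exact ⟨.var (E.symm (.inr a)).succ, fun x a => by simp [STerm.eval]⟩
  | app o f _ ih =>
    choose t ht using ih
    refine ⟨.app o t, fun x a => ?_⟩
    simp only [STerm.eval, ht]

theorem Centralizes.update [Finite A] {ι : Type} [Finite ι] [DecidableEq ι] {φ θ : Set (A × A)}
    (h : Centralizes S φ θ (diag A)) (hθ : ∀ a, (a, a) ∈ θ)
    {f : (ι → A) → A} (hf : IsPol S f) (i₀ : ι) {a b : A} (hab : (a, b) ∈ φ) {u v : ι → A}
    (huv : ∀ i, i ≠ i₀ → (u i, v i) ∈ θ)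
    (he : f (Function.update u i₀ a) = f (Function.update v i₀ a)) :
    f (Function.update u i₀ b) = f (Function.update v i₀ b) := by
  obtain ⟨n, ⟨E⟩⟩ := Finite.exists_equiv_fin (ι ⊕ A)
  obtain ⟨t, ht⟩ := hf.exists_term_update E.symm i₀
  have hv : ∀ c, Function.update v i₀ c = Function.update (Function.update v i₀ (u i₀)) i₀ c := by
    simp
  rw [hv, ht, ht] at he
  rw [hv, ht, ht]
  refine h n t a b _ _ hab (fun j => ?_) he
  rcases E.symm j with i | c
  · by_cases hi : i = i₀
    · subst hi
      simpa using hθ _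
    · simpa [hi] using huv i hi
  · exact hθ c

/-- The term condition for polynomials with both kinds of variables allowed to occur
several times. -/
theorem Centralizes.matrix [Finite A] {ι : Type} [Finite ι] {φ θ : Set (A × A)}
    (h : Centralizes S φ θ (diag A)) (hθ : ∀ a, (a, a) ∈ θ)
    {f : (ι → A) → A} (hf : IsPol S f) {x y z w : ι → A}
    (hi : ∀ i, (x i = y i ∧ z i = w i ∧ (x i, z i) ∈ φ) ∨
      (x i = z i ∧ y i = w i ∧ (x i, y i) ∈ θ))
    (he : f x = f y) : f z = f w := by
  classical
  have := Fintype.ofFinite ι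
  have key : ∀ s : Finset ι, f (s.piecewise z x) = f (s.piecewise w y) := by
    intro s
    induction s using Finset.induction_on with
    | empty => simpa using he
    | insert i s his ih =>
      rw [Finset.piecewise_insert, Finset.piecewise_insert]
      have e1 : s.piecewise z x = Function.update (s.piecewise z x) i (x i) := by
        rw [Function.eq_update_iff]; simp [his]
      have e2 : s.piecewise w y = Function.update (s.piecewise w y) i (y i) := by
        rw [Function.eq_update_iff]; simp [his]
      rcases hi i with ⟨h1, h2, h3⟩ | ⟨h1, h2, h3⟩
      · rw [e1, e2, ← h1] at ih
        rw [← h2]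
        refine h.update hθ hf i h3 (fun j _ => ?_) ih
        by_cases hj : j ∈ s
        · rcases hi j with ⟨h1, h2, h3⟩ | ⟨h1, h2, h3⟩
          · simpa [hj, h2] using hθ _
          · simpa [hj, ← h1, ← h2] using h3
        · rcases hi j with ⟨h1, h2, h3⟩ | ⟨h1, h2, h3⟩
          · simpa [hj, h1] using hθ _
          · simpa [hj] using h3
      · rw [← h1, ← h2, ← e1, ← e2]
        exact ih
  simpa using key Finset.univ

theorem transCl_subuniverse {X : Type} [SAlg S X] {R : Set (X × X)} (hR : IsSubuniverse S R)
    (hr : ∀ p q, (p, q) ∈ R → (p, p) ∈ R ∧ (q, q) ∈ R) : IsSubuniverse S (transCl R) := by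
  intro o z hz
  let x := fun i => (z i).1
  let y := fun i => (z i).2
  have hz' : ∀ i, Relation.TransGen (fun a b => (a, b) ∈ R) (x i) (y i) := hz
  have hx : ∀ i, (x i, x i) ∈ R := fun i => by
    obtain ⟨c, hc, -⟩ := Relation.TransGen.head'_iff.1 (hz' i)
    exact (hr _ _ hc).1
  have hy : ∀ i, (y i, y i) ∈ R := fun i => by
    obtain ⟨c, -, hc⟩ := Relation.TransGen.tail'_iff.1 (hz' i)
    exact (hr _ _ hc).2
  have key : ∀ s : Finset (Fin (S.arity o)), Relation.TransGen (fun a b => (a, b) ∈ R)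
      (SAlg.interp o x) (SAlg.interp o (s.piecewise y x)) := by
    intro s
    induction s using Finset.induction_on with
    | empty =>
      rw [Finset.piecewise_empty]
      exact .single (hR o (fun i => (x i, x i)) hx)
    | insert i s his ih =>
      rw [Finset.piecewise_insert]
      refine ih.trans ?_
      have e1 : s.piecewise y x = Function.update (s.piecewise y x) i (x i) := by
        rw [Function.eq_update_iff]; simp [his]
      rw [e1, Function.update_idem]
      have hs : ∀ j, (s.piecewise y x j, s.piecewise y x j) ∈ R := fun j => by
        by_cases hj : j ∈ s
        · simpa [hj] using hy j
        · simpa [hj] using hx j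
      have step : ∀ a b, (a, b) ∈ R →
          (SAlg.interp o (Function.update (s.piecewise y x) i a),
            SAlg.interp o (Function.update (s.piecewise y x) i b)) ∈ R := fun a b hab => by
        refine hR o (fun j => (Function.update (s.piecewise y x) i a j,
          Function.update (s.piecewise y x) i b j)) fun j => ?_
        by_cases hj : j = i
        · subst hj; simpa using hab
        · simpa [hj] using hs j
      exact Relation.TransGen.lift (fun a => SAlg.interp o (Function.update (s.piecewise y x) i a))
        step _ _ (hz' i)
  have := key Finset.univ
  rw [Finset.piecewise_univ] at this
  exact this

end Basics

theorem exists_pow_idempotent (M : Type*) [Monoid M] [Finite M] :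
    ∃ k : ℕ, 0 < k ∧ ∀ a : M, a ^ k * a ^ k = a ^ k := by
  have := Fintype.ofFinite M
  have h1 : ∀ a : M, ∃ n : ℕ, 0 < n ∧ a ^ n * a ^ n = a ^ n := by
    intro a
    obtain ⟨i, j, hij, he⟩ := Set.Finite.exists_lt_map_eq_of_forall_mem (f := fun n : ℕ => a ^ n)
      (t := Set.univ) (fun _ => Set.mem_univ _) Set.finite_univ
    obtain ⟨d, rfl⟩ := Nat.exists_eq_add_of_lt hij
    have he : a ^ i = a ^ (i + (d + 1)) := he
    have h2 : ∀ t : ℕ, a ^ (i + (d + 1) * t) = a ^ i := by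
      intro t
      induction t with
      | zero => simp
      | succ t ih =>
        rw [Nat.mul_succ, show i + ((d + 1) * t + (d + 1)) = (i + (d + 1)) + (d + 1) * t by ring,
          pow_add, ← he, ← pow_add, ih]
    refine ⟨(d + 1) * (i + 1), by positivity, ?_⟩
    have h3 : (d + 1) * (i + 1) = i + (d * i + d + 1) := by ring
    calc a ^ ((d + 1) * (i + 1)) * a ^ ((d + 1) * (i + 1))
        = a ^ (i + (d + 1) * (i + 1)) * a ^ (d * i + d + 1) := by
          rw [← pow_add, ← pow_add]; congr 1; ring
      _ = a ^ ((d + 1) * (i + 1)) := by rw [h2, ← pow_add, h3]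
  choose n hn hi using h1
  refine ⟨∏ a, n a, Finset.prod_pos fun a _ => hn a, fun a => ?_⟩
  obtain ⟨m, hm⟩ := Finset.dvd_prod_of_mem n (Finset.mem_univ a)
  have hi' : ∀ m : ℕ, 0 < m → (a ^ n a) ^ m = a ^ n a := by
    intro m hm
    obtain ⟨m, rfl⟩ := Nat.exists_eq_succ_of_ne_zero hm.ne'
    exact IsIdempotentElem.pow_succ_eq m (hi a)
  have hm0 : 0 < m := Nat.pos_of_ne_zero fun h0 =>
    (Finset.prod_pos fun a (_ : a ∈ Finset.univ) => hn a).ne' (by rw [hm, h0, mul_zero])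
  rw [hm, pow_mul, hi' m hm0, hi]

theorem exists_iterate_idempotent (A : Type) [Finite A] :
    ∃ k : ℕ, 0 < k ∧ ∀ (f : A → A) (x : A), f^[k] (f^[k] x) = f^[k] x := by
  have : Finite (Function.End A) := inferInstanceAs (Finite (A → A))
  obtain ⟨k, hk, h⟩ := exists_pow_idempotent (Function.End A)
  refine ⟨k, hk, fun f x => ?_⟩
  have h2 : ∀ (g : Function.End A) (n : ℕ) (x : A), (g ^ n : Function.End A) x = g^[n] x := by
    intro g n
    induction n with
    | zero => exact fun _ => rfl
    | succ n ih => exact fun x => by rw [pow_succ]; exact ih (g x)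
  rw [← h2 f, ← h2 f]
  exact congrFun (h f) x

section Irr
variable {A : Type} [SAlg S A]

/-- `τ` is the least reflexive subuniverse of `A²` different from the diagonal. -/
structure Irr (S : Signature) {A : Type} [SAlg S A] (τ : Set (A × A)) : Prop where
  sub : IsSubuniverse S τ
  refl : ∀ a, (a, a) ∈ τ
  nontriv : ∃ a b, (a, b) ∈ τ ∧ a ≠ b
  least : ∀ R, IsSubuniverse S R → (∀ a, (a, a) ∈ R) → ∀ a b, (a, b) ∈ R → a ≠ b → τ ⊆ R

variable {τ μ : Set (A × A)}

theorem IsSubuniverse.rinv {B : Type} [SAlg S B] {R : Set (A × B)} (h : IsSubuniverse S R) :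
    IsSubuniverse S (rinv R) :=
  fun o x hx => h o (fun i => ((x i).2, (x i).1)) hx

theorem Irr.symm (h : Irr S τ) {a b : A} (hab : (a, b) ∈ τ) : (b, a) ∈ τ := by
  obtain ⟨c, d, hcd, hne⟩ := h.nontriv
  exact h.least (Zhuk.rinv τ) h.sub.rinv h.refl d c hcd hne.symm hab

theorem subset_transCl (τ : Set (A × A)) : τ ⊆ transCl τ := fun _ hp => .single hp

theorem transCl_imp {E : A → A → Prop} (hE : Equivalence E)
    (h : ∀ a b, (a, b) ∈ τ → E a b) {x y : A} (hxy : (x, y) ∈ transCl τ) : E x y := by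
  have hxy' : Relation.TransGen (fun a b => (a, b) ∈ τ) x y := hxy
  clear hxy
  induction hxy' with
  | single hb => exact h _ _ hb
  | tail _ hbc ih => exact hE.trans ih (h _ _ hbc)

theorem Irr.transCl_congr (h : Irr S τ) : IsCongruence S (transCl τ) := by
  refine ⟨transCl_subuniverse h.sub fun p q _ => ⟨h.refl p, h.refl q⟩, fun a => .single (h.refl a),
    fun {a b} hab => ?_, fun {a b c} hab hbc => Relation.TransGen.trans hab hbc⟩
  have hab' : Relation.TransGen (fun a b => (a, b) ∈ τ) a b := hab
  clear hab
  induction hab' with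
  | single hb => exact .single (h.symm hb)
  | tail _ hbc ih => exact Relation.TransGen.head (h.symm hbc) ih

theorem Irr.monolith (h : Irr S τ) : IsMonolith S (transCl τ) := by
  refine ⟨h.transCl_congr, fun he => ?_, fun θ hθ hne => ?_⟩
  · obtain ⟨a, b, hab, hn⟩ := h.nontriv
    have := subset_transCl τ hab
    rw [he] at this
    exact hn this
  · have : ∃ a b, (a, b) ∈ θ ∧ a ≠ b := by
      by_contra! hc
      exact hne (Set.ext fun p => ⟨fun hp => hc _ _ hp, fun hp => by
        obtain ⟨a, b⟩ := p
        have hp : a = b := hp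
        subst hp
        exact hθ.2.refl a⟩)
    obtain ⟨a, b, hab, hn⟩ := this
    have hsub := h.least θ hθ.1 hθ.2.refl a b hab hn
    rintro ⟨x, y⟩ hxy
    exact transCl_imp hθ.2 (fun a b hab => hsub hab) hxy

theorem Irr.monolith_unique (h : Irr S τ) (hμ : IsMonolith S μ) : μ = transCl τ :=
  (hμ.2.2 _ h.monolith.1 h.monolith.2.1).antisymm (h.monolith.2.2 _ hμ.1 hμ.2.1)

theorem Irr.exists_pol (h : Irr S τ) {a b c d : A} (hab : a ≠ b) (hcd : (c, d) ∈ τ) :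
    ∃ f : A → A, IsPol1 S f ∧ f a = c ∧ f b = d := by
  have hR := h.least {p | ∃ f : A → A, IsPol1 S f ∧ f a = p.1 ∧ f b = p.2} ?_
    (fun c => ⟨fun _ => c, IsPol.const c, rfl, rfl⟩) a b ⟨_, IsPol1.id, rfl, rfl⟩ hab hcd
  · exact hR
  · intro o x hx
    choose f hf h1 h2 using hx
    refine ⟨fun z => SAlg.interp o fun i => f i z, IsPol.app o _ hf, ?_, ?_⟩
    · simp only [h1]; rfl
    · simp only [h2]; rfl

/-- The polynomial form of the centralizer `(0 : μ)`. -/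
def alph (S : Signature) {A : Type} [SAlg S A] (μ : Set (A × A)) : Set (A × A) :=
  {p | ∀ f : ((Unit ⊕ μ) → A) → A, IsPol S f →
    (f (Sum.elim (fun _ => p.1) fun q => q.1.1) = f (Sum.elim (fun _ => p.1) fun q => q.1.2) ↔
      f (Sum.elim (fun _ => p.2) fun q => q.1.1) = f (Sum.elim (fun _ => p.2) fun q => q.1.2))}

theorem alph_congr (μ : Set (A × A)) : IsCongruence S (alph S μ) := by
  classical
  refine ⟨fun o z hz f hf => ?_, fun a f _ => Iff.rfl, fun {a b} h f hf => (h f hf).symm,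
    fun {a b c} h h' f hf => (h f hf).trans (h' f hf)⟩
  let x := fun i => (z i).1
  let y := fun i => (z i).2
  have hz' : ∀ i, (x i, y i) ∈ alph S μ := hz
  let F : (Fin (S.arity o) → A) → Prop := fun u =>
    f (Sum.elim (fun _ => SAlg.interp o u) fun q => q.1.1) =
      f (Sum.elim (fun _ => SAlg.interp o u) fun q => q.1.2)
  have step : ∀ (u : Fin (S.arity o) → A) i a b, (a, b) ∈ alph S μ →
      (F (Function.update u i a) ↔ F (Function.update u i b)) := by
    intro u i a b hab
    have hp : IsPol S fun x : (Unit ⊕ μ) → A =>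
        f (Sum.elim (fun _ => SAlg.interp o (Function.update u i (x (.inl ()))))
          fun q => x (.inr q)) := by
      refine IsPol.comp hf (g := fun j (x : (Unit ⊕ μ) → A) => Sum.elim
        (fun _ => SAlg.interp o (Function.update u i (x (Sum.inl ()))))
        (fun q => x (Sum.inr q)) j) ?_
      rintro (_ | q)
      · refine IsPol.app o (fun j (x : (Unit ⊕ μ) → A) => Function.update u i (x (Sum.inl ())) j)
          fun j => ?_
        by_cases hj : j = i
        · subst hj; simpa using IsPol.proj _
        · simpa [hj] using IsPol.const _
      · exact IsPol.proj _
    exact hab _ hp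
  have key : ∀ s : Finset (Fin (S.arity o)), F x ↔ F (s.piecewise y x) := by
    intro s
    induction s using Finset.induction_on with
    | empty => rw [Finset.piecewise_empty]
    | insert i s his ih =>
      rw [Finset.piecewise_insert, ih, ← step _ i _ _ (hz' i)]
      have e1 : Function.update (s.piecewise y x) i (x i) = s.piecewise y x := by
        rw [eq_comm, Function.eq_update_iff]; simp [his]
      rw [e1]
  have := key Finset.univ
  rw [Finset.piecewise_univ] at this
  exact this

theorem alph_centralizes (μ : Set (A × A)) : Centralizes S (alph S μ) μ (diag A) := by
  intro n t a b c d hab hcd he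
  let g : Fin (n + 1) → ((Unit ⊕ μ) → A) → A :=
    Fin.cons (fun x => x (.inl ())) fun i x => x (.inr ⟨(c i, d i), hcd i⟩)
  have hg : ∀ i, IsPol S (g i) := Fin.cases (.proj _) fun i => .proj _
  have h1 : ∀ a, (fun i => g i (Sum.elim (fun _ => a) fun q => q.1.1)) = Fin.cons a c :=
    fun a => funext (Fin.cases rfl fun i => rfl)
  have h2 : ∀ a, (fun i => g i (Sum.elim (fun _ => a) fun q => q.1.2)) = Fin.cons a d :=
    fun a => funext (Fin.cases rfl fun i => rfl)
  have := hab _ (IsPol.term t hg)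
  simp only [h1, h2] at this
  exact this.1 he

theorem subset_alph [Finite A] {φ μ : Set (A × A)} (hr : ∀ a, (a, a) ∈ μ)
    (hs : ∀ a b, (a, b) ∈ φ → (b, a) ∈ φ) (h : Centralizes S φ μ (diag A)) :
    φ ⊆ alph S μ := by
  rintro ⟨a, b⟩ hab f hf
  constructor
  · refine h.matrix hr hf ?_
    rintro (_ | q)
    · exact .inl ⟨rfl, rfl, hab⟩
    · exact .inr ⟨rfl, rfl, q.2⟩
  · refine h.matrix hr hf ?_
    rintro (_ | q)
    · exact .inl ⟨rfl, rfl, hs _ _ hab⟩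
    · exact .inr ⟨rfl, rfl, q.2⟩

theorem centralizer_eq_alph [Finite A] {μ : Set (A × A)} (hr : ∀ a, (a, a) ∈ μ) :
    centralizer S (diag A) μ = alph S μ := by
  refine Set.Subset.antisymm ?_ ?_
  · rintro p ⟨φ, ⟨h1, h2⟩, hp⟩
    exact subset_alph hr (fun a b => h1.2.symm) h2 hp
  · intro p hp
    exact ⟨_, ⟨alph_congr μ, alph_centralizes μ⟩, hp⟩

theorem Irr.exists_minimal_pol [Finite A] (h : Irr S τ) :
    ∃ (e : A → A) (c₀ c₁ : A), IsPol1 S e ∧ (∀ x, e (e x) = e x) ∧ (c₀, c₁) ∈ τ ∧ c₀ ≠ c₁ ∧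
      e c₀ = c₀ ∧ e c₁ = c₁ ∧ ∀ f : A → A, IsPol1 S f → (∀ x, e (f x) = f x) →
        (∀ x y, e x = x → e y = y → f x = f y → x = y) ∨
          ∀ x y, e x = x → e y = y → (x, y) ∈ transCl τ → f x = f y := by
  classical
  let P : ℕ → Prop := fun n => ∃ (e : A → A) (c₀ c₁ : A), IsPol1 S e ∧ (∀ x, e (e x) = e x) ∧
    (c₀, c₁) ∈ τ ∧ c₀ ≠ c₁ ∧ e c₀ = c₀ ∧ e c₁ = c₁ ∧ (Set.range e).ncard = n
  have hP : ∃ n, P n := by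
    obtain ⟨a, b, hab, hne⟩ := h.nontriv
    exact ⟨_, _, a, b, IsPol1.id, fun _ => rfl, hab, hne, rfl, rfl, rfl⟩
  obtain ⟨e, c₀, c₁, he, hee, hc, hne, h0, h1, hcard⟩ := Nat.find_spec hP
  refine ⟨e, c₀, c₁, he, hee, hc, hne, h0, h1, fun f hf hef => ?_⟩
  by_contra! hcon
  obtain ⟨⟨x, y, hx, hy, hfxy, hxy⟩, u, v, hu, hv, huv, hfuv⟩ := hcon
  have hedge : ∃ a a', e a = a ∧ e a' = a' ∧ (a, a') ∈ τ ∧ f a ≠ f a' := by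
    by_contra! hno
    refine hfuv ?_
    rw [← hu, ← hv]
    exact transCl_imp (E := fun a b => f (e a) = f (e b))
      ⟨fun _ => rfl, fun h => h.symm, fun h h' => h.trans h'⟩
      (fun a b hab => hno _ _ (hee _) (hee _) (he.mem h.sub h.refl hab)) huv
  obtain ⟨a, a', ha, ha', haa, hfa⟩ := hedge
  obtain ⟨g, hg, hga, hga'⟩ := h.exists_pol hfa haa
  obtain ⟨k, hk, hid⟩ := exists_iterate_idempotent A
  have hp : IsPol1 S (fun z => f (e (g z))) := hf.comp (he.comp hg)
  have hfix : ∀ b, g (f b) = b → e b = b → (fun z => f (e (g z)))^[k] (f b) = f b := fun b hb hb' =>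
    Function.iterate_fixed (by simp [hb, hb']) k
  have hrange : Set.range (fun z => f (e (g z)))^[k] ⊆ f '' Set.range e := by
    obtain ⟨m, rfl⟩ := Nat.exists_eq_succ_of_ne_zero hk.ne'
    rintro _ ⟨z, rfl⟩
    rw [Function.iterate_succ_apply']
    exact ⟨_, ⟨_, rfl⟩, rfl⟩
  have hmin := Nat.find_min' hP ⟨_, f a, f a', hp.iterate k, hid _, hf.mem h.sub h.refl haa, hfa,
    hfix a hga ha, hfix a' hga' ha', rfl⟩
  rw [← hcard] at hmin
  have h2 : (Set.range e).ncard ≤ (f '' Set.range e).ncard :=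
    hmin.trans (Set.ncard_le_ncard hrange (Set.toFinite _))
  have h3 := Set.injOn_of_ncard_image_eq (le_antisymm (Set.ncard_image_le (Set.toFinite _)) h2)
    (Set.toFinite _)
  exact hxy (h3 ⟨x, hx⟩ ⟨y, hy⟩ hfxy)

theorem Irr.exists_semilattice [Finite A] (h : Irr S τ) (hn : ¬ Centralizes S τ τ (diag A)) :
    ∃ (c c' : A) (q : A → A → A), (c, c') ∈ τ ∧ c ≠ c' ∧ IsPol2 S q ∧ q c c = c ∧ q c c' = c' ∧
      q c' c = c' ∧ q c' c' = c' := by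
  obtain ⟨e, c₀, c₁, he, hee, hc, hne, h0, h1, hdich⟩ := h.exists_minimal_pol
  unfold Centralizes at hn
  push Not at hn
  obtain ⟨n, t, a, b, c, d, hab, hcd, heq, hneq⟩ := hn
  have heq : t.eval (Fin.cons a c) = t.eval (Fin.cons a d) := heq
  obtain ⟨f₀, hf₀, hfa, hfb⟩ := h.exists_pol hne hab
  choose g hg hgc hgd using fun i => h.exists_pol hne (hcd i)
  obtain ⟨f₂, hf₂, hf₂c, hf₂d⟩ := h.exists_pol (c := c₀) (d := c₁)
    (a := t.eval (Fin.cons b c)) (b := t.eval (Fin.cons b d)) hneq hc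
  have hcμ := subset_transCl τ hc
  let q₀ : A → A → A := fun x y => e (f₂ (t.eval (Fin.cons (f₀ x) fun i => g i y)))
  have hq₀ : IsPol2 S q₀ := by
    let G : Fin (n + 1) → (Fin 2 → A) → A := Fin.cons (fun x => f₀ (x 0)) fun i x => g i (x 1)
    have hG : ∀ i, IsPol S (G i) :=
      Fin.cases (hf₀.app (.proj 0)) fun i => (hg i).app (.proj 1)
    have hG' : ∀ x : Fin 2 → A,
        (Fin.cons (f₀ (x 0)) fun i => g i (x 1) : Fin (n + 1) → A) = fun i => G i x :=
      fun x => funext (Fin.cases rfl fun i => rfl)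
    unfold IsPol2
    simp only [q₀, hG']
    exact he.app (hf₂.app (IsPol.term t hG))
  have q00 : q₀ c₀ c₀ = q₀ c₀ c₁ := by simp only [q₀, hfa, hgc, hgd, heq]
  have q10 : q₀ c₁ c₀ = c₀ := by simp only [q₀, hfb, hgc, hf₂c, h0]
  have q11 : q₀ c₁ c₁ = c₁ := by simp only [q₀, hfb, hgd, hf₂d, h1]
  obtain ⟨k, hk, hid⟩ := exists_iterate_idempotent A
  let q : A → A → A := fun x y => (q₀ x)^[k] y
  have hq : IsPol2 S q := hq₀.iterate (.proj 0) (.proj 1) k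
  have hql : ∀ x, IsPol1 S (q x) := fun x => hq.app (.const x) (.proj ())
  have hqr : ∀ y, IsPol1 S (fun x => q x y) := fun y => hq.app (.proj ()) (.const y)
  have hqi : ∀ x y, q x (q x y) = q x y := fun x y => hid _ _
  have hks : ∀ x y, q x y = q₀ x ((q₀ x)^[k - 1] y) := fun x y => by
    rw [← Function.iterate_succ_apply' (q₀ x) (k - 1) y, Nat.succ_eq_add_one,
      Nat.sub_add_cancel hk]
  have heq' : ∀ x y, e (q x y) = q x y := fun x y => by
    rw [hks]; exact hee _
  have hq10 : q c₁ c₀ = c₀ := Function.iterate_fixed q10 k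
  have hq11 : q c₁ c₁ = c₁ := Function.iterate_fixed q11 k
  have hq1 : ∀ y, e y = y → q c₁ y = y := by
    rcases hdich _ (hql c₁) (heq' c₁) with hi | hi
    · exact fun y hy => hi _ _ (heq' _ _) hy (hqi _ _)
    · exact absurd (hi _ _ h0 h1 hcμ) (by rwa [hq10, hq11])
  have hq00 : q c₀ c₀ = q c₀ c₁ := by
    have e1 : ∀ y, q c₀ y = (q₀ c₀)^[k - 1] (q₀ c₀ y) := fun y => by
      rw [← Function.iterate_succ_apply (q₀ c₀) (k - 1) y, Nat.succ_eq_add_one,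
        Nat.sub_add_cancel hk]
    rw [e1, e1, q00]
  have hq0 : ∀ y, e y = y → (c₀, y) ∈ transCl τ → q c₀ y = q c₀ c₀ := by
    rcases hdich _ (hql c₀) (heq' c₀) with hi | hi
    · exact absurd (hi _ _ h0 h1 hq00) hne
    · exact fun y hy hy' => (hi _ _ h0 hy hy').symm
  set l := q c₀ c₀ with hl
  have hel : e l = l := heq' _ _
  have hlμ : (c₀, l) ∈ transCl τ := by
    refine subset_transCl τ (h.symm ?_)
    have := hq.mem h.sub h.refl hc (h.refl c₀)
    rwa [hq10] at this
  have hxl : ∀ x, e x = x → (c₀, x) ∈ transCl τ → q x l = l := by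
    have e1 : q c₀ l = l := hqi _ _
    rcases hdich _ (hqr l) (fun x => heq' x l) with hi | hi
    · exact absurd (hi c₀ c₁ h0 h1 (by simp only [e1, hq1 l hel])) hne
    · exact fun x hx hx' => (hi _ _ h0 hx hx').symm.trans e1
  have hor : ∀ x y, e x = x → (c₀, x) ∈ transCl τ → e y = y → (c₀, y) ∈ transCl τ →
      q x y = y ∨ q x y = l := by
    intro x y hx hx' hy hy'
    rcases hdich _ (hql x) (heq' x) with hi | hi
    · exact .inl (hi _ _ (heq' _ _) hy (hqi _ _))
    · refine .inr ((hi _ _ hy hel ?_).trans (hxl x hx hx'))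
      exact h.transCl_congr.2.trans (h.transCl_congr.2.symm hy') hlμ
  have hy : ∃ y, e y = y ∧ (c₀, y) ∈ transCl τ ∧ y ≠ l := by
    by_cases hcl : c₀ = l
    · exact ⟨c₁, h1, hcμ, fun h2 => hne (hcl.trans h2.symm)⟩
    · exact ⟨c₀, h0, h.transCl_congr.2.refl _, hcl⟩
  obtain ⟨y, hy, hyμ, hyl⟩ := hy
  have hinj : ∀ x x', e x = x → e x' = x' → q x y = q x' y → x = x' := by
    rcases hdich _ (hqr y) (fun x => heq' x y) with hi | hi
    · exact hi
    · have := hi _ _ h0 h1 hcμ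
      rw [hq0 y hy hyμ, hq1 y hy] at this
      exact absurd this.symm hyl
  rcases hor l y hel hlμ hy hyμ with h2 | h2
  · have h3 : l = c₁ := hinj _ _ hel h1 (h2.trans (hq1 y hy).symm)
    obtain ⟨s, hs, hs0, hs1⟩ := h.exists_pol hne (h.symm hc)
    refine ⟨c₀, c₁, fun x y => q (s x) y, hc, hne, hq.app (hs.app (.proj 0)) (.proj 1), ?_, ?_,
      ?_, ?_⟩
    · simp only [hs0, hq10]
    · simp only [hs0, hq11]
    · simp only [hs1, ← hl, h3]
    · simp only [hs1, ← hq00, h3]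
  · have h3 : l = c₀ := hinj _ _ hel h0 (h2.trans (hq0 y hy hyμ).symm)
    refine ⟨c₁, c₀, q, h.symm hc, hne.symm, hq, hq11, hq10, ?_, ?_⟩
    · rw [← hq00, h3]
    · rw [← hl, h3]

end Irr

section RingLemma
variable {R : Type} [Ring R]

theorem mem_of_pow_mul_mem (J : AddSubgroup R) (r : R) (hr : ∀ x ∈ J, r * x ∈ J)
    (hr' : ∀ x ∈ J, (1 - r) * x ∈ J) (k l : ℕ) (x : R) (hk : r ^ k * x ∈ J)
    (hl : (1 - r) ^ l * x ∈ J) : x ∈ J := by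
  induction k generalizing x l with
  | zero => simpa using hk
  | succ k ihk =>
    induction l generalizing x with
    | zero => simpa using hl
    | succ l ihl =>
      have h1 : r * x ∈ J := by
        refine ihk (l + 1) (r * x) ?_ ?_
        · rwa [← mul_assoc, ← pow_succ]
        · have hc : Commute (1 - r) r := (Commute.one_left r).sub_left (Commute.refl r)
          rw [← mul_assoc, (hc.pow_left _).eq, mul_assoc]
          exact hr _ hl
      have h2 : (1 - r) * x ∈ J := by
        refine ihl ((1 - r) * x) ?_ ?_
        · have hc : Commute r (1 - r) := (Commute.one_right r).sub_right (Commute.refl r)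
          rw [← mul_assoc, (hc.pow_left _).eq, mul_assoc]
          exact hr' _ hk
        · rwa [← mul_assoc, ← pow_succ]
      have : x = r * x + (1 - r) * x := by noncomm_ring
      rw [this]
      exact J.add_mem h1 h2

/-- A set of coefficient vectors of ternary idempotent terms of a module over a finite ring
with a Taylor term contains the coefficient vector of the Maltsev operation `x - y + z`. -/
theorem exists_maltsev_coeff [Finite R] {n : ℕ} (r : Fin n → R) (hr : ∑ i, r i = 1)
    (u v : Fin n → Fin n → Fin 2) (huv : ∀ i, u i i ≠ v i i)
    (hid : ∀ i, (∑ j, if u i j = 0 then 0 else r j) = ∑ j, if v i j = 0 then 0 else r j)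
    (Γ : Set (R × R × R)) (hsum : ∀ w ∈ Γ, w.1 + w.2.1 + w.2.2 = 1)
    (h0 : (1, 0, 0) ∈ Γ) (h1 : (0, 1, 0) ∈ Γ) (h2 : (0, 0, 1) ∈ Γ)
    (ht : ∀ G : Fin n → R × R × R, (∀ j, G j ∈ Γ) → ∑ j, r j • G j ∈ Γ)
    (hcomp : ∀ w ∈ Γ, ∀ x ∈ Γ, ∀ y ∈ Γ, ∀ z ∈ Γ, w.1 • x + w.2.1 • y + w.2.2 • z ∈ Γ) :
    (1, -1, 1) ∈ Γ := by
  classical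
  let J : AddSubgroup R :=
    { carrier := {s | (1, -s, s) ∈ Γ}
      zero_mem' := by simpa using h0
      add_mem' := fun {s s'} hs hs' => by
        have := hcomp _ hs _ hs' _ h1 _ h2
        simp only [one_smul, Prod.smul_mk, smul_eq_mul, mul_zero, mul_one, Prod.mk_add_mk,
          add_zero] at this
        rw [add_comm s' s, ← neg_add_rev] at this
        exact this
      neg_mem' := fun {s} hs => by
        have := hcomp _ hs _ h0 _ h2 _ h1
        simpa using this }
  have hJ : ∀ s, s ∈ J ↔ (1, -s, s) ∈ Γ := fun s => Iff.rfl
  have hleft : ∀ g, (1 - g, g, 0) ∈ Γ → ∀ s ∈ J, g * s ∈ J := by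
    intro g hg s hs
    have := hcomp _ hg _ h0 _ hs _ h0
    rw [hJ]
    simpa using this
  have hswap : ∀ g, (1 - g, g, 0) ∈ Γ → (1 - g, 0, g) ∈ Γ := by
    intro g hg
    have := hcomp _ hg _ h0 _ h2 _ h0
    simpa using this
  have hneg : ∀ g, (1 - g, g, 0) ∈ Γ → (1 - (1 - g), 1 - g, 0) ∈ Γ := by
    intro g hg
    have := hcomp _ hg _ h1 _ h0 _ h0
    simpa using this
  have hright : ∀ g, (1 - g, g, 0) ∈ Γ → ∀ s ∈ J, s * g ∈ J := by
    intro g hg s hs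
    have := hcomp _ hs _ h0 _ hg _ (hswap g hg)
    rw [hJ]
    simpa using this
  obtain ⟨N, hN, hidem⟩ := exists_pow_idempotent R
  have hpow : ∀ w ∈ Γ, w.1 ^ (N + (N - 1)) * w.2.2 ∈ J := by
    rintro ⟨q, m, s⟩ hw
    have hqs : q + m + s = 1 := hsum _ hw
    have hms : m + s = 1 - q := by rw [← hqs]; abel
    have hX : ∀ w ∈ Γ, ∀ z ∈ Γ, ∀ k : ℕ, q ^ k • w + (1 - q ^ k) • z ∈ Γ := by
      intro w hwΓ z hz k
      induction k with
      | zero => simpa using hwΓ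
      | succ k ih =>
        have := hcomp _ hw _ ih _ hz _ hz
        convert this using 1
        dsimp only
        rw [add_assoc, ← add_smul, hms, smul_add, smul_smul, smul_smul, ← pow_succ', add_assoc,
          ← add_smul]
        congr 2
        rw [mul_sub, ← pow_succ']
        noncomm_ring
    have h3 := hX _ (hX _ hw _ h1 (N - 1)) _ h0 N
    rw [hJ]
    have h4 := hsum _ h3
    have h5 : q ^ N • (q ^ (N - 1) • (q, m, s) + (1 - q ^ (N - 1)) • ((0, 1, 0) : R × R × R)) +
        (1 - q ^ N) • ((1, 0, 0) : R × R × R) =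
        (1, -(q ^ (N + (N - 1)) * s), q ^ (N + (N - 1)) * s) := by
      have e1 : q ^ N * (q ^ (N - 1) * q) = q ^ N := by
        rw [← pow_succ, Nat.sub_add_cancel hN, hidem]
      have e3 : q ^ N * (q ^ (N - 1) * s) = q ^ (N + (N - 1)) * s := by rw [pow_add, mul_assoc]
      ext
      · simp [e1, mul_add]
      · simp only [Prod.smul_mk, Prod.mk_add_mk, smul_eq_mul, mul_zero, mul_one, add_zero] at h4 ⊢
        rw [e1, e3] at h4
        have : q ^ N + (1 - q ^ N) = 1 := by abel
        rw [this] at h4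
        have h6 : q ^ N * (q ^ (N - 1) * m + (1 - q ^ (N - 1))) + q ^ (N + (N - 1)) * s = 0 := by
          rw [add_assoc] at h4
          exact left_eq_add.1 h4.symm
        exact eq_neg_of_add_eq_zero_left h6
      · simp [e3]
    rwa [h5] at h3
  have hri : ∀ i, (1 - r i, r i, 0) ∈ Γ := by
    intro i
    have := ht (fun j => if j = i then (0, 1, 0) else (1, 0, 0)) (fun j => by
      split_ifs <;> assumption)
    convert this using 1
    have e : ∀ j, r j • (if j = i then ((0, 1, 0) : R × R × R) else (1, 0, 0)) =
        r j • ((1, 0, 0) : R × R × R) + if j = i then r j • ((-1, 1, 0) : R × R × R) else 0 := by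
      intro j
      split_ifs <;> simp
    simp only [e, Finset.sum_add_distrib, ← Finset.sum_smul, hr]
    simp [sub_eq_add_neg]
  have hrij : ∀ i j, i ≠ j → (r i, 1 - r i - r j, r j) ∈ Γ := by
    intro i j hij
    have := ht (fun l => if l = i then (1, 0, 0) else if l = j then (0, 0, 1) else (0, 1, 0))
      (fun l => by split_ifs <;> assumption)
    convert this using 1
    have e : ∀ l, r l • (if l = i then ((1, 0, 0) : R × R × R) else
        if l = j then (0, 0, 1) else (0, 1, 0)) =
        r l • ((0, 1, 0) : R × R × R) + ((if l = i then r l • ((1, -1, 0) : R × R × R) else 0) +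
          if l = j then r l • ((0, -1, 1) : R × R × R) else 0) := by
      intro l
      by_cases h : l = i
      · subst h; simp [hij]
      · by_cases h' : l = j
        · subst h'; simp [h]
        · simp [h, h']
    simp only [e, Finset.sum_add_distrib, ← Finset.sum_smul, hr]
    simp [sub_eq_add_neg, add_assoc]
  have hidemJ : ∀ i, r i * (1 - r i) ∈ J := by
    intro i
    have hc : Commute (1 - r i) (r i) := (Commute.one_left _).sub_left (Commute.refl _)
    have hc' := hneg _ (hri i)
    refine mem_of_pow_mul_mem J (r i) (hleft _ (hri i)) (hleft _ hc') (N + (N - 1))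
      (N + (N - 1)) _ ?_ ?_
    · have := hpow _ (hswap _ hc')
      rw [sub_sub_cancel] at this
      have := hleft _ (hri i) _ this
      rwa [← mul_assoc, ← pow_succ', pow_succ, mul_assoc] at this
    · have := hleft _ hc' _ (hpow _ (hswap _ (hri i)))
      dsimp only at this
      rw [← mul_assoc, ← pow_succ'] at this
      rw [← hc.eq, ← mul_assoc, ← pow_succ]
      exact this
  have hpowJ : ∀ i k, r i - r i ^ (k + 1) ∈ J := by
    intro i k
    induction k with
    | zero => simp [J.zero_mem]
    | succ k ih =>
      have := J.add_mem (hidemJ i) (hleft _ (hri i) _ ih)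
      convert this using 1
      rw [mul_sub, mul_sub, ← pow_succ']
      noncomm_ring
  have hprod : ∀ i j, i ≠ j → r i * r j ∈ J := by
    intro i j hij
    have a1 := hpow _ (hrij i j hij)
    have a2 := hright _ (hri j) _ (hpowJ i (N + (N - 1) - 1))
    rw [Nat.sub_add_cancel (by omega)] at a2
    have := J.add_mem a1 a2
    convert this using 1
    rw [sub_mul]
    simp
  have hmem : ∀ i, r i ∈ J := by
    intro i
    have hs : ∀ c : Fin n → Fin 2,
        r i * (∑ j, if c j = 0 then 0 else r j) - (if c i = 0 then 0 else r i * r i) ∈ J := by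
      intro c
      rw [Finset.mul_sum, ← Finset.add_sum_erase _ _ (Finset.mem_univ i)]
      have : (r i * if c i = 0 then 0 else r i) = if c i = 0 then 0 else r i * r i := by
        split_ifs <;> simp
      rw [this, add_sub_cancel_left]
      refine J.sum_mem fun j hj => ?_
      split_ifs
      · simp
      · exact hprod i j (Finset.ne_of_mem_erase hj).symm
    have h3 := J.sub_mem (hs (u i)) (hs (v i))
    rw [hid i] at h3
    have h4 : r i * r i ∈ J := by
      have hne := huv i
      by_cases hu : u i i = 0
      · have hv : v i i ≠ 0 := fun hv => hne (hu.trans hv.symm)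
        simpa [hu, hv] using h3
      · have hv : v i i = 0 := by omega
        simpa [hu, hv] using h3
    have := J.add_mem (hpowJ i 1) h4
    convert this using 1
    rw [pow_two]
    abel
  have := J.sum_mem (t := Finset.univ) fun i _ => hmem i
  rw [hr] at this
  exact this

end RingLemma

section Maltsev
variable {A : Type} [SAlg S A] {τ μ : Set (A × A)}

theorem transCl_tuple {ι : Type} [Finite ι] {E : (ι → A) → (ι → A) → Prop} (hE : Equivalence E)
    (hr : ∀ a, (a, a) ∈ τ) (h : ∀ x y, (∀ i, (x i, y i) ∈ τ) → E x y) {x y : ι → A}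
    (hxy : ∀ i, (x i, y i) ∈ transCl τ) : E x y := by
  classical
  have := Fintype.ofFinite ι
  have key : ∀ s : Finset ι, E x (s.piecewise y x) := by
    intro s
    induction s using Finset.induction_on with
    | empty => rw [Finset.piecewise_empty]; exact hE.refl x
    | insert i s his ih =>
      rw [Finset.piecewise_insert]
      refine hE.trans ih ?_
      have e1 : s.piecewise y x = Function.update (s.piecewise y x) i (x i) := by
        rw [Function.eq_update_iff]; simp [his]
      rw [e1, Function.update_idem]
      refine transCl_imp (E := fun a b => E (Function.update (s.piecewise y x) i a)
        (Function.update (s.piecewise y x) i b)) ⟨fun _ => hE.refl _, hE.symm, hE.trans⟩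
        (fun a b hab => h _ _ fun j => ?_) (hxy i)
      by_cases hj : j = i
      · subst hj; simpa using hab
      · simpa [hj] using hr _
  have := key Finset.univ
  rwa [Finset.piecewise_univ] at this

theorem Centralizes.transCl_left {θ δ : Set (A × A)} (h : Centralizes S τ θ δ) :
    Centralizes S (transCl τ) θ δ := by
  intro n t a b c d hab hcd
  have hab' : Relation.TransGen (fun a b => (a, b) ∈ τ) a b := hab
  clear hab
  induction hab' with
  | single hb => exact h n t _ _ c d hb hcd
  | tail _ hbc ih => exact fun he => h n t _ _ c d hbc hcd (ih he)

theorem exists_two_sensitive [Finite A] (h : Irr S τ) (hC : Centralizes S τ τ (diag A)) {n : ℕ}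
    {t : STerm S n} {u v : Fin n → Fin n → Fin 2} (hn : 1 < n) (huv : ∀ i, u i i ≠ v i i)
    (ht : TaylorOn S A t u v) {e : A → A} (he : IsPol1 S e) {c₀ c₁ : A} (hc : (c₀, c₁) ∈ τ)
    (hne : c₀ ≠ c₁) (h0 : e c₀ = c₀) (h1 : e c₁ = c₁) :
    ∃ i j, i ≠ j ∧ e (t.eval (Function.update (fun _ => c₀) i c₁)) ≠ c₀ ∧
      e (t.eval (Function.update (fun _ => c₀) j c₁)) ≠ c₀ := by
  classical
  by_contra! hcon
  have hi : ∃ i, ∀ j, i ≠ j → e (t.eval (Function.update (fun _ => c₀) j c₁)) = c₀ := by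
    by_cases hs : ∃ i, e (t.eval (Function.update (fun _ => c₀) i c₁)) ≠ c₀
    · obtain ⟨i, hi⟩ := hs
      exact ⟨i, fun j hij => hcon i j hij hi⟩
    · push Not at hs
      exact ⟨⟨0, by omega⟩, fun j _ => hs j⟩
  obtain ⟨i, hi⟩ := hi
  have hpol : IsPol S fun x : Fin n → A => e (t.eval x) :=
    he.app (IsPol.term t (g := fun i x => x i) fun i => .proj i)
  have step : ∀ x : Fin n → A, (∀ j, x j = c₀ ∨ x j = c₁) → ∀ j, i ≠ j →
      e (t.eval (Function.update x j c₀)) = e (t.eval (Function.update x j c₁)) := by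
    intro x hx j hij
    refine hC.matrix h.refl hpol (x := fun _ => c₀) (y := Function.update (fun _ => c₀) j c₁) ?_ ?_
    · intro l
      by_cases hl : l = j
      · subst hl; right; simpa using hc
      · left
        simp only [Function.update_of_ne hl, true_and]
        rcases hx l with h2 | h2 <;> rw [h2]
        · exact h.refl _
        · exact hc
    · rw [hi j hij, ht.1, h0]
  have key : ∀ x : Fin n → A, (∀ j, x j = c₀ ∨ x j = c₁) → ∀ s : Finset (Fin n), i ∉ s →
      e (t.eval (s.piecewise (fun _ => x i) x)) = e (t.eval x) := by
    intro x hx s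
    induction s using Finset.induction_on with
    | empty => intro _; rw [Finset.piecewise_empty]
    | insert j s hjs ih =>
      intro his
      rw [Finset.mem_insert, not_or] at his
      rw [Finset.piecewise_insert, ← ih his.2]
      have hx' : ∀ l, s.piecewise (fun _ => x i) x l = c₀ ∨
          s.piecewise (fun _ => x i) x l = c₁ := by
        intro l
        by_cases hl : l ∈ s
        · simpa [hl] using hx i
        · simpa [hl] using hx l
      have h2 := step _ hx' j his.1
      have h3 : ∀ a b, (a = c₀ ∨ a = c₁) → (b = c₀ ∨ b = c₁) →
          e (t.eval (Function.update (s.piecewise (fun _ => x i) x) j a)) =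
          e (t.eval (Function.update (s.piecewise (fun _ => x i) x) j b)) := by
        rintro a b (rfl | rfl) (rfl | rfl)
        · rfl
        · exact h2
        · exact h2.symm
        · rfl
      have h4 := h3 _ (s.piecewise (fun _ => x i) x j) (hx i) (hx' j)
      rwa [Function.update_eq_self] at h4
  have key' : ∀ x : Fin n → A, (∀ j, x j = c₀ ∨ x j = c₁) → e (t.eval x) = x i := by
    intro x hx
    have h2 := key x hx (Finset.univ.erase i) (Finset.notMem_erase _ _)
    have h3 : (Finset.univ.erase i).piecewise (fun _ => x i) x = fun _ => x i := by
      funext j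
      by_cases hj : j = i
      · subst hj; simp
      · simp [hj]
    rw [← h2, h3, ht.1]
    rcases hx i with h2 | h2 <;> rw [h2] <;> assumption
  have h2 := congrArg e (ht.2 i c₀ c₁)
  rw [key' _ fun j => ?_, key' _ fun j => ?_] at h2
  · have hne' := huv i
    by_cases hu : u i i = 0
    · have hv : v i i ≠ 0 := fun hv => hne' (hu.trans hv.symm)
      simp only [hu, hv, if_true, if_false] at h2
      exact hne h2
    · have hv : v i i = 0 := by omega
      simp only [hu, hv, if_true, if_false] at h2
      exact hne h2.symm
  · split_ifs <;> simp
  · split_ifs <;> simp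

/-- A polynomial Maltsev operation on a minimal set which separates points. -/
structure MaltsevSet (S : Signature) {A : Type} [SAlg S A] (μ : Set (A × A)) (e : A → A) (o : A)
    (p : A → A → A → A) : Prop where
  congr : IsCongruence S μ
  pol : IsPol1 S e
  idem : ∀ x, e (e x) = e x
  base : e o = o
  mal : IsPol3 S p
  range : ∀ x y z, e (p x y z) = p x y z
  right : ∀ x y, e x = x → e y = y → (o, x) ∈ μ → (o, y) ∈ μ → p x y y = x
  left : ∀ x y, e x = x → e y = y → (o, x) ∈ μ → (o, y) ∈ μ → p x x y = y
  sep : ∀ a x, a ≠ x → ∃ f, IsPol1 S f ∧ (∀ z, e (f z) = f z) ∧ f a = o ∧ f a ≠ f x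

theorem exists_maltsevSet [Finite A] (h : Irr S τ) (hC : Centralizes S τ τ (diag A)) {n : ℕ}
    {t : STerm S n} {u v : Fin n → Fin n → Fin 2} (hn : 1 < n) (huv : ∀ i, u i i ≠ v i i)
    (ht : TaylorOn S A t u v) : ∃ e o p, MaltsevSet S (transCl τ) e o p := by
  classical
  obtain ⟨e, c₀, c₁, he, hee, hc, hne, h0, h1, hdich⟩ := h.exists_minimal_pol
  obtain ⟨i, j, hij, hi, hj⟩ := exists_two_sensitive h hC hn huv ht he hc hne h0 h1
  have hcμ := subset_transCl τ hc
  have hμ := h.transCl_congr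
  let g : A → A → Fin n → A := fun x y =>
    Function.update (Function.update (fun _ => c₀) i x) j y
  let f : A → A → A := fun x y => e (t.eval (g x y))
  have hf : IsPol2 S f := by
    refine he.app (IsPol.term t (g := fun l x => g (x 0) (x 1) l) fun l => ?_)
    by_cases hlj : l = j
    · subst hlj; simpa [g] using IsPol.proj (S := S) (A := A) (1 : Fin 2)
    · by_cases hli : l = i
      · subst hli; simpa [g, hlj] using IsPol.proj (S := S) (A := A) (0 : Fin 2)
      · simpa [g, hlj, hli] using IsPol.const (S := S) (ι := Fin 2) c₀
  have hef : ∀ x y, e (f x y) = f x y := fun x y => hee _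
  have f00 : f c₀ c₀ = c₀ := by
    have : g c₀ c₀ = fun _ => c₀ := by
      funext l
      by_cases hlj : l = j
      · subst hlj; simp [g]
      · by_cases hli : l = i
        · subst hli; simp [g, hlj]
        · simp [g, hlj, hli]
    simp only [f, this, ht.1, h0]
  have f10 : f c₁ c₀ ≠ c₀ := by
    have : g c₁ c₀ = Function.update (fun _ => c₀) i c₁ := by
      funext l
      by_cases hlj : l = j
      · subst hlj; simp [g, hij.symm]
      · simp [g, hlj]
    simpa only [f, this]
  have f01 : f c₀ c₁ ≠ c₀ := by
    have : g c₀ c₁ = Function.update (fun _ => c₀) j c₁ := by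
      simp [g]
    simpa only [f, this]
  have hCl := hC.transCl_left
  have hinjr : ∀ y, (c₀, y) ∈ transCl τ → ∀ x x', e x = x → e x' = x' → f x y = f x' y →
      x = x' := by
    intro y hy
    rcases hdich (fun x => f x y) (hf.app (.proj ()) (.const y)) (fun x => hef x y) with h2 | h2
    · exact h2
    · exfalso
      have h3 := h2 _ _ h0 h1 hcμ
      refine f10 (Eq.trans ?_ f00)
      have := hCl.matrix h.refl hf (x := ![c₀, y]) (y := ![c₁, y]) (z := ![c₀, c₀])
        (w := ![c₁, c₀]) (fun l => ?_) h3
      · exact this.symm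
      · fin_cases l
        · right; simpa using hc
        · left; simpa using hμ.2.symm hy
  have hinjl : ∀ x, (c₀, x) ∈ transCl τ → ∀ y y', e y = y → e y' = y' → f x y = f x y' →
      y = y' := by
    intro x hx
    rcases hdich (fun y => f x y) (hf.app (.const x) (.proj ())) (fun y => hef x y) with h2 | h2
    · exact h2
    · exfalso
      have h3 := h2 _ _ h0 h1 hcμ
      refine f01 (Eq.trans ?_ f00)
      have := hCl.matrix h.refl hf (x := ![x, c₀]) (y := ![x, c₁]) (z := ![c₀, c₀])
        (w := ![c₀, c₁]) (fun l => ?_) h3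
      · exact this.symm
      · fin_cases l
        · left; simpa using hμ.2.symm hx
        · right; simpa using hc
  obtain ⟨k, hk, hid⟩ := exists_iterate_idempotent A
  have hitem : ∀ (s : A → A), (∀ x, e (s x) = s x) →
      (∀ x x', e x = x → e x' = x' → s x = s x' → x = x') → ∀ m x, e x = x →
      e (s^[m] x) = s^[m] x := by
    intro s hes hs m x hx
    cases m with
    | zero => exact hx
    | succ m => rw [Function.iterate_succ_apply']; exact hes _
  have hinv : ∀ (s : A → A), (∀ x, e (s x) = s x) →
      (∀ x x', e x = x → e x' = x' → s x = s x' → x = x') → ∀ x, e x = x → s^[k] x = x := by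
    intro s hes hs x hx
    have hinj : ∀ m x x', e x = x → e x' = x' → s^[m] x = s^[m] x' → x = x' := by
      intro m
      induction m with
      | zero => exact fun x x' _ _ h => h
      | succ m ih =>
        intro x x' hx hx' h2
        rw [Function.iterate_succ_apply', Function.iterate_succ_apply'] at h2
        exact ih x x' hx hx' (hs _ _ (hitem s hes hs m x hx) (hitem s hes hs m x' hx') h2)
    exact hinj k _ _ (hitem s hes hs k x hx) hx (hid s x)
  have hsucc : ∀ (s : A → A) x, s (s^[k - 1] x) = s^[k] x := fun s x => by
    rw [← Function.iterate_succ_apply' s, Nat.succ_eq_add_one, Nat.sub_add_cancel hk]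
  let w : A → A := fun y => (f y)^[k - 1] y
  have hfsw : IsPol2 S fun x y => f y x := hf.app (.proj 1) (.proj 0)
  have hw : IsPol1 S w := hf.iterate (.proj ()) (.proj ()) (k - 1)
  let p : A → A → A → A := fun x y z =>
    f ((fun a => f a (w y))^[k - 1] x) ((f y)^[k - 1] z)
  have hp : IsPol3 S p :=
    hf.app (hfsw.iterate (hw.app (.proj 1)) (.proj 0) (k - 1))
      (hf.iterate (.proj 1) (.proj 2) (k - 1))
  have hwy : ∀ y, e y = y → (c₀, y) ∈ transCl τ → f y (w y) = y := fun y hy hy' => by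
    rw [hsucc (f y)]; exact hinv (f y) (hef y) (hinjl y hy') y hy
  have hw0 : w c₀ = c₀ := Function.iterate_fixed f00 _
  have hwμ : ∀ y, (c₀, y) ∈ transCl τ → (c₀, w y) ∈ transCl τ := fun y hy => by
    have := hw.mem hμ.1 hμ.2.refl hy
    rwa [hw0] at this
  refine ⟨e, c₀, p, hμ, he, hee, h0, hp, fun x y z => hef _ _, fun x y hx hy hx' hy' => ?_,
    fun y z hy hz hy' hz' => ?_, fun a x hax => ?_⟩
  · have e1 : (f y)^[k - 1] y = w y := rfl
    simp only [p, e1]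
    rw [hsucc (fun a => f a (w y))]
    exact hinv _ (fun x => hef x _) (hinjr _ (hwμ y hy')) x hx
  · have hs1 : (fun a => f a (w y))^[k - 1] y = y := Function.iterate_fixed (hwy y hy hy') _
    simp only [p]
    rw [hs1, hsucc (f y)]
    exact hinv _ (hef y) (hinjl y hy') z hz
  · obtain ⟨s, hs, hsa, hsx⟩ := h.exists_pol hax hc
    refine ⟨fun z => e (s z), he.comp hs, fun z => hee _, by simp only [hsa, h0], ?_⟩
    show e (s a) ≠ e (s x)
    rw [hsa, hsx, h0, h1]
    exact hne

theorem MaltsevSet.centralizes [Finite A] (h : Irr S τ) (hC : Centralizes S τ τ (diag A))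
    {e : A → A} {o : A} {p : A → A → A → A} (hM : MaltsevSet S (transCl τ) e o p) :
    Centralizes S (transCl τ) (transCl τ) (diag A) := by
  intro n t a b c d hab hcd heq
  have heq : t.eval (Fin.cons a c) = t.eval (Fin.cons a d) := heq
  by_contra hne
  obtain ⟨f, hf, hef, hfo, hfne⟩ := hM.sep _ _ hne
  have hμ := hM.congr
  let g : A → (Fin n → A) → A := fun x y => f (t.eval (Fin.cons x y))
  have hev : ∀ x y x' y', (x, x') ∈ transCl τ → (∀ i, (y i, y' i) ∈ transCl τ) →
      (g x y, g x' y') ∈ transCl τ := fun x y x' y' hx hy =>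
    hf.mem hμ.1 hμ.2.refl (hμ.1.eval_pair_cons t hx hy)
  have hgpol : ∀ {ι : Type} {x : (ι → A) → A} {y : Fin n → (ι → A) → A}, IsPol S x →
      (∀ i, IsPol S (y i)) → IsPol S fun z => g (x z) fun i => y i z := by
    intro ι x y hx hy
    have e1 : ∀ z, (Fin.cons (x z) fun i => y i z : Fin (n + 1) → A) =
        fun i => (Fin.cons x y : Fin (n + 1) → (ι → A) → A) i z :=
      fun z => funext (Fin.cases rfl fun i => rfl)
    simp only [g, e1]
    exact hf.app (IsPol.term t (Fin.cases hx hy))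
  have hq : IsPol S fun z : Unit ⊕ Fin n → A =>
      p (g (z (.inl ())) fun i => z (.inr i)) (g a fun i => z (.inr i)) (g a c) :=
    hM.mal.app (hgpol (.proj _) fun i => .proj _) (hgpol (.const _) fun i => .proj _) (.const _)
  have hob : (o, g b c) ∈ transCl τ := by
    have := hμ.2.refl o
    rwa [← hfo] at this ⊢
  have hin : ∀ x y, (b, x) ∈ transCl τ → (∀ i, (c i, y i) ∈ transCl τ) →
      (o, g x y) ∈ transCl τ := fun x y hx hy => hμ.2.trans hob (hev _ _ _ _ hx hy)
  have hE : Equivalence fun y y' : Fin n → A => ((∀ i, (c i, y i) ∈ transCl τ) ↔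
      (∀ i, (c i, y' i) ∈ transCl τ)) ∧ ((∀ i, (c i, y i) ∈ transCl τ) →
      p (g b y) (g a y) (g a c) = p (g b y') (g a y') (g a c)) :=
    ⟨fun _ => ⟨Iff.rfl, fun _ => rfl⟩, fun h => ⟨h.1.symm, fun h' => (h.2 (h.1.2 h')).symm⟩,
      fun h h' => ⟨h.1.trans h'.1, fun h2 => (h.2 h2).trans (h'.2 (h.1.1 h2))⟩⟩
  have hbe : ∀ x y, e (g x y) = g x y := fun x y => hef _
  have hba := hμ.2.symm hab
  have hstep : ∀ y y' : Fin n → A, (∀ i, (y i, y' i) ∈ τ) → ((∀ i, (c i, y i) ∈ transCl τ) ↔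
      (∀ i, (c i, y' i) ∈ transCl τ)) ∧ ((∀ i, (c i, y i) ∈ transCl τ) →
      p (g b y) (g a y) (g a c) = p (g b y') (g a y') (g a c)) := by
    intro y y' hy
    have hiff : (∀ i, (c i, y i) ∈ transCl τ) ↔ (∀ i, (c i, y' i) ∈ transCl τ) :=
      forall_congr' fun i => ⟨fun h2 => hμ.2.trans h2 (subset_transCl τ (hy i)),
        fun h2 => hμ.2.trans h2 (subset_transCl τ (h.symm (hy i)))⟩
    refine ⟨hiff, fun hcy => ?_⟩
    have hac := hin a c hba fun i => hμ.2.refl _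
    have := hC.transCl_left.matrix h.refl hq (x := Sum.elim (fun _ => a) y)
      (y := Sum.elim (fun _ => a) y') (z := Sum.elim (fun _ => b) y)
      (w := Sum.elim (fun _ => b) y') (fun i => ?_) ?_
    · exact this
    · rcases i with _ | i
      · exact .inl ⟨rfl, rfl, hab⟩
      · exact .inr ⟨rfl, rfl, hy i⟩
    · simp only [Sum.elim_inl, Sum.elim_inr]
      rw [hM.left _ _ (hbe _ _) (hbe _ _) (hin a y hba hcy) hac,
        hM.left _ _ (hbe _ _) (hbe _ _) (hin a y' hba (hiff.1 hcy)) hac]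
  have hfin := (transCl_tuple hE h.refl hstep hcd).2 fun i => hμ.2.refl _
  have e1 : g a c = g a d := by simp only [g, heq]
  have hac := hin a c hba fun i => hμ.2.refl _
  rw [hM.right _ _ (hbe _ _) (hbe _ _) hob hac, ← e1,
    hM.right _ _ (hbe _ _) (hbe _ _) (hin b d (hμ.2.refl _) hcd) hac] at hfin
  exact hfne hfin

/-- Two polynomials which agree at three corners of a matrix agree at the fourth one. -/
theorem MaltsevSet.agree [Finite A] {e : A → A} {o : A} {p : A → A → A → A}
    (hM : MaltsevSet S μ e o p) (hC : Centralizes S μ μ (diag A)) {ι : Type} [Finite ι]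
    {F G : (ι → A) → A} (hF : IsPol S F) (hG : IsPol S G) (heF : ∀ z, e (F z) = F z)
    (heG : ∀ z, e (G z) = G z) {x y z w : ι → A}
    (hi : ∀ i, (x i = y i ∧ z i = w i ∧ (x i, z i) ∈ μ) ∨
      (x i = z i ∧ y i = w i ∧ (x i, y i) ∈ μ)) (hx : F x = G x) (hy : F y = G y)
    (hz : F z = G z) (ho : (o, F x) ∈ μ) : F w = G w := by
  have hμ := hM.congr
  have hxy : ∀ i, (x i, y i) ∈ μ := fun i => by
    rcases hi i with ⟨h1, -, -⟩ | ⟨-, -, h3⟩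
    · rw [h1]; exact hμ.2.refl _
    · exact h3
  have hxz : ∀ i, (x i, z i) ∈ μ := fun i => by
    rcases hi i with ⟨-, -, h3⟩ | ⟨h1, -, -⟩
    · exact h3
    · rw [h1]; exact hμ.2.refl _
  have hxw : ∀ i, (x i, w i) ∈ μ := fun i => by
    rcases hi i with ⟨-, h2, h3⟩ | ⟨-, h2, h3⟩
    · rwa [← h2]
    · rwa [← h2]
  have hFo : ∀ w : ι → A, (∀ i, (x i, w i) ∈ μ) → (o, F w) ∈ μ := fun w hw =>
    hμ.2.trans ho (hF.mem hμ.1 hμ.2.refl hw)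
  have hGo : ∀ w : ι → A, (∀ i, (x i, w i) ∈ μ) → (o, G w) ∈ μ := fun w hw =>
    hμ.2.trans (hx ▸ ho) (hG.mem hμ.1 hμ.2.refl hw)
  have hoo := hμ.2.refl o
  have hK : IsPol S fun z => p (F z) (G z) o := hM.mal.app hF hG (.const o)
  have h1 : p (F z) (G z) o = p (F w) (G w) o := by
    refine hC.matrix hμ.2.refl hK hi ?_
    rw [hx, hy, hM.left _ _ (heG _) hM.base (hGo _ fun i => hμ.2.refl _) hoo,
      hM.left _ _ (heG _) hM.base (hGo _ hxy) hoo]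
  rw [hz, hM.left _ _ (heG _) hM.base (hGo _ hxz) hoo] at h1
  have h2 : p (F w) (G w) (G w) = p (G w) (G w) (G w) := by
    refine hC.matrix hμ.2.refl hM.mal (x := ![F w, G w, o]) (y := ![G w, G w, o])
      (z := ![F w, G w, G w]) (w := ![G w, G w, G w]) (fun i => ?_) ?_
    · fin_cases i
      · right
        refine ⟨rfl, rfl, ?_⟩
        exact hμ.2.trans (hμ.2.symm (hFo _ hxw)) (hGo _ hxw)
      · left; exact ⟨rfl, rfl, hμ.2.refl _⟩
      · left; exact ⟨rfl, rfl, hGo _ hxw⟩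
    · show p (F w) (G w) o = p (G w) (G w) o
      rw [← h1, hM.left _ _ (heG _) hM.base (hGo _ hxw) hoo]
  rwa [hM.right _ _ (heF _) (heG _) (hFo _ hxw) (hGo _ hxw),
    hM.right _ _ (heG _) (heG _) (hGo _ hxw) (hGo _ hxw)] at h2

end Maltsev

section Linear
variable {A : Type} [SAlg S A] {μ : Set (A × A)} {e : A → A} {o : A} {p : A → A → A → A}

/-- The elements of the minimal set lying in the block of the base point. -/
abbrev MaltsevBody (μ : Set (A × A)) (e : A → A) (o : A) : Type := {x : A // e x = x ∧ (o, x) ∈ μ}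

theorem MaltsevSet.mem_body (hM : MaltsevSet S μ e o p) {x y z : A} (hx : (o, x) ∈ μ)
    (hy : (o, y) ∈ μ) (hz : (o, z) ∈ μ) :
    e (p x y z) = p x y z ∧ (o, p x y z) ∈ μ := by
  refine ⟨hM.range x y z, ?_⟩
  have h := hM.mal.mem hM.congr.1 hM.congr.2.refl hx hy hz
  rwa [hM.right o o hM.base hM.base (hM.congr.2.refl o) (hM.congr.2.refl o)] at h

theorem MaltsevSet.agree_two [Finite A] (hM : MaltsevSet S μ e o p)
    (hC : Centralizes S μ μ (diag A)) {F G : A → A → A} (hF : IsPol2 S F) (hG : IsPol2 S G)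
    (heF : ∀ x y, e (F x y) = F x y) (heG : ∀ x y, e (G x y) = G x y) (h0 : F o o = o)
    (h0' : G o o = o) {x y : A} (hx : (o, x) ∈ μ) (hy : (o, y) ∈ μ) (h1 : F x o = G x o)
    (h2 : F o y = G o y) : F x y = G x y := by
  refine hM.agree hC (F := fun z : Fin 2 → A => F (z 0) (z 1)) (G := fun z => G (z 0) (z 1))
    hF hG (fun _ => heF _ _) (fun _ => heG _ _)
    (x := ![o, o]) (y := ![x, o]) (z := ![o, y]) (w := ![x, y]) (fun i => ?_) (h0.trans h0'.symm)
    h1 h2 ?_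
  · fin_cases i
    · exact .inr ⟨rfl, rfl, hx⟩
    · exact .inl ⟨rfl, rfl, hy⟩
  · show (o, F o o) ∈ μ
    rw [h0]; exact hM.congr.2.refl o

/-- The abelian group structure on the body of a minimal set. -/
@[reducible] noncomputable def MaltsevSet.addCommGroup [Finite A] (hM : MaltsevSet S μ e o p)
    (hC : Centralizes S μ μ (diag A)) : AddCommGroup (MaltsevBody μ e o) :=
  have hoo := hM.congr.2.refl o
  have hr : ∀ x : MaltsevBody μ e o, p x o o = x := fun x => hM.right _ _ x.2.1 hM.base x.2.2 hoo
  have hl : ∀ x : MaltsevBody μ e o, p o o x = x := fun x => hM.left _ _ hM.base x.2.1 hoo x.2.2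
  have hs : ∀ x : MaltsevBody μ e o, p x x o = o := fun x => hM.left _ _ x.2.1 hM.base x.2.2 hoo
  have hs' : ∀ x : MaltsevBody μ e o, p o x x = o := fun x => hM.right _ _ hM.base x.2.1 hoo x.2.2
  have hooo : p o o o = o := hM.right _ _ hM.base hM.base hoo hoo
  have hpl : IsPol2 S fun x y => p x o y := hM.mal.app (.proj 0) (.const o) (.proj 1)
  have hng : IsPol1 S fun x => p o x o := hM.mal.app (.const o) (.proj ()) (.const o)
  have hsb : IsPol2 S fun x y => p x y o := hM.mal.app (.proj 0) (.proj 1) (.const o)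
  letI : Add (MaltsevBody μ e o) := ⟨fun x y => ⟨p x o y, hM.mem_body x.2.2 hoo y.2.2⟩⟩
  letI : Zero (MaltsevBody μ e o) := ⟨⟨o, hM.base, hoo⟩⟩
  letI : Neg (MaltsevBody μ e o) := ⟨fun x => ⟨p o x o, hM.mem_body hoo x.2.2 hoo⟩⟩
  { sub := fun x y => ⟨p x y o, hM.mem_body x.2.2 y.2.2 hoo⟩
    nsmul := nsmulRec
    zsmul := zsmulRec
    add_assoc := fun x y z => Subtype.ext (by
      refine hM.agree hC (F := fun v : Fin 3 → A => p (p (v 0) o (v 1)) o (v 2))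
        (G := fun v => p (v 0) o (p (v 1) o (v 2)))
        (hpl.app (hpl.app (.proj _) (.proj _)) (.proj _))
        (hpl.app (.proj _) (hpl.app (.proj _) (.proj _)))
        (fun _ => hM.range _ _ _) (fun _ => hM.range _ _ _)
        (x := ![o, o, o]) (y := ![x, y, o]) (z := ![o, o, z]) (w := ![x, y, z])
        (fun i => ?_) ?_ ?_ ?_ ?_
      · fin_cases i
        · exact .inr ⟨rfl, rfl, x.2.2⟩
        · exact .inr ⟨rfl, rfl, y.2.2⟩
        · exact .inl ⟨rfl, rfl, z.2.2⟩
      · show p (p o o o) o o = p o o (p o o o)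
        rw [hooo]
      · show p (p x o y) o o = p x o (p y o o)
        rw [hr y]
        exact hr ⟨p x o y, hM.mem_body x.2.2 hoo y.2.2⟩
      · show p (p o o o) o z = p o o (p o o z)
        rw [hooo, hl z, hl z]
      · show (o, p (p o o o) o o) ∈ μ
        rw [hooo, hooo]; exact hoo)
    zero_add := fun x => Subtype.ext (hl x)
    add_zero := fun x => Subtype.ext (hr x)
    add_comm := fun x y => Subtype.ext (hM.agree_two hC hpl
      (G := fun x y => p y o x) (hpl.app (.proj 1) (.proj 0)) (fun _ _ => hM.range _ _ _)
      (fun _ _ => hM.range _ _ _)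
      hooo hooo x.2.2 y.2.2 ((hr x).trans (hl x).symm) ((hl y).trans (hr y).symm))
    neg_add_cancel := fun x => Subtype.ext ((hM.agree_two hC (F := fun x y => p (p o x o) o y)
      (G := fun x y => p o x y) (hpl.app (hng.app (.proj 0)) (.proj 1))
      (hM.mal.app (.const o) (.proj 0) (.proj 1)) (fun _ _ => hM.range _ _ _)
      (fun _ _ => hM.range _ _ _) (by rw [hooo, hooo]) hooo x.2.2 x.2.2
      (hr ⟨p o x o, hM.mem_body hoo x.2.2 hoo⟩) (by rw [hooo])).trans (hs' x))
    sub_eq_add_neg := fun x y => Subtype.ext (hM.agree_two hC hsb (G := fun x y => p x o (p o y o))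
      (hpl.app (.proj 0) (hng.app (.proj 1))) (fun _ _ => hM.range _ _ _)
      (fun _ _ => hM.range _ _ _) hooo (by rw [hooo, hooo]) x.2.2 y.2.2 (by rw [hooo])
      (hl ⟨p o y o, hM.mem_body hoo y.2.2 hoo⟩).symm) }

/-- Blocks of an abelian monolith embed into modules on which a term acts linearly. -/
theorem MaltsevSet.exists_linear [Finite A] (hM : MaltsevSet S μ e o p)
    (hC : Centralizes S μ μ (diag A)) {n : ℕ} (t : STerm S n)
    (ht : ∀ a : A, t.eval (fun _ => a) = a) :
    ∃ (V : A → Type) (_ : ∀ a, AddCommGroup (V a)) (_ : ∀ a, Finite (V a))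
      (D : ∀ a, A → V a) (r : Fin n → ∀ a, AddMonoid.End (V a)),
      (∀ a x y, (a, x) ∈ μ → (a, y) ∈ μ → D a x = D a y → x = y) ∧
      (∀ a, D a a = 0) ∧
      (∀ a (φ ψ : AddMonoid.End (V a)), (∀ x, (a, x) ∈ μ → φ (D a x) = ψ (D a x)) → φ = ψ) ∧
      ∀ a (x : Fin n → A), (∀ i, (a, x i) ∈ μ) → D a (t.eval x) = ∑ i, r i a (D a (x i)) := by
  classical
  let _ := hM.addCommGroup hC
  have hμ := hM.congr
  have hoo := hμ.2.refl o
  let N := MaltsevBody μ e o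
  let toN : A → N := fun z => if h : e z = z ∧ (o, z) ∈ μ then ⟨z, h⟩ else 0
  have toN_coe : ∀ z, e z = z → (o, z) ∈ μ → (toN z : A) = z := fun z h1 h2 => by
    simp only [toN, dif_pos (show e z = z ∧ (o, z) ∈ μ from ⟨h1, h2⟩)]
  let good : A → (A → A) → Prop := fun a f =>
    IsPol1 S f ∧ (∀ z, e (f z) = f z) ∧ (o, f a) ∈ μ
  have good_mem : ∀ {a f x}, good a f → (a, x) ∈ μ → (o, f x) ∈ μ := fun hf hx =>
    hμ.2.trans hf.2.2 (hf.1.mem hμ.1 hμ.2.refl hx)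
  let δ : A → A → (A → A) → N := fun a x f =>
    if good a f ∧ (a, x) ∈ μ then toN (f x) - toN (f a) else 0
  let V : A → AddSubgroup ((A → A) → N) := fun a => AddSubgroup.closure (Set.range (δ a))
  have hδ : ∀ a x, δ a x ∈ V a := fun a x => AddSubgroup.subset_closure ⟨x, rfl⟩
  let T : Fin n → A → A → A := fun i a y => t.eval (Function.update (fun _ => a) i y)
  have hT : ∀ i a, IsPol1 S (T i a) := fun i a => by
    refine IsPol.term t (g := fun j y => Function.update (fun _ => a) i (y ()) j) fun j => ?_
    by_cases hj : j = i
    · subst hj; simpa using IsPol.proj (S := S) (A := A) ()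
    · simpa [hj] using IsPol.const (S := S) (ι := Unit) a
  have hTa : ∀ i a, T i a a = a := fun i a => by
    simp only [T, Function.update_eq_self_iff.2 rfl, ht]
  have hTμ : ∀ i a x, (a, x) ∈ μ → (a, T i a x) ∈ μ := fun i a x hx => by
    have := (hT i a).mem hμ.1 hμ.2.refl hx
    rwa [hTa] at this
  let Φ : Fin n → A → ((A → A) → N) →+ ((A → A) → N) := fun i a =>
    { toFun := fun w f => if good a f then w (fun z => f (T i a z)) else 0
      map_zero' := by funext f; simp
      map_add' := fun w w' => by
        funext f
        by_cases hf : good a f <;> simp [hf] }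
  have hΦ : ∀ i a x, (a, x) ∈ μ → Φ i a (δ a x) = δ a (T i a x) := fun i a x hx => by
    funext f
    by_cases hf : good a f
    · have hf' : good a fun z => f (T i a z) :=
        ⟨hf.1.comp (hT i a), fun z => hf.2.1 _, by simpa only [hTa] using hf.2.2⟩
      simp only [Φ, δ, AddMonoidHom.coe_mk, ZeroHom.coe_mk, if_pos hf]
      rw [if_pos ⟨hf', hx⟩, if_pos ⟨hf, hTμ i a x hx⟩, hTa]
    · have hf' : ¬ (good a f ∧ (a, T i a x) ∈ μ) := fun h => hf h.1
      simp only [Φ, δ, AddMonoidHom.coe_mk, ZeroHom.coe_mk, if_neg hf, if_neg hf']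
  have hδ0 : ∀ a x, (a, x) ∉ μ → δ a x = 0 := fun a x hx => by
    funext f
    simp [δ, hx]
  have hΦV : ∀ i a w, w ∈ V a → Φ i a w ∈ V a := fun i a w hw => by
    have h1 : V a ≤ (V a).comap (Φ i a) := by
      refine (AddSubgroup.closure_le _).2 ?_
      rintro _ ⟨x, rfl⟩
      by_cases hx : (a, x) ∈ μ
      · show Φ i a (δ a x) ∈ V a; rw [hΦ i a x hx]; exact hδ a _
      · rw [hδ0 a x hx]; exact zero_mem _
    exact h1 hw
  refine ⟨fun a => V a, fun a => inferInstance, fun a => inferInstance, fun a x => ⟨δ a x, hδ a x⟩,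
    fun i a => ((Φ i a).comp (V a).subtype).codRestrict (V a) fun w => hΦV i a _ w.2,
    ?_, ?_, ?_, ?_⟩
  · intro a x y hx hy hxy
    by_contra hne
    obtain ⟨f, hf, hef, hfx, hfy⟩ := hM.sep x y hne
    have hg : good a f := ⟨hf, hef, by
      have := hf.mem hμ.1 hμ.2.refl (hμ.2.symm hx)
      rwa [hfx] at this⟩
    have h1 := congrFun (congrArg Subtype.val hxy) f
    simp only [δ] at h1
    rw [if_pos ⟨hg, hx⟩, if_pos ⟨hg, hy⟩, sub_left_inj] at h1
    have h2 := congrArg Subtype.val h1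
    rw [toN_coe _ (hef _) (good_mem hg hx), toN_coe _ (hef _) (good_mem hg hy), hfx] at h2
    exact hfy (hfx.trans h2)
  · intro a
    refine Subtype.ext (funext fun f => ?_)
    simp [δ]
  · intro a φ ψ h
    refine AddMonoidHom.ext fun w => ?_
    obtain ⟨w, hw⟩ := w
    induction hw using AddSubgroup.closure_induction with
    | mem w hw =>
      obtain ⟨x, rfl⟩ := hw
      by_cases hx : (a, x) ∈ μ
      · exact h x hx
      · have : (⟨δ a x, hδ a x⟩ : V a) = 0 := Subtype.ext (hδ0 a x hx)
        rw [this]; exact (map_zero φ).trans (map_zero ψ).symm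
    | zero => exact (map_zero φ).trans (map_zero ψ).symm
    | add x y hx hy ihx ihy =>
      exact (map_add φ ⟨x, hx⟩ ⟨y, hy⟩).trans
        ((congrArg₂ (· + ·) ihx ihy).trans (map_add ψ ⟨x, hx⟩ ⟨y, hy⟩).symm)
    | neg x hx ihx =>
      exact (map_neg φ ⟨x, hx⟩).trans ((congrArg Neg.neg ihx).trans (map_neg ψ ⟨x, hx⟩).symm)
  · intro a x hx
    refine Subtype.ext ?_
    rw [AddSubgroup.val_finsetSum]
    have e1 : ∀ i, (((Φ i a).comp (V a).subtype).codRestrict (V a) (fun w => hΦV i a _ w.2)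
        ⟨δ a (x i), hδ a (x i)⟩ : (A → A) → N) = δ a (T i a (x i)) := fun i => hΦ i a _ (hx i)
    refine Eq.trans ?_ (Finset.sum_congr rfl fun i _ => (e1 i).symm)
    funext f
    rw [Finset.sum_apply]
    have htx : (a, t.eval x) ∈ μ := by
      have := hμ.1.eval_pair t (fun _ => a) x hx
      rwa [ht] at this
    by_cases hf : good a f
    swap
    · simp [δ, hf]
    have e2 : ∀ y, (a, y) ∈ μ → δ a y f = toN (f y) - toN (f a) := fun y hy => if_pos ⟨hf, hy⟩
    refine (e2 _ htx).trans ?_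
    rw [Finset.sum_congr rfl fun i _ => e2 _ (hTμ i a _ (hx i))]
    let H : (Fin n → A) → A := fun z => f (t.eval z)
    have hH : IsPol S H := hf.1.app (IsPol.term t (g := fun i z => z i) fun i => .proj i)
    have hHa : H (fun _ => a) = f a := by simp only [H, ht]
    have hHμ : ∀ z, (∀ i, (a, z i) ∈ μ) → (o, H z) ∈ μ := fun z hz => by
      have := hH.mem hμ.1 hμ.2.refl hz
      rw [hHa] at this
      exact hμ.2.trans hf.2.2 this
    have hHe : ∀ z, e (H z) = H z := fun z => hf.2.1 _
    have hsub : ∀ y z, (∀ i, (a, y i) ∈ μ) → (∀ i, (a, z i) ∈ μ) →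
        ((toN (H y) - toN (H z) : N) : A) = p (H y) (H z) o := fun y z hy hz => by
      show p (toN (H y)) (toN (H z)) o = _
      rw [toN_coe _ (hHe _) (hHμ y hy), toN_coe _ (hHe _) (hHμ z hz)]
    have key : ∀ s : Finset (Fin n), toN (H (s.piecewise x fun _ => a)) - toN (f a) =
        ∑ i ∈ s, (toN (f (T i a (x i))) - toN (f a)) := by
      intro s
      induction s using Finset.induction_on with
      | empty => simp [hHa]
      | insert i s his ih =>
        rw [Finset.sum_insert his, ← ih, Finset.piecewise_insert]
        set w := s.piecewise x fun _ => a with hw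
        have hwμ : ∀ j, (a, w j) ∈ μ := fun j => by
          by_cases hj : j ∈ s
          · simpa [hw, hj] using hx j
          · simpa [hw, hj] using hμ.2.refl a
        have hupd : ∀ v : Fin n → A, (∀ j, (a, v j) ∈ μ) → ∀ y, (a, y) ∈ μ → ∀ j,
            (a, Function.update v i y j) ∈ μ := fun v hv y hy j => by
          by_cases hj : j = i
          · subst hj; simpa using hy
          · simpa [hj] using hv j
        have haμ : ∀ j : Fin n, (a, (fun _ => a : Fin n → A) j) ∈ μ := fun j => hμ.2.refl a
        have hwi : w i = a := by simp [hw, his]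
        have hpp : ∀ z, (∀ j, (a, z j) ∈ μ) → p (H z) (H z) o = o := fun z hz =>
          hM.left _ _ (hHe z) hM.base (hHμ z hz) hoo
        have hag : toN (H (Function.update w i (x i))) - toN (H w) =
            toN (H (Function.update (fun _ => a) i (x i))) - toN (H fun _ => a) := by
          refine Subtype.ext ?_
          rw [hsub _ _ (hupd w hwμ _ (hx i)) hwμ, hsub _ _ (hupd _ haμ _ (hx i)) haμ]
          have hup : ∀ y : (Fin n → A) → A, IsPol S y → ∀ g : Fin n → (Fin n → A) → A,
              (∀ j, IsPol S (g j)) →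
              IsPol S fun z => H (Function.update (fun j => g j z) i (y z)) :=
            fun y hy g hg => by
              have := hH.comp (g := Function.update g i y) fun j => by
                by_cases hj : j = i
                · subst hj; simpa using hy
                · simpa [hj] using hg j
              refine (congrArg (IsPol S) (funext fun z => congrArg H (funext fun j => ?_))).mp this
              by_cases hj : j = i
              · subst hj; simp
              · simp [hj]
          have := hM.agree hC
            (F := fun z => p (H z) (H (Function.update z i a)) o)
            (G := fun z => p (H (Function.update (fun _ => a) i (z i))) (H fun _ => a) o)
            (hM.mal.app hH (hup _ (.const a) _ fun j => .proj j) (.const o))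
            (hM.mal.app (hup _ (.proj i) _ fun j => .const a) (.const _) (.const o))
            (fun _ => hM.range _ _ _) (fun _ => hM.range _ _ _) (x := fun _ => a)
            (y := Function.update (fun _ => a) i (x i)) (z := w)
            (w := Function.update w i (x i)) (fun j => ?_) ?_ ?_ ?_ ?_
          · simpa [← hwi] using this
          · by_cases hj : j = i
            · subst hj; right; simpa [hwi] using hx j
            · left; simpa [hj] using hwμ j
          · simp
          · simp
          · have hwu : Function.update w i a = w := by rw [Function.update_eq_self_iff, hwi]
            have hau : Function.update (fun _ : Fin n => a) i a = fun _ => a := by simp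
            show p (H w) (H (Function.update w i a)) o =
              p (H (Function.update (fun _ => a) i (w i))) (H fun _ => a) o
            rw [hwi, hwu, hau, hpp w hwμ, hpp _ haμ]
          · simp only [Function.update_eq_self_iff.2 rfl]
            rw [hpp _ haμ]; exact hoo
        rw [hHa] at hag
        have e3 : H (Function.update (fun _ => a) i (x i)) = f (T i a (x i)) := rfl
        rw [← e3, ← hag]
        abel
    have := key Finset.univ
    rwa [Finset.piecewise_univ] at this

/-- Substitution of terms for the variables of a term. -/
def STerm.subst {m n : ℕ} (t : STerm S m) (s : Fin m → STerm S n) : STerm S n :=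
  match t with
  | .var i => s i
  | .app f ts => .app f fun i => (ts i).subst s

theorem STerm.eval_subst {m n : ℕ} (t : STerm S m) (s : Fin m → STerm S n) (v : Fin n → A) :
    (t.subst s).eval v = t.eval fun i => (s i).eval v := by
  induction t with
  | var i => rfl
  | app f ts ih => simp only [STerm.subst, STerm.eval, ih]

/-- A Taylor term yields a term which is a difference term on the blocks of an abelian
monolith. -/
theorem MaltsevSet.exists_difference_term [Finite A] (hM : MaltsevSet S μ e o p)
    (hC : Centralizes S μ μ (diag A)) {n : ℕ} {t : STerm S n} {u v : Fin n → Fin n → Fin 2}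
    (huv : ∀ i, u i i ≠ v i i) (ht : TaylorOn S A t u v) :
    ∃ d : STerm S 3, (∀ (C : Type) [SAlg S C], (∀ a : C, t.eval (fun _ => a) = a) →
        ∀ a : C, d.eval (fun _ => a) = a) ∧
      ∀ a b : A, (a, b) ∈ μ → d.eval ![a, a, b] = b ∧ d.eval ![b, a, a] = b := by
  classical
  obtain ⟨V, _, _, D, r, hinj, h0, hext, hlin⟩ := hM.exists_linear hC t ht.1
  have hμ := hM.congr
  let R := ∀ a, AddMonoid.End (V a)
  have : ∀ a, Finite (AddMonoid.End (V a)) := fun a => DFunLike.finite _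
  have hRext : ∀ φ ψ : R, (∀ a x, (a, x) ∈ μ → φ a (D a x) = ψ a (D a x)) → φ = ψ :=
    fun φ ψ h => funext fun a => hext a _ _ (h a)
  have happ : ∀ (w : Fin n → R) a x, (∑ j, w j) a x = ∑ j, w j a x := fun w a x => by
    rw [Finset.sum_apply]
    exact AddMonoidHom.finsetSum_apply _ _ _
  let P : STerm S 3 → R × R × R → Prop := fun q w =>
    (∀ (C : Type) [SAlg S C], (∀ a : C, t.eval (fun _ => a) = a) →
        ∀ a : C, q.eval (fun _ => a) = a) ∧ w.1 + w.2.1 + w.2.2 = 1 ∧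
      ∀ a (x : Fin 3 → A), (∀ i, (a, x i) ∈ μ) → D a (q.eval x) =
        w.1 a (D a (x 0)) + w.2.1 a (D a (x 1)) + w.2.2 a (D a (x 2))
  have hidem : ∀ {q w} a (x : Fin 3 → A), P q w → (∀ i, (a, x i) ∈ μ) → (a, q.eval x) ∈ μ := by
    intro q w a x hP hx
    have := hμ.1.eval_pair q (fun _ => a) x hx
    rwa [hP.1 A ht.1] at this
  have hr : ∑ j, r j = 1 := hRext _ _ fun a x hx => by
    rw [happ]
    have := hlin a (fun _ => x) fun _ => hx
    rw [ht.1] at this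
    exact this.symm
  have hmem : ((1, -1, 1) : R × R × R) ∈ {w | ∃ q, P q w} := by
    refine exists_maltsev_coeff r hr u v huv (fun i => hRext _ _ fun a x hx => ?_) _
      (fun w ⟨q, hq⟩ => hq.2.1) ?_ ?_ ?_ ?_ ?_
    · have h1 := congrArg (D a) (ht.2 i a x)
      rw [hlin _ _ fun j => ?_, hlin _ _ fun j => ?_] at h1
      · rw [happ, happ]
        refine (Finset.sum_congr rfl fun j _ => ?_).trans (h1.trans
          (Finset.sum_congr rfl fun j _ => ?_))
        · by_cases hj : u i j = 0
          · simp only [hj, if_true, h0, map_zero]; rfl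
          · simp only [hj, if_false]
        · by_cases hj : v i j = 0
          · simp only [hj, if_true, h0, map_zero]; rfl
          · simp only [hj, if_false]
      · by_cases hj : v i j = 0
        · simpa [hj] using hμ.2.refl a
        · simpa [hj] using hx
      · by_cases hj : u i j = 0
        · simpa [hj] using hμ.2.refl a
        · simpa [hj] using hx
    · exact ⟨.var 0, fun C _ _ a => rfl, by simp, fun a x _ => by
        show D a (x 0) = D a (x 0) + 0 + 0
        simp⟩
    · exact ⟨.var 1, fun C _ _ a => rfl, by simp, fun a x _ => by
        show D a (x 1) = 0 + D a (x 1) + 0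
        simp⟩
    · exact ⟨.var 2, fun C _ _ a => rfl, by simp, fun a x _ => by
        show D a (x 2) = 0 + 0 + D a (x 2)
        simp⟩
    · intro G hG
      choose q hq using hG
      have e1 : (∑ j, r j • G j).1 = ∑ j, r j * (G j).1 := by simp [Prod.fst_sum]
      have e2 : (∑ j, r j • G j).2.1 = ∑ j, r j * (G j).2.1 := by simp [Prod.fst_sum, Prod.snd_sum]
      have e3 : (∑ j, r j • G j).2.2 = ∑ j, r j * (G j).2.2 := by simp [Prod.snd_sum]
      refine ⟨t.subst q, fun C _ hC a => ?_, ?_, fun a x hx => ?_⟩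
      · rw [STerm.eval_subst]
        simp only [(hq _).1 C hC, hC]
      · rw [e1, e2, e3, ← Finset.sum_add_distrib, ← Finset.sum_add_distrib, ← hr]
        refine Finset.sum_congr rfl fun j _ => ?_
        rw [← mul_add, ← mul_add, (hq j).2.1, mul_one]
      · rw [STerm.eval_subst, hlin _ _ fun j => hidem a x (hq j) hx, e1, e2, e3, happ, happ, happ,
          ← Finset.sum_add_distrib, ← Finset.sum_add_distrib]
        refine Finset.sum_congr rfl fun j _ => ?_
        rw [(hq j).2.2 a x hx, map_add, map_add]
        rfl
    · rintro w ⟨q, hq⟩ x ⟨qx, hqx⟩ y ⟨qy, hqy⟩ z ⟨qz, hqz⟩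
      refine ⟨q.subst ![qx, qy, qz], fun C _ hC a => ?_, ?_, fun a k hk => ?_⟩
      · rw [STerm.eval_subst, ← hq.1 C hC a]
        congr 1; funext i
        rw [hq.1 C hC a]
        fin_cases i
        · exact hqx.1 C hC a
        · exact hqy.1 C hC a
        · exact hqz.1 C hC a
      · have e1 : ∀ s : R, ∀ k : R × R × R, k.1 + k.2.1 + k.2.2 = 1 →
            s * k.1 + s * k.2.1 + s * k.2.2 = s := fun s k hk => by
          rw [← mul_add, ← mul_add, hk, mul_one]
        have e2 : w.1 * x.1 + w.2.1 * y.1 + w.2.2 * z.1 +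
            (w.1 * x.2.1 + w.2.1 * y.2.1 + w.2.2 * z.2.1) +
            (w.1 * x.2.2 + w.2.1 * y.2.2 + w.2.2 * z.2.2) = 1 := by
          refine Eq.trans ?_ hq.2.1
          calc _ = (w.1 * x.1 + w.1 * x.2.1 + w.1 * x.2.2) +
                (w.2.1 * y.1 + w.2.1 * y.2.1 + w.2.1 * y.2.2) +
                (w.2.2 * z.1 + w.2.2 * z.2.1 + w.2.2 * z.2.2) := by abel
            _ = _ := by rw [e1 w.1 x hqx.2.1, e1 w.2.1 y hqy.2.1, e1 w.2.2 z hqz.2.1]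
        exact e2
      · rw [STerm.eval_subst, hq.2.2 a _ fun i => ?_]
        · show w.1 a (D a (qx.eval k)) + w.2.1 a (D a (qy.eval k)) + w.2.2 a (D a (qz.eval k)) = _
          rw [hqx.2.2 a k hk, hqy.2.2 a k hk, hqz.2.2 a k hk]
          simp only [map_add]
          show _ = (w.1 a (x.1 a (D a (k 0))) + w.2.1 a (y.1 a (D a (k 0))) +
            w.2.2 a (z.1 a (D a (k 0)))) + (w.1 a (x.2.1 a (D a (k 1))) +
            w.2.1 a (y.2.1 a (D a (k 1))) + w.2.2 a (z.2.1 a (D a (k 1)))) +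
            (w.1 a (x.2.2 a (D a (k 2))) + w.2.1 a (y.2.2 a (D a (k 2))) +
            w.2.2 a (z.2.2 a (D a (k 2))))
          abel
        · fin_cases i
          · exact hidem a k hqx hk
          · exact hidem a k hqy hk
          · exact hidem a k hqz hk
  obtain ⟨d, hd⟩ := hmem
  refine ⟨d, hd.1, fun a b hab => ?_⟩
  have haa := hμ.2.refl a
  have h1 : ∀ i, (a, (![a, a, b] : Fin 3 → A) i) ∈ μ := fun i => by
    fin_cases i <;> assumption
  have h2 : ∀ i, (a, (![b, a, a] : Fin 3 → A) i) ∈ μ := fun i => by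
    fin_cases i <;> assumption
  constructor
  · refine hinj a _ _ (hidem a _ hd h1) hab ?_
    rw [hd.2.2 a _ h1]
    show D a a + -(D a a) + D a b = D a b
    abel
  · refine hinj a _ _ (hidem a _ hd h2) hab ?_
    rw [hd.2.2 a _ h2]
    show D a b + -(D a a) + D a a = D a b
    abel

end Linear

section Abelian
variable {A : Type} [SAlg S A] {τ : Set (A × A)}

/-- The term `d` satisfies the Maltsev identities on the blocks of `μ`. -/
def DiffOn {A : Type} [SAlg S A] (d : STerm S 3) (μ : Set (A × A)) : Prop :=
  ∀ a b : A, (a, b) ∈ μ → d.eval ![a, a, b] = b ∧ d.eval ![b, a, a] = b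

theorem Irr.transCl_eq (h : Irr S τ) {d : STerm S 3} (hd : DiffOn d (transCl τ)) :
    transCl τ = τ := by
  refine Set.Subset.antisymm ?_ (subset_transCl τ)
  rintro ⟨a, b⟩ hab
  have hab' : Relation.TransGen (fun a b => (a, b) ∈ τ) a b := hab
  clear hab
  induction hab' with
  | single hb => exact hb
  | @tail b c hab hbc ih =>
    have h1 := h.sub.eval_pair_three d ih (h.refl b) hbc
    rwa [(hd b a (h.transCl_congr.2.symm (subset_transCl τ ih))).2,
      (hd b c (subset_transCl τ hbc)).1] at h1

/-- An abelian irreducible algebra in a Taylor variety has a difference term for its monolith. -/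
theorem Irr.exists_diffOn [Finite A] (h : Irr S τ) (hC : Centralizes S τ τ (diag A)) {n : ℕ}
    {t : STerm S n} {u v : Fin n → Fin n → Fin 2} (hn : 1 < n) (huv : ∀ i, u i i ≠ v i i)
    (ht : TaylorOn S A t u v) :
    transCl τ = τ ∧ ∃ d : STerm S 3, (∀ (C : Type) [SAlg S C], (∀ a : C, t.eval (fun _ => a) = a) →
      ∀ a : C, d.eval (fun _ => a) = a) ∧ DiffOn d τ := by
  obtain ⟨e, o, p, hM⟩ := exists_maltsevSet h hC hn huv ht
  obtain ⟨d, hd, hd'⟩ := hM.exists_difference_term (hM.centralizes h hC) huv ht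
  have h1 := h.transCl_eq hd'
  exact ⟨h1, d, hd, fun a b hab => hd' a b (subset_transCl τ hab)⟩

end Abelian

section Delta
variable {A : Type} [SAlg S A] {τ μ : Set (A × A)}

theorem mem_alph_of_terms [Finite A] (hr : ∀ a, (a, a) ∈ μ) {a b : A}
    (h : ∀ (n : ℕ) (t : STerm S (n + 1)) (x y : Fin n → A), (∀ i, (x i, y i) ∈ μ) →
      (t.eval (Fin.cons a x) = t.eval (Fin.cons a y) ↔
        t.eval (Fin.cons b x) = t.eval (Fin.cons b y))) : (a, b) ∈ alph S μ := by
  classical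
  intro f hf
  obtain ⟨n, ⟨E⟩⟩ := Finite.exists_equiv_fin ((Unit ⊕ μ) ⊕ A)
  obtain ⟨t, ht⟩ := hf.exists_term_update E.symm (Sum.inl ())
  have key : ∀ (c : A) (g : μ → A), f (Sum.elim (fun _ => c) g) =
      t.eval (Fin.cons c fun j => Sum.elim (Sum.elim (fun _ => a) g) id (E.symm j)) := by
    intro c g
    rw [← ht]
    congr 1
    funext i
    rcases i with _ | i <;> simp
  simp only [key]
  refine h n t _ _ fun j => ?_
  rcases E.symm j with (_ | q) | c
  · exact hr _
  · exact q.2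
  · exact hr _

theorem DeltaCon.isConOn (hμ : IsCongruence S μ) (α : Set (A × A)) :
    IsConOn S μ (DeltaCon S μ α) := by
  have hprod : μ ×ˢ μ ∈ {Δ | IsConOn S μ Δ ∧ ∀ a b : A, (a, b) ∈ α → ((a, a), (b, b)) ∈ Δ} :=
    ⟨⟨subset_rfl, fun o x hx => ⟨hμ.1 o _ fun i => (hx i).1, hμ.1 o _ fun i => (hx i).2⟩,
      fun p hp => ⟨hp, hp⟩, fun p q h => ⟨h.2, h.1⟩, fun p q r h h' => ⟨h.1, h'.2⟩⟩,
      fun a b _ => ⟨hμ.2.refl a, hμ.2.refl b⟩⟩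
  refine ⟨fun p hp => hp _ hprod, fun o x hx Δ hΔ => hΔ.1.2.1 o x fun i => hx i Δ hΔ,
    fun p hp Δ hΔ => hΔ.1.2.2.1 p hp, fun p q h Δ hΔ => hΔ.1.2.2.2.1 p q (h Δ hΔ),
    fun p q r h h' Δ hΔ => hΔ.1.2.2.2.2 p q r (h Δ hΔ) (h' Δ hΔ)⟩

theorem DeltaCon.diag_mem {α : Set (A × A)} {a b : A} (h : (a, b) ∈ α) :
    ((a, a), (b, b)) ∈ DeltaCon S μ α := fun _ hΔ => hΔ.2 a b h

theorem DeltaCon.eq_iff_and_mem [Finite A] (hμ : IsCongruence S μ) {p q : A × A}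
    (h : (p, q) ∈ DeltaCon S μ (alph S μ)) :
    (p.1 = p.2 ↔ q.1 = q.2) ∧ (p.1, q.1) ∈ alph S μ := by
  have hα := alph_congr (S := S) μ
  let ι := alph S μ ⊕ μ
  let x : ι → A := Sum.elim (fun r => r.1.1) fun r => r.1.1
  let y : ι → A := Sum.elim (fun r => r.1.1) fun r => r.1.2
  let z : ι → A := Sum.elim (fun r => r.1.2) fun r => r.1.1
  let w : ι → A := Sum.elim (fun r => r.1.2) fun r => r.1.2
  let M : Set ((A × A) × (A × A)) :=
    {r | ∃ f : (ι → A) → A, IsPol S f ∧ r = ((f x, f y), (f z, f w))}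
  have hMsub : IsSubuniverse S M := by
    intro o r hr
    choose f hf hrf using hr
    refine ⟨_, .app o f hf, ?_⟩
    rw [show r = fun i => ((f i x, f i y), (f i z, f i w)) from funext hrf]
    rfl
  have hMrefl : ∀ p ∈ μ, (p, p) ∈ M := fun p hp => ⟨_, .proj (Sum.inr ⟨p, hp⟩), rfl⟩
  have hMμ : M ⊆ μ ×ˢ μ := by
    rintro _ ⟨f, hf, rfl⟩
    constructor
    · refine hf.mem hμ.1 hμ.2.refl fun i => ?_
      rcases i with i | i
      · exact hμ.2.refl _
      · exact i.2
    · refine hf.mem hμ.1 hμ.2.refl fun i => ?_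
      rcases i with i | i
      · exact hμ.2.refl _
      · exact i.2
  have hMsymm : ∀ p q, (p, q) ∈ M → (q, p) ∈ M := by
    rintro _ _ ⟨f, hf, h⟩
    rw [Prod.mk.injEq] at h
    obtain ⟨rfl, rfl⟩ := h
    let σ : ι → ι := Sum.elim (fun r => .inl ⟨(r.1.2, r.1.1), hα.2.symm r.2⟩) .inr
    refine ⟨fun v => f fun i => v (σ i), hf.comp fun i => .proj _, ?_⟩
    have e1 : (fun i => x (σ i)) = z := funext fun i => by rcases i with i | i <;> rfl
    have e2 : (fun i => y (σ i)) = w := funext fun i => by rcases i with i | i <;> rfl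
    have e3 : (fun i => z (σ i)) = x := funext fun i => by rcases i with i | i <;> rfl
    have e4 : (fun i => w (σ i)) = y := funext fun i => by rcases i with i | i <;> rfl
    show ((f z, f w), (f x, f y)) = ((f fun i => x (σ i), f fun i => y (σ i)),
      (f fun i => z (σ i), f fun i => w (σ i)))
    rw [e1, e2, e3, e4]
  have hM : ∀ p q, (p, q) ∈ M → (p.1 = p.2 ↔ q.1 = q.2) ∧ (p.1, q.1) ∈ alph S μ := by
    have himp : ∀ p q, (p, q) ∈ M → p.1 = p.2 → q.1 = q.2 := by
      rintro _ _ ⟨f, hf, h⟩ heq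
      rw [Prod.mk.injEq] at h
      obtain ⟨rfl, rfl⟩ := h
      refine (alph_centralizes μ).matrix hμ.2.refl hf (fun i => ?_) heq
      rcases i with i | i
      · exact .inl ⟨rfl, rfl, i.2⟩
      · exact .inr ⟨rfl, rfl, i.2⟩
    refine fun p q hpq => ⟨⟨himp p q hpq, himp q p (hMsymm _ _ hpq)⟩, ?_⟩
    obtain ⟨f, hf, h⟩ := hpq
    rw [Prod.mk.injEq] at h
    obtain ⟨rfl, rfl⟩ := h
    refine hf.mem hα.1 hα.2.refl fun i => ?_
    rcases i with i | i
    · exact i.2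
    · exact hα.2.refl _
  have hmem : transCl M ∈ {Δ | IsConOn S μ Δ ∧ ∀ a b : A, (a, b) ∈ alph S μ →
      ((a, a), (b, b)) ∈ Δ} := by
    refine ⟨⟨?_, ?_, fun p hp => .single (hMrefl p hp), ?_, fun p q r h h' => .trans h h'⟩,
      fun a b hab => .single ⟨_, .proj (Sum.inl ⟨_, hab⟩), rfl⟩⟩
    · rintro ⟨p, q⟩ hpq
      have hpq' : Relation.TransGen (fun a b => (a, b) ∈ M) p q := hpq
      clear hpq
      induction hpq' with
      | single h => exact hMμ h
      | tail _ h ih => exact ⟨ih.1, (hMμ h).2⟩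
    · exact transCl_subuniverse hMsub fun p q h =>
        ⟨hMrefl p (hMμ h).1, hMrefl q (hMμ h).2⟩
    · intro p q hpq
      have hpq' : Relation.TransGen (fun a b => (a, b) ∈ M) p q := hpq
      clear hpq
      induction hpq' with
      | single h => exact .single (hMsymm _ _ h)
      | tail _ h ih => exact .head (hMsymm _ _ h) ih
  have hpq : Relation.TransGen (fun a b => (a, b) ∈ M) p q := h _ hmem
  clear h
  induction hpq with
  | single h => exact hM _ _ h
  | tail _ h ih => exact ⟨ih.1.trans (hM _ _ h).1, hα.2.trans ih.2 (hM _ _ h).2⟩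

/-- An irreducible algebra whose least reflexive relation is an abelian congruence with a
difference term. -/
structure AbIrr (S : Signature) {A : Type} [SAlg S A] (τ : Set (A × A)) (d : STerm S 3) :
    Prop where
  irr : Irr S τ
  congr : IsCongruence S τ
  ab : Centralizes S τ τ (diag A)
  diff : DiffOn d τ

variable {d : STerm S 3}

theorem AbIrr.symm (h : AbIrr S τ d) {a b : A} (hab : (a, b) ∈ τ) : (b, a) ∈ τ :=
  h.congr.2.symm hab

theorem AbIrr.left (h : AbIrr S τ d) {a b : A} (hab : (a, b) ∈ τ) : d.eval ![a, a, b] = b :=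
  (h.diff a b hab).1

theorem AbIrr.right (h : AbIrr S τ d) {a b : A} (hab : (a, b) ∈ τ) : d.eval ![a, b, b] = a :=
  (h.diff b a (h.symm hab)).2

theorem AbIrr.subset_alph [Finite A] (h : AbIrr S τ d) : τ ⊆ alph S τ :=
  Zhuk.subset_alph h.irr.refl (fun _ _ => h.symm) h.ab

theorem AbIrr.cancel [Finite A] (h : AbIrr S τ d) {e f f' : A} (hf : (e, f) ∈ τ)
    (hf' : (e, f') ∈ τ) (heq : d.eval ![f', f, e] = e) : f' = f := by
  have hff := h.congr.2.trans (h.symm hf) hf'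
  have h1 : d.eval ![f', f, e] = d.eval ![f, f, e] := by rw [heq, h.left (h.symm hf)]
  have h2 : d.eval ![f', f, f] = d.eval ![f, f, f] := by
    refine h.ab.matrix h.irr.refl (IsPol.term d (g := fun i x => x i) fun i => .proj i)
      (x := ![f', f, e]) (y := ![f, f, e]) (fun i => ?_) h1
    fin_cases i
    · exact .inr ⟨rfl, rfl, h.symm hff⟩
    · exact .inl ⟨rfl, rfl, h.irr.refl _⟩
    · exact .inl ⟨rfl, rfl, hf⟩
  rwa [h.right (h.symm hff), h.right (h.irr.refl f)] at h2

theorem DeltaCon.eval_three {α : Set (A × A)} (hμ : IsCongruence S μ) (t : STerm S 3)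
    {a a' b b' c c' x x' y y' z z' : A}
    (h0 : ((a, a'), (x, x')) ∈ DeltaCon S μ α) (h1 : ((b, b'), (y, y')) ∈ DeltaCon S μ α)
    (h2 : ((c, c'), (z, z')) ∈ DeltaCon S μ α) :
    ((t.eval ![a, b, c], t.eval ![a', b', c']), (t.eval ![x, y, z], t.eval ![x', y', z'])) ∈
      DeltaCon S μ α := by
  have := (DeltaCon.isConOn hμ α).2.1.eval_pair_three t h0 h1 h2
  rwa [eval_prod_three, eval_prod_three] at this

theorem AbIrr.delta_right_inj [Finite A] (h : AbIrr S τ d) {e f f' : A}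
    (hΔ : ((e, f), (e, f')) ∈ DeltaCon S τ (alph S τ)) : f = f' := by
  have hcon := DeltaCon.isConOn h.congr (alph S τ)
  have hf : (e, f) ∈ τ := (hcon.1 hΔ).1
  have hf' : (e, f') ∈ τ := (hcon.1 hΔ).2
  have h1 := (DeltaCon.eq_iff_and_mem h.congr (DeltaCon.eval_three h.congr d hΔ
    (hcon.2.2.1 _ hf) (hcon.2.2.1 _ (h.irr.refl e)))).1
  simp only [h.left (h.irr.refl e), h.left (h.symm hf), true_iff] at h1
  exact (h.cancel hf hf' h1.symm).symm

theorem AbIrr.delta_normal [Finite A] (h : AbIrr S τ d) {a b a' b' : A} (hab : (a, b) ∈ τ)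
    (hab' : (a', b') ∈ τ) (hα : (a, a') ∈ alph S τ) :
    ((a, b), (d.eval ![a, a, a'], d.eval ![b, a, a'])) ∈ DeltaCon S τ (alph S τ) ∧
      ((a', b'), (d.eval ![a, a, a'], d.eval ![a, a, b'])) ∈ DeltaCon S τ (alph S τ) := by
  have hcon := DeltaCon.isConOn h.congr (alph S τ)
  have hα' := (alph_congr (S := S) τ).2.symm hα
  constructor
  · have := DeltaCon.eval_three h.congr d (hcon.2.2.1 _ hab) (hcon.2.2.1 _ (h.irr.refl a))
      (DeltaCon.diag_mem (μ := τ) hα)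
    rwa [h.left (h.irr.refl a), h.right (h.symm hab)] at this
  · have := DeltaCon.eval_three h.congr d (DeltaCon.diag_mem (μ := τ) hα')
      (DeltaCon.diag_mem (μ := τ) hα') (hcon.2.2.1 _ hab')
    rwa [h.left (h.irr.refl a'), h.left hab'] at this

theorem AbIrr.delta_of_eq [Finite A] (h : AbIrr S τ d) {a b a' b' : A} (hab : (a, b) ∈ τ)
    (hab' : (a', b') ∈ τ) (hα : (a, a') ∈ alph S τ)
    (heq : d.eval ![b, a, a'] = d.eval ![a, a, b']) :
    ((a, b), (a', b')) ∈ DeltaCon S τ (alph S τ) := by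
  have hcon := DeltaCon.isConOn h.congr (alph S τ)
  obtain ⟨h1, h2⟩ := h.delta_normal hab hab' hα
  rw [heq] at h1
  exact hcon.2.2.2.2 _ _ _ h1 (hcon.2.2.2.1 _ _ h2)

end Delta

section Bridge

variable {A B : Type} [SAlg S A] [SAlg S B] {τ : Set (A × A)} {τ' : Set (B × B)}
  {T : Set (A × A × B × B)} {d : STerm S 3}

theorem IsSubuniverse.pr12 (h : IsSubuniverse S T) : IsSubuniverse S (pr12 T) := by
  intro o x hx
  choose b b' hb using hx
  exact ⟨_, _, h o (fun i => ((x i).1, (x i).2, b i, b' i)) hb⟩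

theorem IsSubuniverse.bConv (h : IsSubuniverse S T) : IsSubuniverse S (bConv T) :=
  fun o x hx => h o (fun i => ((x i).2.2.1, (x i).2.2.2, (x i).1, (x i).2.1)) hx

theorem IsSubuniverse.pr34 (h : IsSubuniverse S T) : IsSubuniverse S (pr34 T) :=
  h.bConv.pr12

/-- Bridges between diagonals whose projections are the prescribed relations. -/
structure Br (S : Signature) {A B : Type} [SAlg S A] [SAlg S B] (τ : Set (A × A))
    (τ' : Set (B × B)) (T : Set (A × A × B × B)) : Prop where
  sub : IsSubuniverse S T
  eqv : ∀ {a a' b b'}, (a, a', b, b') ∈ T → (a = a' ↔ b = b')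
  left : ∀ {a a' b b'}, (a, a', b, b') ∈ T → (a, a') ∈ τ
  right : ∀ {a a' b b'}, (a, a', b, b') ∈ T → (b, b') ∈ τ'
  totL : ∀ {a a'}, (a, a') ∈ τ → ∃ b b', (a, a', b, b') ∈ T
  totR : ∀ {b b'}, (b, b') ∈ τ' → ∃ a a', (a, a', b, b') ∈ T

theorem Br.conv (h : Br S τ τ' T) : Br S τ' τ (bConv T) where
  sub := h.sub.bConv
  eqv hz := (h.eqv hz).symm
  left hz := h.right hz
  right hz := h.left hz
  totL hb := h.totR hb
  totR ha := h.totL ha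

theorem Br.traceL (h : Br S τ τ' T) (hr : ∀ a, (a, a) ∈ τ) (a : A) : ∃ b, (a, a, b, b) ∈ T := by
  obtain ⟨b, b', hb⟩ := h.totL (hr a)
  obtain rfl := (h.eqv hb).1 rfl
  exact ⟨b, hb⟩

theorem Br.traceR (h : Br S τ τ' T) (hr : ∀ b, (b, b) ∈ τ') (b : B) : ∃ a, (a, a, b, b) ∈ T :=
  h.conv.traceL hr b

theorem exists_br (hA : Irr S τ) (hB : Irr S τ') (hT : IsBridge S (diag A) (diag B) T) :
    ∃ T', Br S τ τ' T' := by
  obtain ⟨hsub, -, -, hL, hR, heqv⟩ := hT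
  have heq : ∀ {a a' b b'}, (a, a', b, b') ∈ T → (a = a' ↔ b = b') := fun h => heqv _ _ _ _ h
  have hτ : τ ⊆ pr12 T := by
    obtain ⟨⟨a, a'⟩, h, hne⟩ := Set.exists_of_ssubset hL
    exact hA.least _ hsub.pr12 (fun x => hL.1 (show x = x from rfl)) a a' h hne
  let T₁ : Set (A × A × B × B) := {z | z ∈ T ∧ (z.1, z.2.1) ∈ τ}
  have hT₁ : IsSubuniverse S T₁ := fun o x hx =>
    ⟨hsub o x fun i => (hx i).1, hA.sub o (fun i => ((x i).1, (x i).2.1)) fun i => (hx i).2⟩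
  have hτ' : τ' ⊆ pr34 T₁ := by
    obtain ⟨a, a', haa, hne⟩ := hA.nontriv
    obtain ⟨b, b', hb⟩ := hτ haa
    refine hB.least _ hT₁.pr34 (fun y => ?_) b b' ⟨a, a', hb, haa⟩
      fun hbb => hne ((heq hb).2 hbb)
    obtain ⟨c, c', hc⟩ := hR.1 (show (y, y) ∈ diag B from rfl)
    obtain rfl := (heq hc).2 rfl
    exact ⟨c, c, hc, hA.refl c⟩
  let T₂ : Set (A × A × B × B) := {z | z ∈ T₁ ∧ (z.2.2.1, z.2.2.2) ∈ τ'}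
  have hT₂ : IsSubuniverse S T₂ := fun o x hx =>
    ⟨hT₁ o x fun i => (hx i).1,
      hB.sub o (fun i => ((x i).2.2.1, (x i).2.2.2)) fun i => (hx i).2⟩
  have hτ₂ : τ ⊆ pr12 T₂ := by
    obtain ⟨b, b', hbb, hne⟩ := hB.nontriv
    obtain ⟨a, a', ha⟩ := hτ' hbb
    refine hA.least _ hT₂.pr12 (fun x => ?_) a a' ⟨b, b', ha, hbb⟩
      fun haa => hne ((heq ha.1).1 haa)
    obtain ⟨c, c', hc⟩ := hτ (hA.refl x)
    obtain rfl := (heq hc).1 rfl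
    exact ⟨c, c, ⟨hc, hA.refl x⟩, hB.refl c⟩
  refine ⟨T₂, hT₂, fun hz => heq hz.1.1, fun hz => hz.1.2, fun hz => hz.2, fun ha => hτ₂ ha,
    fun {b b'} hb => ?_⟩
  obtain ⟨a, a', ha⟩ := hτ' hb
  exact ⟨a, a', ha, hb⟩

theorem Br.alph_of_left [Finite B] (h : Br S τ τ' T) (hB : IsCongruence S τ')
    (hd : DiffOn d τ') {a a' : A} {b b' c c' : B} (hb : (a, a', b, b') ∈ T)
    (hc : (a, a', c, c') ∈ T) : (b, c) ∈ alph S τ' := by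
  have key : ∀ {b b' c c' : B}, (a, a', b, b') ∈ T → (a, a', c, c') ∈ T →
      ∀ (n : ℕ) (t : STerm S (n + 1)) (x y : Fin n → B), (∀ i, (x i, y i) ∈ τ') →
      t.eval (Fin.cons b x) = t.eval (Fin.cons b y) →
      t.eval (Fin.cons c x) = t.eval (Fin.cons c y) := by
    intro b b' c c' hb hc n t x y hxy he
    choose g g' hg using fun i => h.totR (hxy i)
    choose m hm using fun i => h.traceR hB.2.refl (y i)
    have z1 := h.sub.eval_quad_cons t hb hg
    have z1' := h.sub.eval_quad_cons t hc hg
    have z2 := h.sub.eval_quad_cons t hb hm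
    have z2' := h.sub.eval_quad_cons t hc hm
    rw [← he] at z2
    obtain ⟨k, hk⟩ := h.traceR hB.2.refl (t.eval (Fin.cons c x))
    have r1 := h.right z1'
    have r2 := h.right z2'
    have e1 := h.eqv (h.sub.eval_quad_three d z1' z1' hk)
    have e2 := h.eqv (h.sub.eval_quad_three d z1 z1' hk)
    have e3 := h.eqv (h.sub.eval_quad_three d z2 z1' hk)
    have e4 := h.eqv (h.sub.eval_quad_three d z2' z1' hk)
    rw [(hd _ _ (hB.2.refl _)).1, (hd _ _ (hB.2.symm r1)).1] at e1
    rw [(hd _ _ (hB.2.symm r1)).1, (hd _ _ (hB.2.trans r1 (hB.2.symm r2))).2] at e4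
    exact (e4.1 (e3.2 (e2.1 (e1.2 rfl)))).symm
  exact mem_alph_of_terms hB.2.refl fun n t x y hxy =>
    ⟨key hb hc n t x y hxy, key hc hb n t x y hxy⟩

theorem Br.alph_of_trace [Finite B] (h : Br S τ τ' T) (hr : ∀ b, (b, b) ∈ τ') {a a' : A}
    {b b' : B} (hb : (a, a, b, b) ∈ T) (hb' : (a', a', b', b') ∈ T) (ha : (a, a') ∈ alph S τ) :
    (b, b') ∈ alph S τ' := by
  refine mem_alph_of_terms hr fun n t x y hxy => ?_
  choose g g' hg using fun i => h.totR (hxy i)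
  rw [← h.eqv (h.sub.eval_quad_cons t hb hg), ← h.eqv (h.sub.eval_quad_cons t hb' hg)]
  have hgg : ∀ i, (g i, g' i) ∈ τ := fun i => h.left (hg i)
  exact ⟨fun he => alph_centralizes τ n t _ _ g g' ha hgg he,
    fun he => alph_centralizes τ n t _ _ g g' ((alph_congr τ).2.symm ha) hgg he⟩

end Bridge

section Abelian

variable {A B : Type} [SAlg S A] [SAlg S B] {τ : Set (A × A)} {τ' : Set (B × B)}
  {T : Set (A × A × B × B)} {d d' : STerm S 3}

/-- The part of a bridge consisting of tuples whose trace is centralized. -/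
def opn (S : Signature) {A B : Type} [SAlg S B] (τ' : Set (B × B)) (T : Set (A × A × B × B)) :
    Set (A × A × B × B) :=
  {z | z ∈ T ∧ ∃ w, (z.1, z.1, w, w) ∈ T ∧ (w, z.2.2.1) ∈ alph S τ'}

theorem opn_subuniverse (h : IsSubuniverse S T) : IsSubuniverse S (opn S τ' T) := by
  intro o x hx
  choose hT w hw hα using hx
  exact ⟨h o x hT, _, h o (fun i => ((x i).1, (x i).1, w i, w i)) hw,
    (alph_congr τ').1 o (fun i => (w i, (x i).2.2.1)) hα⟩

theorem Br.opn_conv [Finite A] (h : Br S τ τ' T) (hA : ∀ a, (a, a) ∈ τ)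
    (hB : ∀ b, (b, b) ∈ τ') {a a' : A} {b b' : B} (hz : (a, a', b, b') ∈ opn S τ' T) :
    (b, b', a, a') ∈ opn S τ (bConv T) := by
  obtain ⟨hT, w, hw, hα⟩ := hz
  obtain ⟨m, hm⟩ := h.traceR hB b
  exact ⟨hT, m, hm, h.conv.alph_of_trace hA (a := b) (a' := w) (b := m) (b' := a) hm hw
    ((alph_congr τ').2.symm hα)⟩

theorem Br.exists_opn_of_term [Finite B] (h : Br S τ τ' T) (hA : ∀ a, (a, a) ∈ τ)
    (hC : Centralizes S τ τ (diag A)) (hB : IsCongruence S τ') (hd : DiffOn d τ') {c c' : A}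
    {u u' w : B} (hu : (c, c', u, u') ∈ T) (hw : (c, c, w, w) ∈ T) {n : ℕ}
    {t : STerm S (n + 1)} {x y : Fin n → B} (hxy : ∀ i, (x i, y i) ∈ τ')
    (he : t.eval (Fin.cons w x) = t.eval (Fin.cons w y))
    (hne : t.eval (Fin.cons u x) ≠ t.eval (Fin.cons u y)) :
    ∃ a a' b b', (a, a', b, b') ∈ opn S τ' T ∧ b ≠ b' := by
  choose g g' hg using fun i => h.totR (hxy i)
  choose v hv using fun i => h.traceL hA (g i)
  have e1 : t.eval (Fin.cons c g) = t.eval (Fin.cons c g') :=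
    (h.eqv (h.sub.eval_quad_cons t hw hg)).2 he
  have e2 : t.eval (Fin.cons c' g) = t.eval (Fin.cons c' g') :=
    hC n t c c' g g' (h.left hu) (fun i => h.left (hg i)) e1
  have z1 := h.sub.eval_quad_cons t hu hg
  rw [← e2] at z1
  have hα := h.alph_of_left hB hd (h.sub.eval_quad_cons t hu hv) z1
  obtain ⟨b, hb⟩ := h.traceR hB.2.refl u
  exact ⟨_, _, _, _, ⟨h.sub.eval_quad_cons t hb hg, _, h.sub.eval_quad_cons t hb hv, hα⟩, hne⟩

theorem Br.exists_opn [Finite A] [Finite B] (h : Br S τ τ' T) (hA : AbIrr S τ d)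
    (hB : AbIrr S τ' d') : ∃ a a' b b', (a, a', b, b') ∈ opn S τ' T ∧ b ≠ b' := by
  by_contra hcon
  obtain ⟨c, c', hc, hne⟩ := hA.irr.nontriv
  obtain ⟨u, u', hu⟩ := h.totL hc
  obtain ⟨w, hw⟩ := h.traceL hA.irr.refl c
  have hα : (w, u) ∈ alph S τ' := by
    refine mem_alph_of_terms hB.irr.refl fun n t x y hxy => ⟨fun he => ?_, fun he => ?_⟩
    · by_contra hne
      exact hcon (h.exists_opn_of_term hA.irr.refl hA.ab hB.congr hB.diff hu hw hxy he hne)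
    · choose g g' hg using fun i => h.totR (hxy i)
      obtain ⟨b, hb⟩ := h.traceR hB.irr.refl u
      have e1 := (h.eqv (h.sub.eval_quad_cons t hb hg)).2 he
      refine (h.eqv (h.sub.eval_quad_cons t hw hg)).1 ?_
      by_contra hne
      obtain ⟨b, b', a, a', hz, hne⟩ := h.conv.exists_opn_of_term hB.irr.refl hB.ab hA.congr
        hA.diff (c := u) (c' := u') (u := c) (u' := c') (w := b) hu hb
        (fun i => h.left (hg i)) e1 hne
      have hz' := h.conv.opn_conv hB.irr.refl hA.irr.refl hz
      exact hcon ⟨a, a', b, b', hz', fun hbb => hne ((h.eqv hz'.1).2 hbb)⟩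
  exact hcon ⟨c, c', u, u', ⟨hu, w, hw, hα⟩, fun huu => hne ((h.eqv hu).2 huu)⟩

theorem Br.opn_br [Finite A] [Finite B] (h : Br S τ τ' T) (hA : AbIrr S τ d)
    (hB : AbIrr S τ' d') : Br S τ τ' (opn S τ' T) := by
  obtain ⟨a, a', b, b', hz, hne⟩ := h.exists_opn hA hB
  have hsub := opn_subuniverse (τ' := τ') h.sub
  have hL : τ ⊆ pr12 (opn S τ' T) := by
    refine hA.irr.least _ hsub.pr12 (fun x => ?_) a a' ⟨b, b', hz⟩
      fun haa => hne ((h.eqv hz.1).1 haa)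
    obtain ⟨w, hw⟩ := h.traceL hA.irr.refl x
    exact ⟨w, w, hw, w, hw, (alph_congr τ').2.refl w⟩
  have hR : τ' ⊆ pr34 (opn S τ' T) := by
    refine hB.irr.least _ hsub.pr34 (fun x => ?_) b b' ⟨a, a', hz⟩ hne
    obtain ⟨w, hw⟩ := h.traceR hB.irr.refl x
    exact ⟨w, w, hw, x, hw, (alph_congr τ').2.refl x⟩
  exact ⟨hsub, fun hz => h.eqv hz.1, fun hz => h.left hz.1, fun hz => h.right hz.1,
    fun ha => hL ha, fun hb => hR hb⟩

theorem Br.delta_imp [Finite A] [Finite B] (h : Br S τ τ' T) (hA : IsCongruence S τ)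
    (hB : AbIrr S τ' d) {a a' c c' : A} {b b' e e' : B} (hz : (a, a', b, b') ∈ opn S τ' T)
    (hz' : (c, c', e, e') ∈ opn S τ' T)
    (hΔ : ((a, a'), (c, c')) ∈ DeltaCon S τ (alph S τ)) :
    ((b, b'), (e, e')) ∈ DeltaCon S τ' (alph S τ') := by
  obtain ⟨hT, w, hw, hα⟩ := hz
  obtain ⟨hT', w', hw', hα'⟩ := hz'
  have hαB := (alph_congr (S := S) τ').2
  have hbe : (b, e) ∈ alph S τ' := hαB.trans (hαB.symm hα) (hαB.trans
    (h.alph_of_trace hB.irr.refl hw hw' (DeltaCon.eq_iff_and_mem hA hΔ).2) hα')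
  have hb := h.right hT
  obtain ⟨g, g', hg⟩ := h.totR (hB.symm hb)
  obtain ⟨n, hn⟩ := h.traceR hB.irr.refl b
  have e1 := h.eqv (h.sub.eval_quad_three d hg hn hT)
  have e2 := h.eqv (h.sub.eval_quad_three d hg hn hT')
  have hrefl := (DeltaCon.isConOn hA (alph S τ)).2.2.1
  have e3 := (DeltaCon.eq_iff_and_mem hA (DeltaCon.eval_three hA d (hrefl _ (h.left hg))
    (hrefl _ (h.left hn)) hΔ)).1
  rw [hB.right (hB.symm hb), hB.left hb] at e1
  exact hB.delta_of_eq hb (h.right hT') hbe (e2.1 (e3.1 (e1.2 rfl)))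

end Abelian

section Iso

theorem isoAlgI_of_rel {X Y : Type} (iX : SAlg S X) (iY : SAlg S Y) (R : Set (X × Y))
    (hR : IsSubuniverse S R) (hX : ∀ x, ∃ y, (x, y) ∈ R) (hY : ∀ y, ∃ x, (x, y) ∈ R)
    (h : ∀ x y x' y', (x, y) ∈ R → (x', y') ∈ R → (x = x' ↔ y = y')) : IsoAlgI iX iY := by
  choose f hf using hX
  choose g hg using hY
  refine ⟨⟨f, g, fun x => (h _ _ _ _ (hg _) (hf x)).2 rfl,
    fun y => (h _ _ _ _ (hf _) (hg y)).1 rfl⟩, fun o x => ?_⟩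
  exact (h _ _ _ _ (hf _) (hR o (fun i => (x i, f (x i))) fun i => hf (x i))).1 rfl

variable {A B : Type} [iA : SAlg S A] [iB : SAlg S B]

theorem ConQuot.eq_iff {θ : Set (A × A)} (h : IsCongruence S θ) {a b : A} :
    ConQuot.mk θ a = ConQuot.mk θ b ↔ (a, b) ∈ θ :=
  Equivalence.quot_mk_eq_iff h.2 a b

theorem ConQuot.interp_mk {θ : Set (A × A)} (h : IsCongruence S θ) (o : S.ops)
    (x : Fin (S.arity o) → A) :
    (quotAlg iA θ).interp o (fun i => ConQuot.mk θ (x i)) = ConQuot.mk θ (SAlg.interp o x) :=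
  (ConQuot.eq_iff h).2 (h.1 o (fun i => (_, x i)) fun i => (ConQuot.eq_iff h).1
    (Classical.choose_spec (Quot.exists_rep (ConQuot.mk θ (x i)))))

theorem ConQuot.surj (θ : Set (A × A)) (q : ConQuot θ) : ∃ a, ConQuot.mk θ a = q :=
  Quot.exists_rep q

theorem isoAlgI_quot {θ : Set (A × A)} {θ' : Set (B × B)} (hθ : IsCongruence S θ)
    (hθ' : IsCongruence S θ') (R : Set (A × B)) (hR : IsSubuniverse S R)
    (hX : ∀ x, ∃ y, (x, y) ∈ R) (hY : ∀ y, ∃ x, (x, y) ∈ R)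
    (h : ∀ x y x' y', (x, y) ∈ R → (x', y') ∈ R → ((x, x') ∈ θ ↔ (y, y') ∈ θ')) :
    IsoAlgI (quotAlg iA θ) (quotAlg iB θ') := by
  let := quotAlg iA θ
  let := quotAlg iB θ'
  refine isoAlgI_of_rel _ _ {p | ∃ x y, (x, y) ∈ R ∧ p = (ConQuot.mk θ x, ConQuot.mk θ' y)}
    ?_ ?_ ?_ ?_
  · intro o p hp
    choose x y hxy hp using hp
    refine ⟨_, _, hR o (fun i => (x i, y i)) hxy, ?_⟩
    rw [show p = _ from funext hp]
    exact Prod.ext (ConQuot.interp_mk hθ o x) (ConQuot.interp_mk hθ' o y)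
  · intro q
    obtain ⟨x, rfl⟩ := ConQuot.surj θ q
    obtain ⟨y, hy⟩ := hX x
    exact ⟨_, x, y, hy, rfl⟩
  · intro q
    obtain ⟨y, rfl⟩ := ConQuot.surj θ' q
    obtain ⟨x, hx⟩ := hY y
    exact ⟨_, x, y, hx, rfl⟩
  · rintro _ _ _ _ ⟨x, y, hxy, h1⟩ ⟨x', y', hxy', h2⟩
    rw [Prod.mk.injEq] at h1 h2
    obtain ⟨rfl, rfl⟩ := h1
    obtain ⟨rfl, rfl⟩ := h2
    rw [ConQuot.eq_iff hθ, ConQuot.eq_iff hθ']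
    exact h _ _ _ _ hxy hxy'

/-- A congruence of a subalgebra as a relation on the subtype. -/
def subCon {μ : Set A} (Δ : Set (A × A)) : Set (↥μ × ↥μ) := {r | ((r.1 : A), (r.2 : A)) ∈ Δ}

theorem subCon_congr {μ : Set (A × A)} {Δ : Set ((A × A) × (A × A))} (hμ : IsSubuniverse S μ)
    (h : IsConOn S μ Δ) :
    letI := subAlg μ hμ
    IsCongruence S (subCon (μ := μ) Δ) :=
  let := subAlg μ hμ
  ⟨fun o x hx => h.2.1 o (fun i => (((x i).1 : A × A), ((x i).2 : A × A))) hx,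
    fun p => h.2.2.1 _ p.2, fun hpq => h.2.2.2.1 _ _ hpq,
    fun hpq hqr => h.2.2.2.2 _ _ _ hpq hqr⟩

theorem isoAlgI_DAlg {μ α : Set (A × A)} {ν β : Set (B × B)} (hμ : IsCongruence S μ)
    (hν : IsCongruence S ν) (R : Set ((A × A) × (B × B))) (hR : IsSubuniverse S R)
    (hL : ∀ p ∈ μ, ∃ q ∈ ν, (p, q) ∈ R) (hL' : ∀ q ∈ ν, ∃ p ∈ μ, (p, q) ∈ R)
    (h : ∀ p q p' q', (p, q) ∈ R → (p', q') ∈ R →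
      ((p, p') ∈ DeltaCon S μ α ↔ (q, q') ∈ DeltaCon S ν β)) :
    IsoAlgI (DAlg S A μ α hμ.1) (DAlg S B ν β hν.1) := by
  let := subAlg μ hμ.1
  let := subAlg ν hν.1
  refine isoAlgI_quot (subCon_congr hμ.1 (DeltaCon.isConOn hμ α))
    (subCon_congr hν.1 (DeltaCon.isConOn hν β)) {r | ((r.1 : A × A), (r.2 : B × B)) ∈ R}
    (fun o x hx => hR o (fun i => (((x i).1 : A × A), ((x i).2 : B × B))) hx) ?_ ?_
    fun p q p' q' hpq hpq' => h _ _ _ _ hpq hpq'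
  · intro p
    obtain ⟨q, hq, hpq⟩ := hL p p.2
    exact ⟨⟨q, hq⟩, hpq⟩
  · intro q
    obtain ⟨p, hp, hpq⟩ := hL' q q.2
    exact ⟨⟨p, hp⟩, hpq⟩

theorem Br.isoAlgI_DAlg [Finite A] [Finite B] {τ : Set (A × A)} {τ' : Set (B × B)}
    {T : Set (A × A × B × B)} {d d' : STerm S 3} (h : Br S τ τ' T) (hA : AbIrr S τ d)
    (hB : AbIrr S τ' d') :
    IsoAlgI (DAlg S A τ (alph S τ) hA.congr.1) (DAlg S B τ' (alph S τ') hB.congr.1) := by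
  have ho := h.opn_br hA hB
  refine Zhuk.isoAlgI_DAlg hA.congr hB.congr
    {r | (r.1.1, r.1.2, r.2.1, r.2.2) ∈ opn S τ' T}
    (fun o x hx => ho.sub o (fun i => ((x i).1.1, (x i).1.2, (x i).2.1, (x i).2.2)) hx)
    (fun p hp => ?_) (fun q hq => ?_) fun p q p' q' hpq hpq' => ⟨fun hΔ => ?_, fun hΔ => ?_⟩
  · obtain ⟨b, b', hb⟩ := ho.totL hp
    exact ⟨(b, b'), ho.right hb, hb⟩
  · obtain ⟨a, a', ha⟩ := ho.totR hq
    exact ⟨(a, a'), ho.left ha, ha⟩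
  · exact h.delta_imp hA.congr hB hpq hpq' hΔ
  · exact h.conv.delta_imp hB.congr hA (h.opn_conv hA.irr.refl hB.irr.refl hpq)
      (h.opn_conv hA.irr.refl hB.irr.refl hpq') hΔ

end Iso

section Nonabelian

variable {A B : Type} [iA : SAlg S A] [iB : SAlg S B] {τ : Set (A × A)} {τ' : Set (B × B)}
  {T : Set (A × A × B × B)} {d : STerm S 3}

theorem Br.eq_of_trace (h : Br S τ τ' T) (hA : Irr S τ) (hn : ¬ Centralizes S τ τ (diag A))
    {a a' : A} {b b' : B} (hb : (a, a, b, b) ∈ T) (hb' : (a', a', b', b') ∈ T)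
    (hα : (b, b') ∈ alph S τ') : a = a' := by
  let R : Set (A × A) :=
    {r | ∃ w w', (r.1, r.1, w, w) ∈ T ∧ (r.2, r.2, w', w') ∈ T ∧ (w, w') ∈ alph S τ'}
  have hR : IsSubuniverse S R := by
    intro o x hx
    choose w w' hw hw' hα using hx
    exact ⟨_, _, h.sub o (fun i => ((x i).1, (x i).1, w i, w i)) hw,
      h.sub o (fun i => ((x i).2, (x i).2, w' i, w' i)) hw',
      (alph_congr τ').1 o (fun i => (w i, w' i)) hα⟩
  by_contra hne
  have hτ : τ ⊆ R := by
    refine hA.least R hR (fun x => ?_) a a' ⟨b, b', hb, hb', hα⟩ hne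
    obtain ⟨w, hw⟩ := h.traceL hA.refl x
    exact ⟨w, w, hw, hw, (alph_congr τ').2.refl w⟩
  refine hn fun n t x y g g' hxy hg he => ?_
  obtain ⟨w, w', hw, hw', hα⟩ := hτ hxy
  choose u u' hu using fun i => h.totL (hg i)
  refine (h.eqv (h.sub.eval_quad_cons t hw' hu)).2 ?_
  exact alph_centralizes τ' n t _ _ u u' hα (fun i => h.right (hu i))
    ((h.eqv (h.sub.eval_quad_cons t hw hu)).1 he)

theorem Br.isoAlgI (h : Br S τ τ' T) (hA : Irr S τ) (hB : Irr S τ')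
    (hn : ¬ Centralizes S τ τ (diag A)) (hn' : ¬ Centralizes S τ' τ' (diag B)) :
    IsoAlgI iA iB := by
  refine isoAlgI_of_rel iA iB (btr T)
    (fun o x hx => h.sub o (fun i => ((x i).1, (x i).1, (x i).2, (x i).2)) hx)
    (fun a => h.traceL hA.refl a) (fun b => h.traceR hB.refl b) fun a b a' b' hb hb' => ⟨?_, ?_⟩
  · rintro rfl
    exact h.conv.eq_of_trace hB hn' hb hb' ((alph_congr τ).2.refl a)
  · rintro rfl
    exact h.eq_of_trace hA hn hb hb' ((alph_congr τ').2.refl b)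

theorem Br.exists_pol (h : Br S τ τ' T) (hr : ∀ a, (a, a) ∈ τ) {ι : Type} {f : (ι → A) → A}
    (hf : IsPol S f) : ∃ g : (ι → B) → B, IsPol S g ∧ ∀ x x' y y',
      (∀ i, (x i, x' i, y i, y' i) ∈ T) → (f x, f x', g y, g y') ∈ T := by
  induction hf with
  | proj i => exact ⟨_, .proj i, fun x x' y y' h => h i⟩
  | const a =>
    obtain ⟨b, hb⟩ := h.traceL hr a
    exact ⟨_, .const b, fun _ _ _ _ _ => hb⟩
  | app o f _ ih =>
    choose g hg hfg using ih
    exact ⟨_, .app o g hg, fun x x' y y' hx =>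
      h.sub o (fun i => (f i x, f i x', g i y, g i y')) fun i => hfg i x x' y y' hx⟩

theorem Br.exists_pol2 (h : Br S τ τ' T) (hr : ∀ a, (a, a) ∈ τ) {f : A → A → A}
    (hf : IsPol2 S f) : ∃ g : B → B → B, IsPol2 S g ∧ ∀ {a a' b b' c c' e e'},
      (a, a', b, b') ∈ T → (c, c', e, e') ∈ T → (f a c, f a' c', g b e, g b' e') ∈ T := by
  obtain ⟨g, hg, hfg⟩ := h.exists_pol hr hf
  refine ⟨fun b e => g ![b, e], ?_, fun {a a' b b' c c' e e'} h1 h2 => ?_⟩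
  · have := hg.comp (g := fun i (x : Fin 2 → B) => ![x 0, x 1] i) (κ := Fin 2) fun i => by
      fin_cases i
      · exact IsPol.proj 0
      · exact IsPol.proj 1
    exact this
  · exact hfg ![a, c] ![a', c'] ![b, e] ![b', e'] fun i => by fin_cases i <;> assumption

theorem AbIrr.parallelogram [Finite B] (hB : AbIrr S τ' d) {p : B → B → B} (hp : IsPol2 S p)
    {u v : B} (huv : (u, v) ∈ τ') : d.eval ![p v u, p v v, p u v] = p u u := by
  let f : (Fin 2 → B) → B := fun x => d.eval ![p (x 0) u, p (x 0) (x 1), p u (x 1)]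
  have hf : IsPol S f := by
    have := IsPol.term d (ι := Fin 2) (g := fun i (x : Fin 2 → B) =>
      ![p (x 0) u, p (x 0) (x 1), p u (x 1)] i) fun i => by
        fin_cases i
        · exact hp.app (.proj 0) (.const u)
        · exact hp.app (.proj 0) (.proj 1)
        · exact hp.app (.const u) (.proj 1)
    exact this
  have mem : ∀ {x x' y y'}, (x, x') ∈ τ' → (y, y') ∈ τ' → (p x y, p x' y') ∈ τ' :=
    fun h h' => hp.mem hB.irr.sub hB.irr.refl h h'
  have huu := hB.irr.refl u
  have e1 : f ![u, u] = f ![u, v] := by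
    show d.eval ![p u u, p u u, p u u] = d.eval ![p u u, p u v, p u v]
    rw [hB.left (hB.irr.refl _), hB.right (mem huu huv)]
  have e2 : f ![v, u] = f ![v, v] := by
    refine hB.ab.matrix hB.irr.refl hf (x := ![u, u]) (y := ![u, v]) (fun i => ?_) e1
    fin_cases i
    · exact .inl ⟨rfl, rfl, huv⟩
    · exact .inr ⟨rfl, rfl, huv⟩
  have e3 : f ![v, u] = p u u := hB.left (mem (hB.symm huv) huu)
  exact e2.symm.trans e3

theorem Br.not_mixed [Finite A] [Finite B] (h : Br S τ τ' T) (hA : Irr S τ)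
    (hn : ¬ Centralizes S τ τ (diag A)) (hB : AbIrr S τ' d)
    (hid : ∀ a : A, d.eval ![a, a, a] = a) : False := by
  obtain ⟨c, c', p, hc, hne, hp, p1, p2, p3, p4⟩ := hA.exists_semilattice hn
  obtain ⟨q, hq, hpq⟩ := h.exists_pol2 hA.refl hp
  have hαB := (alph_congr (S := S) τ').2
  obtain ⟨u, u', hu⟩ := h.totL hc
  obtain ⟨w, hw⟩ := h.traceL hA.refl c
  obtain ⟨w', hw'⟩ := h.traceL hA.refl c'
  obtain ⟨x, hx⟩ := h.traceR hB.irr.refl u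
  have W : ∀ {b b'}, (c, c', b, b') ∈ T → (b, u) ∈ alph S τ' := fun hb =>
    h.alph_of_left hB.congr hB.diff hb hu
  have x1 : p x x = x := by
    have h1 := hpq hu hu
    rw [p1, p4] at h1
    exact h.eq_of_trace hA hn (hpq hx hx) hx (W h1)
  have x2 : p c x = x := by
    have h1 := hpq hw hu
    rw [p1, p2] at h1
    exact h.eq_of_trace hA hn (hpq hw hx) hx (W h1)
  have x3 : p x c' = c' := by
    have h1 := hpq hu hw'
    rw [p2, p4, ← (h.eqv (hpq hu hw')).1 (p2.trans p4.symm)] at h1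
    exact h.eq_of_trace hA hn (hpq hx hw') h1 (hαB.refl _)
  have x4 : p c' x = c' := by
    have h1 := hpq hw' hu
    rw [p3, p4, ← (h.eqv (hpq hw' hu)).1 (p3.trans p4.symm)] at h1
    exact h.eq_of_trace hA hn (hpq hw' hx) h1 (hαB.refl _)
  by_cases hxc : x = c'
  · subst hxc
    obtain ⟨x', hx'⟩ := h.traceR hB.irr.refl u'
    obtain rfl := h.eq_of_trace hA hn hx hx' (hB.subset_alph (h.right hu))
    have e1 := (h.eqv (hpq hu hx)).1 (p2.trans p4.symm)
    have e2 := (h.eqv (hpq hx' hu)).1 (p3.trans p4.symm)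
    have e3 := (h.eqv (hpq hu hu)).2 (e1.trans e2)
    rw [p1, p4] at e3
    exact hne e3
  · have hz := hpq hu hx
    have hz0 := hpq hx hx
    rw [x2, x4] at hz
    rw [x1] at hz0
    have e := h.eqv (h.sub.eval_quad_three d (hpq hz hz0) (hpq hz hz) (hpq hz0 hz))
    rw [x1, x4, x3, p4, hid, hid, hB.left (hB.irr.refl _),
      hB.parallelogram hq (h.right hz)] at e
    exact hxc (e.2 rfl)

end Nonabelian

section Converse

variable {A B : Type} [iA : SAlg S A] [iB : SAlg S B] {τ : Set (A × A)} {τ' : Set (B × B)}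
  {T : Set (A × A × B × B)} {d d' : STerm S 3}

theorem IsoAlgI.symm {A B : Type} {iA : SAlg S A} {iB : SAlg S B} (h : IsoAlgI iA iB) :
    IsoAlgI iB iA := by
  obtain ⟨f, hf⟩ := h
  refine ⟨f.symm, fun o x => ?_⟩
  rw [Equiv.symm_apply_eq, hf]
  simp

theorem isBridge_of_traces (hT : IsSubuniverse S T) (hL : ∀ a, ∃ b, (a, a, b, b) ∈ T)
    (hR : ∀ b, ∃ a, (a, a, b, b) ∈ T)
    (heqv : ∀ a a' b b', (a, a', b, b') ∈ T → (a = a' ↔ b = b')) {a a' : A} {b b' : B}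
    (hz : (a, a', b, b') ∈ T) (hne : a ≠ a') : IsBridge S (diag A) (diag B) T := by
  refine ⟨hT, ?_, ?_, ⟨?_, fun hsub => hne (@hsub (a, a') ⟨b, b', hz⟩)⟩,
    ⟨?_, fun hsub => hne ((heqv _ _ _ _ hz).2 (@hsub (b, b') ⟨a, a', hz⟩))⟩, heqv⟩
  · rintro a₁ a₂ b₁ b₂ a₁' a₂' h h1 h2
    obtain rfl : a₁ = a₁' := h1
    obtain rfl : a₂ = a₂' := h2
    exact h
  · rintro a₁ a₂ b₁ b₂ b₁' b₂' h h1 h2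
    obtain rfl : b₁ = b₁' := h1
    obtain rfl : b₂ = b₂' := h2
    exact h
  · rintro ⟨x, y⟩ hxy
    obtain rfl : x = y := hxy
    obtain ⟨b, hb⟩ := hL x
    exact ⟨b, b, hb⟩
  · rintro ⟨x, y⟩ hxy
    obtain rfl : x = y := hxy
    obtain ⟨b, hb⟩ := hR x
    exact ⟨b, b, hb⟩

theorem IsBridge.conv {ρ : Set (A × A)} {σ : Set (B × B)} (h : IsBridge S ρ σ T) :
    IsBridge S σ ρ (bConv T) :=
  ⟨h.1.bConv, fun _ _ _ _ _ _ hz h1 h2 => h.2.2.1 _ _ _ _ _ _ hz h1 h2,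
    fun _ _ _ _ _ _ hz h1 h2 => h.2.1 _ _ _ _ _ _ hz h1 h2, h.2.2.2.2.1, h.2.2.2.1,
    fun _ _ _ _ hz => (h.2.2.2.2.2 _ _ _ _ hz).symm⟩

theorem exists_bridge_of_isoAlgI (hA : ∃ a a' : A, a ≠ a') (h : IsoAlgI iA iB) :
    ∃ T, IsBridge S (diag A) (diag B) T := by
  obtain ⟨f, hf⟩ := h
  obtain ⟨a, a', hne⟩ := hA
  refine ⟨{z | z.2.2.1 = f z.1 ∧ z.2.2.2 = f z.2.1}, isBridge_of_traces (fun o x hx => ?_)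
    (fun a => ⟨f a, rfl, rfl⟩) (fun b => ⟨f.symm b, by simp⟩) ?_ (b := f a) (b' := f a')
    ⟨rfl, rfl⟩ hne⟩
  · constructor
    · refine Eq.trans ?_ (hf o _).symm
      exact congrArg (SAlg.interp o) (funext fun i => (hx i).1)
    · refine Eq.trans ?_ (hf o _).symm
      exact congrArg (SAlg.interp o) (funext fun i => (hx i).2)
  · rintro a a' b b' ⟨h1, h2⟩
    dsimp only at h1 h2
    rw [h1, h2, f.apply_eq_iff_eq]

theorem DCar.eq_iff {μ α : Set (A × A)} (hμ : IsCongruence S μ) {p q : ↥μ} :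
    DCar.mk S A μ α p = DCar.mk S A μ α q ↔ ((p : A × A), (q : A × A)) ∈ DeltaCon S μ α :=
  let := subAlg μ hμ.1
  ConQuot.eq_iff (subCon_congr hμ.1 (DeltaCon.isConOn hμ α))

theorem DCar.interp_mk {μ α : Set (A × A)} (hμ : IsCongruence S μ) (o : S.ops)
    (x : Fin (S.arity o) → A × A) (hx : ∀ i, x i ∈ μ) :
    (DAlg S A μ α hμ.1).interp o (fun i => DCar.mk S A μ α ⟨x i, hx i⟩) =
      DCar.mk S A μ α ⟨SAlg.interp o x, hμ.1 o x hx⟩ :=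
  let := subAlg μ hμ.1
  ConQuot.interp_mk (subCon_congr hμ.1 (DeltaCon.isConOn hμ α)) o fun i => ⟨x i, hx i⟩

theorem exists_bridge_of_isoAlgI_DAlg_left [Finite A] (hA : AbIrr S τ d)
    (h : IsoAlgI (DAlg S A τ (alph S τ) hA.congr.1) iB) :
    ∃ T, IsBridge S (diag A) (diag B) T := by
  obtain ⟨f, hf⟩ := h
  obtain ⟨a, a', haa, hne⟩ := hA.irr.nontriv
  refine ⟨{z | ∃ (e : A) (h1 : (e, z.1) ∈ τ) (h2 : (e, z.2.1) ∈ τ),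
    f (DCar.mk S A τ _ ⟨_, h1⟩) = z.2.2.1 ∧ f (DCar.mk S A τ _ ⟨_, h2⟩) = z.2.2.2},
    isBridge_of_traces (fun o x hx => ?_) (fun a => ?_) (fun b => ?_) ?_
    (b := f (DCar.mk S A τ _ ⟨(a, a), hA.irr.refl a⟩))
    (b' := f (DCar.mk S A τ _ ⟨(a, a'), haa⟩)) ⟨a, hA.irr.refl a, haa, rfl, rfl⟩ hne⟩
  · choose e h1 h2 h3 h4 using hx
    refine ⟨SAlg.interp o e, hA.congr.1 o (fun i => (e i, (x i).1)) h1,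
      hA.congr.1 o (fun i => (e i, (x i).2.1)) h2, ?_, ?_⟩
    · refine (congrArg f (DCar.interp_mk hA.congr o (fun i => (e i, (x i).1)) h1)).symm.trans ?_
      rw [hf]
      exact congrArg (SAlg.interp o) (funext h3)
    · refine (congrArg f (DCar.interp_mk hA.congr o (fun i => (e i, (x i).2.1)) h2)).symm.trans ?_
      rw [hf]
      exact congrArg (SAlg.interp o) (funext h4)
  · exact ⟨f (DCar.mk S A τ _ ⟨(a, a), hA.irr.refl a⟩), a, hA.irr.refl a, hA.irr.refl a, rfl, rfl⟩
  · obtain ⟨⟨⟨e, a⟩, hea⟩, he⟩ := Quot.exists_rep (f.symm b)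
    have : f (DCar.mk S A τ _ ⟨(e, a), hea⟩) = b := (congrArg f he).trans (f.apply_symm_apply b)
    exact ⟨a, e, hea, hea, this, this⟩
  · rintro a a' b b' ⟨e, h1, h2, h3, h4⟩
    constructor
    · rintro rfl
      exact h3.symm.trans h4
    · rintro rfl
      have := f.injective (h3.trans h4.symm)
      exact hA.delta_right_inj ((DCar.eq_iff hA.congr).1 this)

/-- The graph of an isomorphism between the quotients of two congruences by `Δ`. -/
structure DIso (S : Signature) {A B : Type} [SAlg S A] [SAlg S B] (τ : Set (A × A))
    (τ' : Set (B × B)) (K : Set ((A × A) × (B × B))) : Prop where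
  sub : IsSubuniverse S K
  left : ∀ {p q}, (p, q) ∈ K → p ∈ τ
  right : ∀ {p q}, (p, q) ∈ K → q ∈ τ'
  totL : ∀ {p}, p ∈ τ → ∃ q, (p, q) ∈ K
  totR : ∀ {q}, q ∈ τ' → ∃ p, (p, q) ∈ K
  iff : ∀ {p q p' q'}, (p, q) ∈ K → (p', q') ∈ K →
    ((p, p') ∈ DeltaCon S τ (alph S τ) ↔ (q, q') ∈ DeltaCon S τ' (alph S τ'))
  satL : ∀ {p p' q}, (p, q) ∈ K → (p, p') ∈ DeltaCon S τ (alph S τ) → (p', q) ∈ K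
  satR : ∀ {p q q'}, (p, q) ∈ K → (q, q') ∈ DeltaCon S τ' (alph S τ') → (p, q') ∈ K

theorem exists_dIso (hA : IsCongruence S τ) (hB : IsCongruence S τ')
    (h : IsoAlgI (DAlg S A τ (alph S τ) hA.1) (DAlg S B τ' (alph S τ') hB.1)) :
    ∃ K, DIso S τ τ' K := by
  obtain ⟨f, hf⟩ := h
  refine ⟨{r | ∃ (h1 : r.1 ∈ τ) (h2 : r.2 ∈ τ'), f (DCar.mk S A τ (alph S τ) ⟨_, h1⟩) =
    DCar.mk S B τ' (alph S τ') ⟨_, h2⟩}, ?_, fun hz => hz.1, fun hz => hz.2.1, ?_, ?_, ?_, ?_, ?_⟩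
  · intro o x hx
    choose h1 h2 h3 using hx
    refine ⟨hA.1 o (fun i => (x i).1) h1, hB.1 o (fun i => (x i).2) h2, ?_⟩
    refine (congrArg f (DCar.interp_mk hA o (fun i => (x i).1) h1)).symm.trans ?_
    refine Eq.trans ?_ (DCar.interp_mk hB o (fun i => (x i).2) h2)
    rw [hf]
    exact congrArg _ (funext h3)
  · intro p hp
    obtain ⟨⟨q, hq⟩, he⟩ := Quot.exists_rep (f (DCar.mk S A τ (alph S τ) ⟨p, hp⟩))
    exact ⟨q, hp, hq, he.symm⟩
  · intro q hq
    obtain ⟨⟨p, hp⟩, he⟩ := Quot.exists_rep (f.symm (DCar.mk S B τ' (alph S τ') ⟨q, hq⟩))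
    exact ⟨p, hp, hq, (congrArg f he).trans (f.apply_symm_apply _)⟩
  · rintro p q p' q' ⟨h1, h2, h3⟩ ⟨h1', h2', h3'⟩
    have e1 := DCar.eq_iff (α := alph S τ) hA (p := ⟨p, h1⟩) (q := ⟨p', h1'⟩)
    have e2 := DCar.eq_iff (α := alph S τ') hB (p := ⟨q, h2⟩) (q := ⟨q', h2'⟩)
    rw [← e1, ← e2, ← f.apply_eq_iff_eq]
    exact ⟨fun h => h3.symm.trans (h.trans h3'), fun h => h3.trans (h.trans h3'.symm)⟩
  · rintro p p' q ⟨h1, h2, h3⟩ h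
    have h1' : p' ∈ τ := ((DeltaCon.isConOn hA _).1 h).2
    have e1 := (DCar.eq_iff (α := alph S τ) hA (p := ⟨p, h1⟩) (q := ⟨p', h1'⟩)).2 h
    exact ⟨h1', h2, (congrArg f e1).symm.trans h3⟩
  · rintro p q q' ⟨h1, h2, h3⟩ h
    have h2' : q' ∈ τ' := ((DeltaCon.isConOn hB _).1 h).2
    have e2 := (DCar.eq_iff (α := alph S τ') hB (p := ⟨q, h2⟩) (q := ⟨q', h2'⟩)).2 h
    exact ⟨h1, h2', h3.trans e2⟩

variable {K : Set ((A × A) × (B × B))}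

/-- Two pairs whose images under `K` have representatives with a common first coordinate. -/
def share (K : Set ((A × A) × (B × B))) : Set ((A × A) × (A × A)) :=
  {r | ∃ g c c', (r.1, (g, c)) ∈ K ∧ (r.2, (g, c')) ∈ K}

theorem share_symm {p q : A × A} (h : (p, q) ∈ share K) : (q, p) ∈ share K := by
  obtain ⟨g, c, c', h1, h2⟩ := h
  exact ⟨g, c', c, h2, h1⟩

theorem DIso.share_sub (h : DIso S τ τ' K) : IsSubuniverse S (share K) := by
  intro o x hx
  choose g c c' h1 h2 using hx
  exact ⟨_, _, _, h.sub o (fun i => ((x i).1, (g i, c i))) h1,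
    h.sub o (fun i => ((x i).2, (g i, c' i))) h2⟩

theorem DIso.share_refl (h : DIso S τ τ' K) {p : A × A} (hp : p ∈ τ) : (p, p) ∈ share K := by
  obtain ⟨⟨g, c⟩, hq⟩ := h.totL hp
  exact ⟨g, c, c, hq, hq⟩

theorem DIso.share_trans [Finite B] (h : DIso S τ τ' K) (hA : IsCongruence S τ)
    (hB : AbIrr S τ' d') {p q r : A × A}
    (hpq : (p, q) ∈ share K) (hqr : (q, r) ∈ share K) : (p, r) ∈ share K := by
  obtain ⟨g, c, c', k1, k2⟩ := hpq
  obtain ⟨g', e, e', k3, k4⟩ := hqr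
  have hcon := DeltaCon.isConOn hB.congr (alph S τ')
  have hΔ : ((g, c'), (g', e)) ∈ DeltaCon S τ' (alph S τ') :=
    (h.iff k2 k3).1 ((DeltaCon.isConOn hA (alph S τ)).2.2.1 _ (h.left k2))
  have hcc : (c, c') ∈ τ' := hB.congr.2.trans (hB.symm (h.right k1)) (h.right k2)
  have hee : (e, e') ∈ τ' := hB.congr.2.trans (hB.symm (h.right k3)) (h.right k4)
  have e1 := DeltaCon.eval_three hB.congr d' (hcon.2.2.1 _ (h.right k1))
    (hcon.2.2.1 _ (h.right k2)) hΔ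
  rw [hB.left (hB.irr.refl g), hB.right hcc] at e1
  have e2 := DeltaCon.eval_three hB.congr d' (hcon.2.2.2.1 _ _ hΔ) (hcon.2.2.2.1 _ _ hΔ)
    (hcon.2.2.1 _ (h.right k4))
  rw [hB.left (hB.irr.refl g'), hB.left hee] at e2
  exact ⟨_, _, _, h.satR k1 e1, h.satR k4 e2⟩

theorem DIso.share_satR (h : DIso S τ τ' K) {p q q' : A × A} (hpq : (p, q) ∈ share K)
    (hΔ : (q, q') ∈ DeltaCon S τ (alph S τ)) : (p, q') ∈ share K := by
  obtain ⟨g, c, c', h1, h2⟩ := hpq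
  exact ⟨g, c, c', h1, h.satL h2 hΔ⟩

theorem DIso.exists_share [Finite A] [Finite B] (h : DIso S τ τ' K) (hA : AbIrr S τ d)
    (hB : AbIrr S τ' d') : ∃ e f f', ((e, f), (e, f')) ∈ share K ∧ f ≠ f' := by
  by_contra hcon
  have H : ∀ e f f', ((e, f), (e, f')) ∈ share K → f = f' := fun e f f' hs => by
    by_contra hne
    exact hcon ⟨e, f, f', hs, hne⟩
  have hDA := DeltaCon.isConOn hA.congr (alph S τ)
  have key : ∀ {a e b g : A}, ((a, e), (b, g)) ∈ share K → ∀ (n : ℕ) (t : STerm S (n + 1))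
      (x y : Fin n → A), (∀ i, (x i, y i) ∈ τ) → t.eval (Fin.cons e x) = t.eval (Fin.cons e y) →
      t.eval (Fin.cons g x) = t.eval (Fin.cons g y) := by
    intro a e b g hs n t x y hxy he
    have h1 := h.share_sub.eval_pair_cons t (share_symm hs) (x := fun i => (x i, x i))
      (y := fun i => (x i, x i)) fun i => h.share_refl (hA.irr.refl _)
    have h2 := h.share_sub.eval_pair_cons t hs (x := fun i => (x i, y i))
      (y := fun i => (x i, y i)) fun i => h.share_refl (hxy i)
    have hc : ∀ (p : A × A) (v w : Fin n → A), t.eval (Fin.cons p fun i => (v i, w i)) =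
        (t.eval (Fin.cons p.1 v), t.eval (Fin.cons p.2 w)) := by
      intro p v w
      rw [eval_prod]
      congr 2 <;> funext i <;> refine Fin.cases ?_ (fun i => ?_) i <;> rfl
    rw [hc, hc] at h1 h2
    dsimp only at h1 h2
    rw [he] at h1
    exact H _ _ _ (h.share_trans hA.congr hB h1 h2)
  obtain ⟨g, c, hgc, hne⟩ := hB.irr.nontriv
  obtain ⟨⟨a, e⟩, hp⟩ := h.totR hgc
  obtain ⟨⟨b, f⟩, hp'⟩ := h.totR (hB.irr.refl g)
  have hs : ((a, e), (b, f)) ∈ share K := ⟨g, c, g, hp, hp'⟩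
  have hef : (e, f) ∈ alph S τ := mem_alph_of_terms hA.irr.refl fun n t x y hxy =>
    ⟨key hs n t x y hxy, key (share_symm hs) n t x y hxy⟩
  have hα := (alph_congr (S := S) τ).2
  have hab : (a, b) ∈ alph S τ := hα.trans (hA.subset_alph (h.left hp))
    (hα.trans hef (hα.symm (hA.subset_alph (h.left hp'))))
  obtain ⟨e1, e2⟩ := hA.delta_normal (h.left hp) (h.left hp') hab
  have hs' := share_symm (h.share_satR (share_symm (h.share_satR hs e2)) e1)
  rw [H _ _ _ hs'] at e1
  have := (h.iff hp hp').1 (hDA.2.2.2.2 _ _ _ e1 (hDA.2.2.2.1 _ _ e2))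
  exact hne (hB.delta_right_inj this).symm

theorem DIso.exists_bridge [Finite A] [Finite B] (h : DIso S τ τ' K) (hA : AbIrr S τ d)
    (hB : AbIrr S τ' d') : ∃ T, IsBridge S (diag A) (diag B) T := by
  obtain ⟨e, f, f', ⟨g, c, c', h1, h2⟩, hne⟩ := h.exists_share hA hB
  refine ⟨{z | ∃ e g, ((e, z.1), (g, z.2.2.1)) ∈ K ∧ ((e, z.2.1), (g, z.2.2.2)) ∈ K},
    isBridge_of_traces ?_ ?_ ?_ ?_ (a := f) (a' := f') (b := c) (b' := c') ⟨e, g, h1, h2⟩ hne⟩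
  · intro o x hx
    choose e g h1 h2 using hx
    exact ⟨_, _, h.sub o (fun i => ((e i, (x i).1), (g i, (x i).2.2.1))) h1,
      h.sub o (fun i => ((e i, (x i).2.1), (g i, (x i).2.2.2))) h2⟩
  · intro a
    obtain ⟨⟨g, c⟩, hq⟩ := h.totL (hA.irr.refl a)
    exact ⟨c, a, g, hq, hq⟩
  · intro b
    obtain ⟨⟨e, a⟩, hq⟩ := h.totR (hB.irr.refl b)
    exact ⟨a, e, b, hq, hq⟩
  · rintro a a' b b' ⟨e, g, k1, k2⟩
    constructor
    · rintro rfl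
      exact hB.delta_right_inj ((h.iff k1 k2).1
        ((DeltaCon.isConOn hA.congr _).2.2.1 _ (h.left k1)))
    · rintro rfl
      exact hA.delta_right_inj ((h.iff k1 k2).2
        ((DeltaCon.isConOn hB.congr _).2.2.1 _ (h.right k1)))

end Converse

section Main

variable {A B : Type} [iA : SAlg S A] [iB : SAlg S B] {τ μ : Set (A × A)} {τ' : Set (B × B)}

theorem Centralizes.mono {φ θ : Set (A × A)} (h : Centralizes S μ μ (diag A)) (hφ : φ ⊆ μ)
    (hθ : θ ⊆ μ) : Centralizes S φ θ (diag A) :=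
  fun n t a b c d hab hcd => h n t a b c d (hφ hab) fun i => hθ (hcd i)

theorem Irr.abelian_or_not [Finite A] (h : Irr S τ) {n : ℕ} {t : STerm S n}
    {u v : Fin n → Fin n → Fin 2} (hn : 1 < n) (huv : ∀ i, u i i ≠ v i i)
    (ht : TaylorOn S A t u v) :
    (transCl τ = τ ∧ ∃ d : STerm S 3, (∀ (C : Type) [SAlg S C], (∀ a : C, t.eval (fun _ => a) = a) →
      ∀ a : C, d.eval ![a, a, a] = a) ∧ AbIrr S τ d) ∨
    (¬ Centralizes S (transCl τ) (transCl τ) (diag A) ∧ ¬ Centralizes S τ τ (diag A)) := by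
  by_cases hC : Centralizes S τ τ (diag A)
  · obtain ⟨h1, d, hd, hd'⟩ := h.exists_diffOn hC hn huv ht
    refine .inl ⟨h1, d, fun C _ hid a => ?_, h, h1 ▸ h.transCl_congr, hC, hd'⟩
    have e : (![a, a, a] : Fin 3 → C) = fun _ => a := by
      funext i
      fin_cases i <;> rfl
    rw [e]
    exact hd C hid a
  · exact .inr ⟨fun h' => hC (h'.mono (subset_transCl τ) (subset_transCl τ)), hC⟩

theorem exists_bridge_iff_similarI [Finite A] [Finite B] (hT : CommonTaylor S A B)
    (hA : Irr S τ) (hB : Irr S τ') :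
    (∃ T : Set (A × A × B × B), IsBridge S (diag A) (diag B) T) ↔ SimilarI S iA iB := by
  obtain ⟨n, t, u, v, hn, huv, htA, htB⟩ := hT
  have hmA := hA.monolith
  have hmB := hB.monolith
  have huA : ∀ {μ}, IsMonolith S μ → μ = transCl τ := hA.monolith_unique
  have huB : ∀ {ν}, IsMonolith S ν → ν = transCl τ' := hB.monolith_unique
  rcases hA.abelian_or_not hn huv htA with ⟨eA, d, hd, hA'⟩ | ⟨hnA, hnA'⟩ <;>
  rcases hB.abelian_or_not hn huv htB with ⟨eB, d', hd', hB'⟩ | ⟨hnB, hnB'⟩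
  · rw [eA] at hmA huA
    rw [eB] at hmB huB
    constructor
    · rintro ⟨T, hT⟩
      obtain ⟨T, hT⟩ := exists_br hA hB hT
      refine ⟨τ, τ', hmA, hmB, fun _ => ?_, fun h => absurd hB'.ab h.2, fun h => absurd hA'.ab h.1,
        fun h => absurd hA'.ab h.1⟩
      rw [centralizer_eq_alph hA.refl, centralizer_eq_alph hB.refl]
      exact hT.isoAlgI_DAlg hA' hB'
    · rintro ⟨μ, ν, hμ, hν, h, -⟩
      obtain rfl := huA hμ
      obtain rfl := huB hν
      have h := h ⟨hA'.ab, hB'.ab⟩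
      rw [centralizer_eq_alph hA.refl, centralizer_eq_alph hB.refl] at h
      obtain ⟨K, hK⟩ := exists_dIso hA'.congr hB'.congr h
      exact hK.exists_bridge hA' hB'
  · rw [eA] at hmA huA
    constructor
    · rintro ⟨T, hT⟩
      obtain ⟨T, hT⟩ := exists_br hA hB hT
      exact (hT.conv.not_mixed hB hnB' hA' (hd B htB.1)).elim
    · rintro ⟨μ, ν, hμ, hν, -, h, -⟩
      obtain rfl := huA hμ
      obtain rfl := huB hν
      have h := h ⟨hA'.ab, hnB⟩
      rw [centralizer_eq_alph hA.refl] at h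
      exact exists_bridge_of_isoAlgI_DAlg_left hA' h
  · rw [eB] at hmB huB
    constructor
    · rintro ⟨T, hT⟩
      obtain ⟨T, hT⟩ := exists_br hA hB hT
      exact (hT.not_mixed hA hnA' hB' (hd' A htA.1)).elim
    · rintro ⟨μ, ν, hμ, hν, -, -, h, -⟩
      obtain rfl := huA hμ
      obtain rfl := huB hν
      have h := h ⟨hnA, hB'.ab⟩
      rw [centralizer_eq_alph hB.refl] at h
      obtain ⟨T, hT⟩ := exists_bridge_of_isoAlgI_DAlg_left hB' h.symm
      exact ⟨_, hT.conv⟩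
  · constructor
    · rintro ⟨T, hT⟩
      obtain ⟨T, hT⟩ := exists_br hA hB hT
      exact ⟨_, _, hmA, hmB, fun h => absurd h.1 hnA, fun h => absurd h.1 hnA,
        fun h => absurd h.2 hnB, fun _ => hT.isoAlgI hA hB hnA' hnB'⟩
    · rintro ⟨μ, ν, hμ, hν, -, -, -, h⟩
      obtain rfl := huA hμ
      obtain rfl := huB hν
      obtain ⟨a, a', -, hne⟩ := hA.nontriv
      exact exists_bridge_of_isoAlgI ⟨a, a', hne⟩ (h ⟨hnA, hnB⟩)

end Main

section Quotient

variable {A B : Type} [iA : SAlg S A] [iB : SAlg S B] {ρ ρstar : Set (A × A)}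
  {σ : Set (B × B)}

theorem ConQuot.eval_mk (hρ : IsCongruence S ρ) {n : ℕ} (t : STerm S n) (x : Fin n → A) :
    letI := quotAlg iA ρ
    t.eval (fun i => ConQuot.mk ρ (x i)) = ConQuot.mk ρ (t.eval x) := by
  let := quotAlg iA ρ
  induction t with
  | var i => rfl
  | app o ts ih =>
    refine Eq.trans ?_ (ConQuot.interp_mk hρ o _)
    exact congrArg (SAlg.interp o) (funext ih)

theorem TaylorOn.quot (hρ : IsCongruence S ρ) {n : ℕ} {t : STerm S n}
    {u v : Fin n → Fin n → Fin 2} (h : TaylorOn S A t u v) :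
    letI := quotAlg iA ρ
    TaylorOn S (ConQuot ρ) t u v := by
  let := quotAlg iA ρ
  constructor
  · intro q
    obtain ⟨a, rfl⟩ := ConQuot.surj ρ q
    exact (ConQuot.eval_mk hρ t fun _ => a).trans (congrArg _ (h.1 a))
  · intro i p q
    obtain ⟨a, rfl⟩ := ConQuot.surj ρ p
    obtain ⟨b, rfl⟩ := ConQuot.surj ρ q
    have e : ∀ w : Fin n → Fin 2, t.eval (fun j => if w j = 0 then ConQuot.mk ρ a else
        ConQuot.mk ρ b) = ConQuot.mk ρ (t.eval fun j => if w j = 0 then a else b) := fun w => by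
      rw [← ConQuot.eval_mk hρ]
      congr 1
      funext j
      split <;> rfl
    rw [e, e, h.2]

theorem IsSubuniverse.comap_quot (hρ : IsCongruence S ρ) {R : Set (ConQuot ρ × ConQuot ρ)}
    (hR : letI := quotAlg iA ρ; IsSubuniverse S R) :
    IsSubuniverse S {p : A × A | (ConQuot.mk ρ p.1, ConQuot.mk ρ p.2) ∈ R} := by
  let := quotAlg iA ρ
  intro o x hx
  have := hR o _ hx
  have e : SAlg.interp o (fun i => (ConQuot.mk ρ (x i).1, ConQuot.mk ρ (x i).2)) =
      (ConQuot.mk ρ (SAlg.interp o x).1, ConQuot.mk ρ (SAlg.interp o x).2) :=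
    Prod.ext (ConQuot.interp_mk hρ o fun i => (x i).1) (ConQuot.interp_mk hρ o fun i => (x i).2)
  rwa [e] at this

theorem irr_quot [Finite A] (hρ : IsCongruence S ρ) (h : Cov S ρ = {ρstar}) :
    letI := quotAlg iA ρ
    Irr S {q | ∃ a b, (a, b) ∈ ρstar ∧ q = (ConQuot.mk ρ a, ConQuot.mk ρ b)} := by
  let := quotAlg iA ρ
  obtain ⟨hsub, -, hlt, -⟩ : ρstar ∈ Cov S ρ := h ▸ rfl
  refine ⟨fun o x hx => ?_, fun q => ?_, ?_, fun R hR hrefl p q hpq hne => ?_⟩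
  · choose a b hab hx using hx
    refine ⟨_, _, hsub o (fun i => (a i, b i)) hab, ?_⟩
    rw [show x = _ from funext hx]
    exact Prod.ext (ConQuot.interp_mk hρ o a) (ConQuot.interp_mk hρ o b)
  · obtain ⟨a, rfl⟩ := ConQuot.surj ρ q
    exact ⟨a, a, hlt.1 (hρ.2.refl a), rfl⟩
  · obtain ⟨⟨a, b⟩, hab, hn⟩ := Set.exists_of_ssubset hlt
    exact ⟨_, _, ⟨a, b, hab, rfl⟩, fun he => hn ((ConQuot.eq_iff hρ).1 he)⟩
  · obtain ⟨a, rfl⟩ := ConQuot.surj ρ p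
    obtain ⟨b, rfl⟩ := ConQuot.surj ρ q
    let L : Set (A × A) := {p | (ConQuot.mk ρ p.1, ConQuot.mk ρ p.2) ∈ R}
    have hL : L ∈ {L | IsSubuniverse S L ∧ Saturated ρ L ∧ ρ ⊂ L} := by
      refine ⟨IsSubuniverse.comap_quot hρ hR, Set.Subset.antisymm ?_ ?_, ?_, fun hs => ?_⟩
      · rintro ⟨x, y⟩ ⟨x', hx, y', hxy, hy⟩
        have hxy : (ConQuot.mk ρ x', ConQuot.mk ρ y') ∈ R := hxy
        rwa [← (ConQuot.eq_iff hρ).2 hx, (ConQuot.eq_iff hρ).2 hy] at hxy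
      · rintro ⟨x, y⟩ hxy
        exact ⟨x, hρ.2.refl x, y, hxy, hρ.2.refl y⟩
      · rintro ⟨x, y⟩ hxy
        show (ConQuot.mk ρ x, ConQuot.mk ρ y) ∈ R
        rw [(ConQuot.eq_iff hρ).2 hxy]
        exact hrefl _
      · exact hne ((ConQuot.eq_iff hρ).2 (@hs (a, b) hpq))
    obtain ⟨M, hML, hM⟩ := (Set.toFinite _).exists_le_minimal hL
    have hM' : M ∈ Cov S ρ := ⟨hM.1.1, hM.1.2.1, hM.1.2.2, fun L' h1 h2 h3 h4 =>
      Set.Subset.antisymm h4 (hM.2 ⟨h1, h2, h3⟩ h4)⟩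
    rw [h] at hM'
    obtain rfl : M = ρstar := hM'
    rintro _ ⟨x, y, hxy, rfl⟩
    exact hML hxy

theorem exists_bridge_quot_iff (hρ : IsCongruence S ρ) (hσ : IsCongruence S σ) :
    (∃ T : Set (A × A × B × B), IsBridge S ρ σ T) ↔
      letI := quotAlg iA ρ
      letI := quotAlg iB σ
      ∃ T : Set (ConQuot ρ × ConQuot ρ × ConQuot σ × ConQuot σ),
        IsBridge S (diag (ConQuot ρ)) (diag (ConQuot σ)) T := by
  let := quotAlg iA ρ
  let := quotAlg iB σ
  constructor
  · rintro ⟨T, hT, -, -, hL, hR, heqv⟩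
    obtain ⟨⟨a, a'⟩, ⟨b, b', hz⟩, hn⟩ := Set.exists_of_ssubset hL
    refine ⟨{z | ∃ a a' b b', (a, a', b, b') ∈ T ∧
      z = (ConQuot.mk ρ a, ConQuot.mk ρ a', ConQuot.mk σ b, ConQuot.mk σ b')},
      isBridge_of_traces (fun o x hx => ?_) (fun p => ?_) (fun q => ?_) ?_
      ⟨a, a', b, b', hz, rfl⟩ fun he => hn ((ConQuot.eq_iff hρ).1 he)⟩
    · choose a a' b b' hz hx using hx
      refine ⟨_, _, _, _, hT o (fun i => (a i, a' i, b i, b' i)) hz, ?_⟩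
      rw [show x = _ from funext hx]
      exact Prod.ext (ConQuot.interp_mk hρ o a) (Prod.ext (ConQuot.interp_mk hρ o a')
        (Prod.ext (ConQuot.interp_mk hσ o b) (ConQuot.interp_mk hσ o b')))
    · obtain ⟨a, rfl⟩ := ConQuot.surj ρ p
      obtain ⟨b, b', hz⟩ := hL.1 (hρ.2.refl a)
      refine ⟨ConQuot.mk σ b, a, a, b, b', hz, ?_⟩
      rw [(ConQuot.eq_iff hσ).2 ((heqv _ _ _ _ hz).1 (hρ.2.refl a))]
    · obtain ⟨b, rfl⟩ := ConQuot.surj σ q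
      obtain ⟨a, a', hz⟩ := hR.1 (hσ.2.refl b)
      refine ⟨ConQuot.mk ρ a, a, a', b, b, hz, ?_⟩
      rw [(ConQuot.eq_iff hρ).2 ((heqv _ _ _ _ hz).2 (hσ.2.refl b))]
    · rintro _ _ _ _ ⟨a, a', b, b', hz, he⟩
      simp only [Prod.mk.injEq] at he
      obtain ⟨rfl, rfl, rfl, rfl⟩ := he
      rw [ConQuot.eq_iff hρ, ConQuot.eq_iff hσ]
      exact heqv _ _ _ _ hz
  · rintro ⟨T, hT, -, -, hL, hR, heqv⟩
    have heqv : ∀ a a' b b', (a, a', b, b') ∈ T → (a = a' ↔ b = b') := heqv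
    have hmkL : ∀ {a a'}, (ConQuot.mk ρ a, ConQuot.mk ρ a') ∈ pr12 T → ∃ b b',
        (ConQuot.mk ρ a, ConQuot.mk ρ a', ConQuot.mk σ b, ConQuot.mk σ b') ∈ T := by
      rintro a a' ⟨p, p', hz⟩
      obtain ⟨b, rfl⟩ := ConQuot.surj σ p
      obtain ⟨b', rfl⟩ := ConQuot.surj σ p'
      exact ⟨b, b', hz⟩
    have hmkR : ∀ {b b'}, (ConQuot.mk σ b, ConQuot.mk σ b') ∈ pr34 T → ∃ a a',
        (ConQuot.mk ρ a, ConQuot.mk ρ a', ConQuot.mk σ b, ConQuot.mk σ b') ∈ T := by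
      rintro b b' ⟨p, p', hz⟩
      obtain ⟨a, rfl⟩ := ConQuot.surj ρ p
      obtain ⟨a', rfl⟩ := ConQuot.surj ρ p'
      exact ⟨a, a', hz⟩
    refine ⟨{z | (ConQuot.mk ρ z.1, ConQuot.mk ρ z.2.1, ConQuot.mk σ z.2.2.1,
      ConQuot.mk σ z.2.2.2) ∈ T}, ?_, ?_, ?_, ⟨?_, fun hs => ?_⟩, ⟨?_, fun hs => ?_⟩, ?_⟩
    · intro o x hx
      have := hT o _ hx
      have e : SAlg.interp o (fun i => (ConQuot.mk ρ (x i).1, ConQuot.mk ρ (x i).2.1,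
          ConQuot.mk σ (x i).2.2.1, ConQuot.mk σ (x i).2.2.2)) = (ConQuot.mk ρ (SAlg.interp o x).1,
          ConQuot.mk ρ (SAlg.interp o x).2.1, ConQuot.mk σ (SAlg.interp o x).2.2.1,
          ConQuot.mk σ (SAlg.interp o x).2.2.2) :=
        Prod.ext (ConQuot.interp_mk hρ o fun i => (x i).1)
          (Prod.ext (ConQuot.interp_mk hρ o fun i => (x i).2.1)
            (Prod.ext (ConQuot.interp_mk hσ o fun i => (x i).2.2.1)
              (ConQuot.interp_mk hσ o fun i => (x i).2.2.2)))
      rwa [e] at this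
    · intro a₁ a₂ b₁ b₂ a₁' a₂' hz h1 h2
      have hz : (ConQuot.mk ρ a₁, ConQuot.mk ρ a₂, ConQuot.mk σ b₁, ConQuot.mk σ b₂) ∈ T := hz
      rwa [(ConQuot.eq_iff hρ).2 h1, (ConQuot.eq_iff hρ).2 h2] at hz
    · intro a₁ a₂ b₁ b₂ b₁' b₂' hz h1 h2
      have hz : (ConQuot.mk ρ a₁, ConQuot.mk ρ a₂, ConQuot.mk σ b₁, ConQuot.mk σ b₂) ∈ T := hz
      rwa [(ConQuot.eq_iff hσ).2 h1, (ConQuot.eq_iff hσ).2 h2] at hz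
    · rintro ⟨a, a'⟩ haa
      exact hmkL (hL.1 ((ConQuot.eq_iff hρ).2 haa))
    · obtain ⟨⟨p, p'⟩, hpp, hn⟩ := Set.exists_of_ssubset hL
      obtain ⟨a, rfl⟩ := ConQuot.surj ρ p
      obtain ⟨a', rfl⟩ := ConQuot.surj ρ p'
      exact hn ((ConQuot.eq_iff hρ).2 (@hs (a, a') (hmkL hpp)))
    · rintro ⟨b, b'⟩ hbb
      exact hmkR (hR.1 ((ConQuot.eq_iff hσ).2 hbb))
    · obtain ⟨⟨p, p'⟩, hpp, hn⟩ := Set.exists_of_ssubset hR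
      obtain ⟨b, rfl⟩ := ConQuot.surj σ p
      obtain ⟨b', rfl⟩ := ConQuot.surj σ p'
      exact hn ((ConQuot.eq_iff hσ).2 (@hs (b, b') (hmkR hpp)))
    · intro a a' b b' hz
      rw [← ConQuot.eq_iff hρ, ← ConQuot.eq_iff hσ]
      exact heqv _ _ _ _ hz

end Quotient

end Zhuk

/-- for irreducible congruences, there exists a bridge from `(A,ρ)` to
`(B,σ)` if and only if `A/ρ ∼ B/σ`. -/
theorem stmt_19 {S : Zhuk.Signature} {A B : Type} [iA : Zhuk.SAlg S A] [iB : Zhuk.SAlg S B]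
    [Finite A] [Finite B]
    (hTay : Zhuk.CommonTaylor S A B)
    (ρ ρstar : Set (A × A)) (σ σstar : Set (B × B))
    (hρ : Zhuk.ConStar S ρ) (hσ : Zhuk.ConStar S σ)
    (hρirr : Zhuk.Cov S ρ = {ρstar}) (hσirr : Zhuk.Cov S σ = {σstar}) :
    (∃ T : Set (A × A × B × B), Zhuk.IsBridge S ρ σ T) ↔
      Zhuk.SimilarI S (Zhuk.quotAlg iA ρ) (Zhuk.quotAlg iB σ) := by
  let := Zhuk.quotAlg iA ρ
  let := Zhuk.quotAlg iB σ
  obtain ⟨n, t, u, v, hn, huv, htA, htB⟩ := hTay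
  exact (Zhuk.exists_bridge_quot_iff hρ.1 hσ.1).trans
    (Zhuk.exists_bridge_iff_similarI ⟨n, t, u, v, hn, huv, htA.quot hρ.1, htB.quot hσ.1⟩
      (Zhuk.irr_quot hρ.1 hρirr) (Zhuk.irr_quot hσ.1 hσirr))
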